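/- (Half-dispersion for antisymmetric channels.) For every antisymmetric CM-DMBC satisfying the standing assumptions (unique CAID, full-support CAID, and C_k > C for k = 1,2) and every ε ∈ (0, 1/2), there exist a constant K > 0 and an integer n₀ such that for all n ≥ n₀, | log M*_f(n, ε) − ( nC − √(nV₁/2)·Q^{−1}(2ε) ) | ≤ K·n^{1/3}·log n, where V₁ = V₁(P*) and P* is the uniform distribution on 𝒳. -/

import Mathlib

open Finset

noncomputable section

variable {𝒳 𝒴 : Type*} [Fintype 𝒳] [Fintype 𝒴]

/-- `P` is a probability distribution on the finite alphabet `𝒳`. -/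
def IsDist (P : 𝒳 → ℝ) : Prop := (∀ x, 0 ≤ P x) ∧ ∑ x, P x = 1

/-- The output distribution `PW` induced by input distribution `P` and channel `W`. -/
def outDist (P : 𝒳 → ℝ) (W : 𝒳 → 𝒴 → ℝ) (y : 𝒴) : ℝ := ∑ x, P x * W x y

/-- The mutual information `I(P, W)` (natural logarithm). -/
def mutInfo (P : 𝒳 → ℝ) (W : 𝒳 → 𝒴 → ℝ) : ℝ :=
  ∑ x, ∑ y, P x * W x y * Real.log (W x y / outDist P W y)

/-- Relative entropy (KL divergence) between two pmfs on a finite alphabet. -/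
def relEnt (p q : 𝒴 → ℝ) : ℝ := ∑ y, p y * Real.log (p y / q y)

/-- Directional derivative `∇I_k(v)` of the mutual information at `P*` along `v`. -/
def gradI (Pstar : 𝒳 → ℝ) (W : 𝒳 → 𝒴 → ℝ) (v : 𝒳 → ℝ) : ℝ :=
  ∑ x, v x * relEnt (W x) (outDist Pstar W)

/-- Per-symbol information density `i_{P,W}(x;y)`. -/
def infoDens (P : 𝒳 → ℝ) (W : 𝒳 → 𝒴 → ℝ) (x : 𝒳) (y : 𝒴) : ℝ :=
  Real.log (W x y / outDist P W y)

/-- Causality of a feedback encoder: the input at time `i` depends on the message and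
on the channel outputs at times `< i` only. -/
def Causal (n M : ℕ) (f : Fin M → (Fin n → 𝒴) → (Fin n → 𝒴) → Fin n → 𝒳) : Prop :=
  ∀ (j : Fin M) (y1 y1' y2 y2' : Fin n → 𝒴) (i : Fin n),
    (∀ t, t < i → y1 t = y1' t) → (∀ t, t < i → y2 t = y2' t) →
      f j y1 y2 i = f j y1' y2' i

/-- The joint law `ℙ(j, y₁ⁿ, y₂ⁿ)` induced by an FLF code:
`(1/M) ∏ᵢ W₁(y₁ᵢ | fᵢ(j, y₁^{i-1}, y₂^{i-1})) W₂(y₂ᵢ | fᵢ(j, y₁^{i-1}, y₂^{i-1}))`. -/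
def codeLaw (W1 W2 : 𝒳 → 𝒴 → ℝ) (n M : ℕ)
    (f : Fin M → (Fin n → 𝒴) → (Fin n → 𝒴) → Fin n → 𝒳)
    (j : Fin M) (y1 y2 : Fin n → 𝒴) : ℝ :=
  (1 / M) * ∏ i, (W1 (f j y1 y2 i) (y1 i) * W2 (f j y1 y2 i) (y2 i))

/-- Error probability `ℙ[g(Y₁ⁿ) ≠ J]` at decoder 1. -/
def errProb1 (W1 W2 : 𝒳 → 𝒴 → ℝ) (n M : ℕ)
    (f : Fin M → (Fin n → 𝒴) → (Fin n → 𝒴) → Fin n → 𝒳)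
    (g : (Fin n → 𝒴) → Fin M) : ℝ :=
  ∑ j, ∑ y1 : Fin n → 𝒴, ∑ y2 : Fin n → 𝒴,
    if g y1 = j then 0 else codeLaw W1 W2 n M f j y1 y2

/-- Error probability `ℙ[g(Y₂ⁿ) ≠ J]` at decoder 2. -/
def errProb2 (W1 W2 : 𝒳 → 𝒴 → ℝ) (n M : ℕ)
    (f : Fin M → (Fin n → 𝒴) → (Fin n → 𝒴) → Fin n → 𝒳)
    (g : (Fin n → 𝒴) → Fin M) : ℝ :=
  ∑ j, ∑ y1 : Fin n → 𝒴, ∑ y2 : Fin n → 𝒴,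
    if g y2 = j then 0 else codeLaw W1 W2 n M f j y1 y2

/-- Per-symbol conditional variance `Var_{Y ∼ W(·|x)}(i_{P,W}(x;Y))`. -/
def symbVar (P : 𝒳 → ℝ) (W : 𝒳 → 𝒴 → ℝ) (x : 𝒳) : ℝ :=
  ∑ y, W x y * (infoDens P W x y - ∑ y', W x y' * infoDens P W x y') ^ 2

/-- Conditional information variance `V(P) = Σₓ P(x) Var_{Y∼W(·|x)}(i_{P,W}(x;Y))`. -/
def condInfoVar (P : 𝒳 → ℝ) (W : 𝒳 → 𝒴 → ℝ) : ℝ := ∑ x, P x * symbVar P W x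

/-- Existence of an `(n, M, ε)` fixed-length feedback code. -/
def FLFExists (W1 W2 : 𝒳 → 𝒴 → ℝ) (n M : ℕ) (ε : ℝ) : Prop :=
  ∃ f : Fin M → (Fin n → 𝒴) → (Fin n → 𝒴) → Fin n → 𝒳,
    Causal n M f ∧
      ∃ g1 g2 : (Fin n → 𝒴) → Fin M,
        errProb1 W1 W2 n M f g1 ≤ ε ∧ errProb2 W1 W2 n M f g2 ≤ ε

/-- `M*_f(n, ε)`: the maximum code size of `(n, M, ε)`-FLF codes. -/
noncomputable def MstarF (W1 W2 : 𝒳 → 𝒴 → ℝ) (n : ℕ) (ε : ℝ) : ℕ :=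
  sSup {M | FLFExists W1 W2 n M ε}

/-- The Gaussian tail function `Q(t)`. -/
noncomputable def Qfun (t : ℝ) : ℝ :=
  ∫ u in Set.Ioi t, Real.exp (-u ^ 2 / 2) / Real.sqrt (2 * Real.pi)

/-- The inverse `Q⁻¹` of the Gaussian tail function (on `(0,1)`). -/
noncomputable def Qinv : ℝ → ℝ := Function.invFun Qfun

/-- A weakly symmetric stochastic matrix with `N` rows, supported on the output
set `S`: nonnegative entries, rows supported on `S` summing to one, each row a
permutation (within `S`) of any other row, and all column sums over `S` equal. -/
def WeaklySymmetricOn (S : Finset 𝒴) (N : ℕ) (Mtx : Fin N → 𝒴 → ℝ) : Prop :=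
  (∀ u y, 0 ≤ Mtx u y) ∧
  (∀ u y, y ∉ S → Mtx u y = 0) ∧
  (∀ u, ∑ y ∈ S, Mtx u y = 1) ∧
  (∀ u u', ∃ σ : 𝒴 ≃ 𝒴, (∀ y ∈ S, σ y ∈ S) ∧ ∀ y ∈ S, Mtx u' (σ y) = Mtx u y) ∧
  (∀ y ∈ S, ∀ y' ∈ S, ∑ u, Mtx u y = ∑ u, Mtx u y')

/-- The uniform input distribution on `𝒳 = Fin 2 × Fin N` (an alphabet of size `2N`). -/
def unifDist (N : ℕ) : Fin 2 × Fin N → ℝ := fun _ => 1 / (2 * N)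

/-! ### The Gaussian tail function -/

/-- The standard Gaussian density. -/
def stdGauss (x : ℝ) : ℝ := Real.exp (-x ^ 2 / 2) / Real.sqrt (2 * Real.pi)

theorem stdGauss_pos (x : ℝ) : 0 < stdGauss x := by
  unfold stdGauss; positivity

theorem continuous_stdGauss : Continuous stdGauss := by
  unfold stdGauss; fun_prop

theorem integrable_stdGauss : MeasureTheory.Integrable stdGauss := by
  have h := (integrable_exp_neg_mul_sq (b := 1 / 2) (by norm_num)).div_const
    (Real.sqrt (2 * Real.pi))
  refine h.congr (Filter.Eventually.of_forall fun x => ?_)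
  simp only [stdGauss]
  congr 2
  ring

theorem integral_stdGauss : ∫ x, stdGauss x = 1 := by
  have h := integral_gaussian (1 / 2)
  have h2 : ∫ x, stdGauss x = (∫ x : ℝ, Real.exp (-(1 / 2) * x ^ 2)) / Real.sqrt (2 * Real.pi) := by
    rw [← MeasureTheory.integral_div]
    congr 1
    ext x
    simp only [stdGauss]
    congr 2
    ring
  rw [h2, h]
  have : Real.pi / (1 / 2) = 2 * Real.pi := by ring
  rw [this]
  exact div_self (by positivity)

theorem stdGauss_neg (x : ℝ) : stdGauss (-x) = stdGauss x := by
  simp [stdGauss]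

theorem Qfun_eq (t : ℝ) : Qfun t = ∫ u in Set.Ioi t, stdGauss u := rfl

theorem Qfun_eq_sub (t : ℝ) : Qfun t = Qfun 0 - ∫ u in (0 : ℝ)..t, stdGauss u := by
  rw [Qfun_eq, Qfun_eq, ← intervalIntegral.integral_Ioi_sub_Ioi'
    integrable_stdGauss.integrableOn integrable_stdGauss.integrableOn]
  ring

theorem hasDerivAt_Qfun (x : ℝ) : HasDerivAt Qfun (-stdGauss x) x := by
  have h : HasDerivAt (fun t => Qfun 0 - ∫ u in (0 : ℝ)..t, stdGauss u) (0 - stdGauss x) x :=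
    (hasDerivAt_const x _).sub
      (intervalIntegral.integral_hasDerivAt_right (continuous_stdGauss.intervalIntegrable _ _)
        (continuous_stdGauss.stronglyMeasurableAtFilter _ _) continuous_stdGauss.continuousAt)
  rw [zero_sub] at h
  exact h.congr_of_eventuallyEq (Filter.Eventually.of_forall Qfun_eq_sub)

theorem continuous_Qfun : Continuous Qfun :=
  continuous_iff_continuousAt.2 fun x => (hasDerivAt_Qfun x).continuousAt

theorem Qfun_nonneg (t : ℝ) : 0 ≤ Qfun t :=
  MeasureTheory.setIntegral_nonneg measurableSet_Ioi fun x _ => (stdGauss_pos x).le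

theorem Qfun_add_neg (t : ℝ) : Qfun t + Qfun (-t) = 1 := by
  have h1 : Qfun (-t) = ∫ u in Set.Iic t, stdGauss u := by
    rw [Qfun_eq, ← integral_comp_neg_Iic]
    simp [stdGauss_neg]
  rw [h1, Qfun_eq, add_comm, intervalIntegral.integral_Iic_add_Ioi
    integrable_stdGauss.integrableOn integrable_stdGauss.integrableOn, integral_stdGauss]

theorem Qfun_le_one (t : ℝ) : Qfun t ≤ 1 := by
  linarith [Qfun_add_neg t, Qfun_nonneg (-t)]

theorem Qfun_strictAnti : StrictAnti Qfun :=
  strictAnti_of_hasDerivAt_neg hasDerivAt_Qfun fun x => neg_neg_of_pos (stdGauss_pos x)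

theorem stdGauss_le_exp_neg (x : ℝ) : stdGauss x ≤ Real.exp (-x) := by
  unfold stdGauss
  have h3 : (2 : ℝ) ≤ Real.sqrt (2 * Real.pi) :=
    Real.le_sqrt_of_sq_le (by nlinarith [Real.pi_gt_three])
  have he : Real.exp (1 / 2) ≤ 2 := by
    have h : Real.exp (1 / 2) ^ 2 = Real.exp 1 := by
      rw [← Real.exp_nat_mul]; norm_num
    nlinarith [Real.exp_one_lt_d9, Real.exp_pos (1 / 2)]
  rw [div_le_iff₀ (by positivity)]
  calc Real.exp (-x ^ 2 / 2) ≤ Real.exp (-x + 1 / 2) :=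
        Real.exp_le_exp.2 (by nlinarith [sq_nonneg (x - 1)])
    _ = Real.exp (-x) * Real.exp (1 / 2) := Real.exp_add _ _
    _ ≤ _ := by gcongr; linarith

theorem Qfun_le_exp_neg (t : ℝ) : Qfun t ≤ Real.exp (-t) := by
  rw [Qfun_eq, ← integral_exp_neg_Ioi]
  exact MeasureTheory.setIntegral_mono_on integrable_stdGauss.integrableOn
    (integrableOn_exp_neg_Ioi t) measurableSet_Ioi
    fun x _ => stdGauss_le_exp_neg x

theorem Qfun_Qinv {p : ℝ} (hp : p ∈ Set.Ioo (0 : ℝ) 1) : Qfun (Qinv p) = p := by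
  have htop : Filter.Tendsto Qfun Filter.atTop (nhds 0) :=
    squeeze_zero Qfun_nonneg Qfun_le_exp_neg Real.tendsto_exp_neg_atTop_nhds_zero
  obtain ⟨b, hb⟩ := (htop.eventually (gt_mem_nhds hp.1)).exists
  obtain ⟨a, ha⟩ := (htop.eventually (gt_mem_nhds (sub_pos.2 hp.2))).exists
  have ha' : p < Qfun (-a) := by linarith [Qfun_add_neg a]
  have hex : ∃ x, Qfun x = p := by
    have := mem_range_of_exists_le_of_exists_ge continuous_Qfun ⟨b, hb.le⟩ ⟨-a, ha'.le⟩
    exact this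
  exact Function.invFun_eq hex

/-- Near any point, the Gaussian tail function decreases at least linearly. -/
theorem Qfun_local_slope (q : ℝ) : ∃ κ > 0, ∀ h, 0 ≤ h → h ≤ 1 →
    Qfun (q + h) ≤ Qfun q - κ * h ∧ Qfun q + κ * h ≤ Qfun (q - h) := by
  obtain ⟨x₀, -, hx₀⟩ := (isCompact_Icc (a := q - 1) (b := q + 1)).exists_isMinOn
    ⟨q, by constructor <;> linarith⟩ continuous_stdGauss.continuousOn
  refine ⟨stdGauss x₀, stdGauss_pos x₀, fun h h0 h1 => ?_⟩
  have key : ∀ a b, a ≤ b → q - 1 ≤ a → b ≤ q + 1 →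
      stdGauss x₀ * (b - a) ≤ -Qfun b - -Qfun a := by
    intro a b hab ha hb
    refine (convex_Icc (q - 1) (q + 1)).mul_sub_le_image_sub_of_le_deriv
      (continuous_Qfun.neg.continuousOn)
      (fun x _ => (hasDerivAt_Qfun x).neg.differentiableAt.differentiableWithinAt)
      (fun x hx => ?_) a ⟨ha, by linarith⟩ b ⟨by linarith, hb⟩ hab
    rw [interior_Icc] at hx
    have := (hasDerivAt_Qfun x).neg.deriv
    rw [this, neg_neg]
    exact hx₀ ⟨hx.1.le, hx.2.le⟩
  have k1 := key q (q + h) (by linarith) (by linarith) (by linarith)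
  have k2 := key (q - h) q (by linarith) (by linarith) (by linarith)
  constructor <;> nlinarith
/-! ### Taylor estimates and the Lindeberg replacement step -/

theorem abs_sub_taylor_one_le {f f1 f2 : ℝ → ℝ} {a b K : ℝ}
    (hf : ∀ t ∈ Set.uIcc a b, HasDerivAt f (f1 t) t)
    (hf1 : ∀ t ∈ Set.uIcc a b, HasDerivAt f1 (f2 t) t)
    (hK : ∀ t ∈ Set.uIcc a b, |f2 t| ≤ K) :
    |f b - f a - f1 a * (b - a)| ≤ K * |b - a| ^ 2 := by
  have hconv : Convex ℝ (Set.uIcc a b) := convex_uIcc a b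
  have ha : a ∈ Set.uIcc a b := Set.left_mem_uIcc
  have hb : b ∈ Set.uIcc a b := Set.right_mem_uIcc
  have hK0 : 0 ≤ K := (abs_nonneg _).trans (hK a ha)
  have h := hconv.norm_image_sub_le_of_norm_hasDerivWithin_le
    (f := fun t => f t - f1 a * (t - a)) (f' := fun t => f1 t - f1 a) (C := K * |b - a|)
    (fun t ht => by
      have h := (hf t ht).sub (((hasDerivAt_id t).sub_const a).const_mul (f1 a))
      exact (h.congr_deriv (by simp)).hasDerivWithinAt)
    (fun t ht => by
      have h1 := hconv.norm_image_sub_le_of_norm_hasDerivWithin_le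
        (fun t ht => (hf1 t ht).hasDerivWithinAt) (fun t ht => hK t ht) ha ht
      exact h1.trans (mul_le_mul_of_nonneg_left (Set.abs_sub_left_of_mem_uIcc ht) hK0))
    ha hb
  simp only [sub_self, mul_zero, sub_zero, Real.norm_eq_abs] at h
  calc _ = |f b - f1 a * (b - a) - f a| := by ring_nf
    _ ≤ _ := h
    _ = _ := by ring

theorem abs_sub_taylor_two_le {f f1 f2 f3 : ℝ → ℝ} {a b K : ℝ}
    (hf : ∀ t ∈ Set.uIcc a b, HasDerivAt f (f1 t) t)
    (hf1 : ∀ t ∈ Set.uIcc a b, HasDerivAt f1 (f2 t) t)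
    (hf2 : ∀ t ∈ Set.uIcc a b, HasDerivAt f2 (f3 t) t)
    (hK : ∀ t ∈ Set.uIcc a b, |f3 t| ≤ K) :
    |f b - f a - f1 a * (b - a) - f2 a * ((b - a) ^ 2 / 2)| ≤ K * |b - a| ^ 3 := by
  have ha : a ∈ Set.uIcc a b := Set.left_mem_uIcc
  have hb : b ∈ Set.uIcc a b := Set.right_mem_uIcc
  have hK0 : 0 ≤ K := (abs_nonneg _).trans (hK a ha)
  have h := (convex_uIcc a b).norm_image_sub_le_of_norm_hasDerivWithin_le
    (f := fun t => f t - f1 a * (t - a) - f2 a * ((t - a) ^ 2 / 2))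
    (f' := fun t => f1 t - f1 a - f2 a * (t - a)) (C := K * |b - a| ^ 2)
    (fun t ht => by
      have h1 := ((hasDerivAt_id t).sub_const a).const_mul (f1 a)
      have h2 := ((((hasDerivAt_id t).sub_const a).pow 2).div_const 2).const_mul (f2 a)
      have h := ((hf t ht).sub h1).sub h2
      exact (h.congr_deriv (by simp)).hasDerivWithinAt)
    (fun t ht => by
      have hsub : Set.uIcc a t ⊆ Set.uIcc a b := Set.uIcc_subset_uIcc ha ht
      have h1 := abs_sub_taylor_one_le (fun u hu => hf1 u (hsub hu))
        (fun u hu => hf2 u (hsub hu)) (fun u hu => hK u (hsub hu))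
      exact h1.trans (by gcongr K * ?_ ^ 2; exact Set.abs_sub_left_of_mem_uIcc ht))
    ha hb
  simp only [sub_self, mul_zero, sub_zero, Real.norm_eq_abs, ne_eq, OfNat.ofNat_ne_zero,
    not_false_eq_true, zero_pow, zero_div] at h
  calc _ = |f b - f1 a * (b - a) - f2 a * ((b - a) ^ 2 / 2) - f a| := by ring_nf
    _ ≤ _ := h
    _ = _ := by ring

theorem hasDerivAt_stdGauss (x : ℝ) : HasDerivAt stdGauss (-(x * stdGauss x)) x := by
  have h : HasDerivAt (fun y : ℝ => -y ^ 2 / 2) (-x) x := by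
    refine ((((hasDerivAt_id x).pow 2).neg).div_const 2).congr_deriv ?_
    simp only [Nat.cast_ofNat, id, Nat.add_one_sub_one, pow_one, mul_one]
    ring
  refine (h.exp.div_const (Real.sqrt (2 * Real.pi))).congr_deriv ?_
  unfold stdGauss
  ring

theorem hasDerivAt_id_mul_stdGauss (x : ℝ) :
    HasDerivAt (fun y => y * stdGauss y) ((1 - x ^ 2) * stdGauss x) x := by
  refine ((hasDerivAt_id x).mul (hasDerivAt_stdGauss x)).congr_deriv ?_
  simp only [id]
  ring

theorem two_mul_stdGauss_le (x : ℝ) : 2 * stdGauss x ≤ Real.exp (-x ^ 2 / 2) := by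
  unfold stdGauss
  have h3 : (2 : ℝ) ≤ Real.sqrt (2 * Real.pi) :=
    Real.le_sqrt_of_sq_le (by nlinarith [Real.pi_gt_three])
  rw [mul_div_assoc', div_le_iff₀ (by positivity), mul_comm]
  gcongr

theorem stdGauss_le_one (x : ℝ) : stdGauss x ≤ 1 := by
  have := two_mul_stdGauss_le x
  have h1 : Real.exp (-x ^ 2 / 2) ≤ 1 := Real.exp_le_one_iff.2 (by nlinarith [sq_nonneg x])
  linarith

theorem sq_mul_stdGauss_le (x : ℝ) : x ^ 2 * stdGauss x ≤ 1 := by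
  have h := two_mul_stdGauss_le x
  have h2 : Real.exp (-x ^ 2 / 2) * Real.exp (x ^ 2 / 2) = 1 := by
    rw [← Real.exp_add]; ring_nf; exact Real.exp_zero
  have h3 := Real.add_one_le_exp (x ^ 2 / 2)
  have h4 := Real.exp_pos (-x ^ 2 / 2)
  have h5 := sq_nonneg x
  nlinarith [mul_le_mul_of_nonneg_left h h5]

theorem pow_four_mul_stdGauss_le (x : ℝ) : x ^ 4 * stdGauss x ≤ 4 := by
  have h := two_mul_stdGauss_le x
  have h2 : Real.exp (-x ^ 2 / 2) * Real.exp (x ^ 2 / 2) = 1 := by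
    rw [← Real.exp_add]; ring_nf; exact Real.exp_zero
  have h3 := Real.quadratic_le_exp_of_nonneg (x := x ^ 2 / 2) (by positivity)
  have h4 := Real.exp_pos (-x ^ 2 / 2)
  have h5 : 0 ≤ x ^ 4 := by positivity
  have h6 : x ^ 4 / 8 ≤ Real.exp (x ^ 2 / 2) := by nlinarith [sq_nonneg x]
  nlinarith [mul_le_mul_of_nonneg_left h h5, mul_le_mul_of_nonneg_left h6 h4.le]

theorem abs_mul_stdGauss_le (x : ℝ) : |x * stdGauss x| ≤ 1 := by
  have h0 := stdGauss_pos x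
  rw [abs_mul, abs_of_pos h0]
  nlinarith [sq_mul_stdGauss_le x, stdGauss_le_one x, sq_abs x, sq_nonneg (|x| - 1)]

theorem abs_one_sub_sq_mul_stdGauss_le (x : ℝ) : |(1 - x ^ 2) * stdGauss x| ≤ 1 := by
  have h0 := stdGauss_pos x
  rw [abs_le]
  constructor <;> nlinarith [sq_mul_stdGauss_le x, stdGauss_le_one x, mul_nonneg (sq_nonneg x) h0.le]

theorem abs_cube_mul_stdGauss_le (x : ℝ) : |x ^ 3 * stdGauss x| ≤ 3 := by
  have h0 := stdGauss_pos x
  have h1 := sq_mul_stdGauss_le x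
  have h2 := pow_four_mul_stdGauss_le x
  rw [abs_le]
  constructor <;>
    nlinarith [mul_nonneg (mul_nonneg (sq_nonneg x) (sq_nonneg (x - 1))) h0.le,
      mul_nonneg (mul_nonneg (sq_nonneg x) (sq_nonneg (x + 1))) h0.le]

theorem hasDerivAt_div_sqrt (z : ℝ) {t : ℝ} (ht : 0 ≤ t) :
    HasDerivAt (fun t => z / Real.sqrt (1 + t))
      (-(z / Real.sqrt (1 + t)) / (2 * (1 + t))) t := by
  have h1 : (0 : ℝ) < 1 + t := by linarith
  have hs := Real.sqrt_pos.2 h1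
  have h := ((hasDerivAt_id t).const_add 1).sqrt h1.ne'
  have h2 := (h.inv hs.ne').const_mul z
  refine h2.congr_deriv ?_
  simp only [id]
  rw [Real.sq_sqrt h1.le]
  field_simp

/-- Variation of the Gaussian tail under a change of scale. -/
theorem abs_Qfun_div_sqrt_sub_le (z : ℝ) {θ : ℝ} (hθ : 0 ≤ θ) :
    |Qfun (z / Real.sqrt (1 + θ)) - Qfun z - z * stdGauss z / 2 * θ| ≤ 3 * θ ^ 2 := by
  set w : ℝ → ℝ := fun t => z / Real.sqrt (1 + t) with hw
  have hnn : ∀ t ∈ Set.uIcc 0 θ, 0 ≤ t := fun t ht => by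
    rw [Set.uIcc_of_le hθ] at ht; exact ht.1
  have key := abs_sub_taylor_one_le (a := 0) (b := θ) (K := 3)
    (f := fun t => Qfun (w t)) (f1 := fun t => w t * stdGauss (w t) / (2 * (1 + t)))
    (f2 := fun t => ((1 - w t ^ 2) * stdGauss (w t) * (-w t / (2 * (1 + t))) * (2 * (1 + t))
      - w t * stdGauss (w t) * 2) / (2 * (1 + t)) ^ 2)
    (fun t ht => by
      have h := (hasDerivAt_Qfun (w t)).comp t (hasDerivAt_div_sqrt z (hnn t ht))
      refine h.congr_deriv ?_
      simp only [hw]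
      ring)
    (fun t ht => by
      have h1 : (0 : ℝ) < 1 + t := by linarith [hnn t ht]
      have h := (hasDerivAt_id_mul_stdGauss (w t)).comp t (hasDerivAt_div_sqrt z (hnn t ht))
      have h2 : HasDerivAt (fun t : ℝ => 2 * (1 + t)) 2 t := by
        simpa using ((hasDerivAt_id t).const_add 1).const_mul 2
      exact h.div h2 (by positivity))
    (fun t ht => by
      have h1 : (1 : ℝ) ≤ 1 + t := by linarith [hnn t ht]
      have e1 := abs_le.1 (abs_mul_stdGauss_le (w t))
      have e2 := abs_le.1 (abs_cube_mul_stdGauss_le (w t))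
      have e : (1 - w t ^ 2) * stdGauss (w t) * (-w t / (2 * (1 + t))) * (2 * (1 + t))
        - w t * stdGauss (w t) * 2 = w t ^ 3 * stdGauss (w t) - 3 * (w t * stdGauss (w t)) := by
        field_simp
        ring
      rw [e, abs_div, div_le_iff₀ (by positivity), abs_of_pos (a := (2 * (1 + t)) ^ 2) (by positivity)]
      rw [abs_le]
      constructor <;> nlinarith)
  have hw0 : w 0 = z := by simp [hw]
  simp only [hw0, add_zero, mul_one, sub_zero, sq_abs] at key
  exact key

theorem hasDerivAt_neg_stdGauss (x : ℝ) :
    HasDerivAt (fun y => -stdGauss y) (x * stdGauss x) x := by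
  simpa using (hasDerivAt_stdGauss x).fun_neg

theorem abs_Qfun_taylor_le (z h : ℝ) :
    |Qfun (z + h) - Qfun z + stdGauss z * h - z * stdGauss z * (h ^ 2 / 2)| ≤ |h| ^ 3 := by
  have key := abs_sub_taylor_two_le (a := z) (b := z + h) (K := 1)
    (fun t _ => hasDerivAt_Qfun t) (fun t _ => hasDerivAt_neg_stdGauss t)
    (fun t _ => hasDerivAt_id_mul_stdGauss t) (fun t _ => abs_one_sub_sq_mul_stdGauss_le t)
  simp only [add_sub_cancel_left, one_mul] at key
  convert key using 2
  ring

/-- One replacement step of Lindeberg's method for the Gaussian tail function. -/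
theorem lindeberg_step {ι : Type*} [Fintype ι] {p ψ : ι → ℝ} {v B s : ℝ} (x : ℝ)
    (hp : ∀ i, 0 ≤ p i) (hp1 : ∑ i, p i = 1) (hmean : ∑ i, p i * ψ i = 0)
    (hvar : ∑ i, p i * ψ i ^ 2 = v) (hB : ∀ i, p i ≠ 0 → |ψ i| ≤ B) (hs : 0 < s) :
    |∑ i, p i * Qfun ((x + ψ i) / Real.sqrt s) - Qfun (x / Real.sqrt (s + v))|
      ≤ B ^ 3 / (s * Real.sqrt s) + 3 * v ^ 2 / s ^ 2 := by
  have hv : 0 ≤ v := hvar ▸ sum_nonneg fun i _ => mul_nonneg (hp i) (sq_nonneg _)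
  have hr := Real.sqrt_pos.2 hs
  have hrs : Real.sqrt s ^ 2 = s := Real.sq_sqrt hs.le
  set r := Real.sqrt s with hrdef
  set z := x / r with hz
  have hscale : x / Real.sqrt (s + v) = z / Real.sqrt (1 + v / s) := by
    have : s + v = s * (1 + v / s) := by field_simp
    rw [this, Real.sqrt_mul hs.le, ← div_div]
  have h1 := abs_Qfun_div_sqrt_sub_le z (div_nonneg hv hs.le)
  rw [← hscale] at h1
  have hsum : ∑ i, p i * (Qfun ((x + ψ i) / r) - Qfun z + stdGauss z * (ψ i / r)
      - z * stdGauss z * ((ψ i / r) ^ 2 / 2)) =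
      ∑ i, p i * Qfun ((x + ψ i) / r) - Qfun z - z * stdGauss z / 2 * (v / s) := by
    have e : ∀ i, p i * (Qfun ((x + ψ i) / r) - Qfun z + stdGauss z * (ψ i / r)
      - z * stdGauss z * ((ψ i / r) ^ 2 / 2)) = p i * Qfun ((x + ψ i) / r) - p i * Qfun z
        + (p i * ψ i) * (stdGauss z / r) - (p i * ψ i ^ 2) * (z * stdGauss z / 2 / s) := by
      intro i
      rw [← hrs]
      field_simp
    simp only [e, sum_sub_distrib, sum_add_distrib, ← sum_mul, hp1, hmean, hvar]
    ring
  have h2 : |∑ i, p i * (Qfun ((x + ψ i) / r) - Qfun z + stdGauss z * (ψ i / r)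
      - z * stdGauss z * ((ψ i / r) ^ 2 / 2))| ≤ B ^ 3 / (s * r) := by
    have hterm : ∀ i ∈ univ, |p i * (Qfun ((x + ψ i) / r) - Qfun z + stdGauss z * (ψ i / r)
      - z * stdGauss z * ((ψ i / r) ^ 2 / 2))| ≤ p i * (B ^ 3 / (s * r)) := by
      intro i _
      rw [abs_mul, abs_of_nonneg (hp i)]
      by_cases hpi : p i = 0
      · simp [hpi]
      refine mul_le_mul_of_nonneg_left ?_ (hp i)
      have ht := abs_Qfun_taylor_le z (ψ i / r)
      rw [hz, ← add_div] at ht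
      refine ht.trans ?_
      rw [abs_div, abs_of_pos hr, div_pow, show s * r = r ^ 3 by rw [← hrs]; ring]
      gcongr
      exact hB i hpi
    refine (abs_sum_le_sum_abs _ _).trans ((sum_le_sum hterm).trans ?_)
    rw [← sum_mul, hp1, one_mul]
  rw [hsum] at h2
  have e3 : 3 * (v / s) ^ 2 = 3 * v ^ 2 / s ^ 2 := by ring
  rw [e3] at h1
  rw [abs_le] at *
  constructor <;> linarith

theorem div_mul_sqrt_le_telescope {s v : ℝ} (hs : 0 < s) (hv : 0 ≤ v) (hvs : v ≤ s) :
    v / (s * Real.sqrt s) ≤ 4 / Real.sqrt s - 4 / Real.sqrt (s + v) := by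
  have ha := Real.sqrt_pos.2 hs
  have hb := Real.sqrt_pos.2 (show 0 < s + v by linarith)
  have ha2 : Real.sqrt s ^ 2 = s := Real.sq_sqrt hs.le
  have hb2 : Real.sqrt (s + v) ^ 2 = s + v := Real.sq_sqrt (by linarith)
  set a := Real.sqrt s
  set b := Real.sqrt (s + v)
  have hab : a ≤ b := Real.sqrt_le_sqrt (by linarith)
  have hb3 : b ≤ 3 / 2 * a := by
    by_contra h
    push Not at h
    nlinarith
  have hva : v = (b - a) * (b + a) := by nlinarith
  rw [hva, ← ha2, div_sub_div _ _ ha.ne' hb.ne', div_le_div_iff₀ (by positivity) (by positivity)]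
  have h4 : (b + a) * b ≤ 4 * a ^ 2 := by nlinarith
  have h5 : 0 ≤ (b - a) * a := mul_nonneg (by linarith) ha.le
  nlinarith [mul_le_mul_of_nonneg_left h4 h5]
/-! ### Channels used with causal feedback -/

section Feedback

variable {A Z : Type*}

/-- A feedback strategy whose input at time `i` only depends on the outputs at times `< i`. -/
def IsCausal {n : ℕ} (f : (Fin n → Z) → Fin n → A) : Prop :=
  ∀ z z' i, (∀ t, t < i → z t = z' t) → f z i = f z' i

/-- The law of the outputs of the channel `W` used with the feedback strategy `f`. -/
def feedbackLaw {n : ℕ} (W : A → Z → ℝ) (f : (Fin n → Z) → Fin n → A) (z : Fin n → Z) : ℝ :=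
  ∏ i, W (f z i) (z i)

theorem feedbackLaw_nonneg {n : ℕ} {W : A → Z → ℝ} (hW : ∀ x z, 0 ≤ W x z)
    (f : (Fin n → Z) → Fin n → A) (z : Fin n → Z) : 0 ≤ feedbackLaw W f z :=
  prod_nonneg fun _ _ => hW _ _

/-- The strategy induced on the first `n` channel uses. -/
def initStrategy {n : ℕ} [Nonempty Z] (f : (Fin (n + 1) → Z) → Fin (n + 1) → A)
    (z : Fin n → Z) (i : Fin n) : A :=
  f (Fin.snoc (α := fun _ => Z) z (Classical.arbitrary Z)) i.castSucc

theorem IsCausal.initStrategy {n : ℕ} [Nonempty Z] {f : (Fin (n + 1) → Z) → Fin (n + 1) → A}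
    (hf : IsCausal f) : IsCausal (initStrategy f) := by
  intro z z' i h
  refine hf _ _ _ fun t ht => ?_
  induction t using Fin.lastCases with
  | last => exact absurd ht (not_lt.2 (Fin.le_last _))
  | cast t => simpa using h t (by simpa using ht)

/-- Expectations under a feedback law can be computed by averaging over the last output first. -/
theorem sum_feedbackLaw_succ {n : ℕ} [Fintype Z] [Nonempty Z] (W : A → Z → ℝ)
    {f : (Fin (n + 1) → Z) → Fin (n + 1) → A} (hf : IsCausal f) (F : (Fin (n + 1) → Z) → ℝ) :
    ∑ z, feedbackLaw W f z * F z = ∑ z : Fin n → Z, feedbackLaw W (initStrategy f) z *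
      ∑ a, W (f (Fin.snoc (α := fun _ => Z) z (Classical.arbitrary Z)) (Fin.last n)) a *
        F (Fin.snoc (α := fun _ => Z) z a) := by
  rw [← (Fin.snocEquiv fun _ : Fin (n + 1) => Z).sum_comp, Fintype.sum_prod_type_right]
  refine sum_congr rfl fun z _ => ?_
  rw [mul_sum]
  refine sum_congr rfl fun a _ => ?_
  have hlast : f (Fin.snoc (α := fun _ => Z) z a) (Fin.last n) =
      f (Fin.snoc (α := fun _ => Z) z (Classical.arbitrary Z)) (Fin.last n) := by
    refine hf _ _ _ fun t ht => ?_
    induction t using Fin.lastCases with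
    | last => exact absurd ht (lt_irrefl _)
    | cast t => simp
  have hcast : ∀ i : Fin n, f (Fin.snoc (α := fun _ => Z) z a) i.castSucc = initStrategy f z i := by
    intro i
    refine hf _ _ _ fun t ht => ?_
    induction t using Fin.lastCases with
    | last => exact absurd ht (not_lt.2 (Fin.le_last _))
    | cast t => simp
  change feedbackLaw W f (Fin.snoc (α := fun _ => Z) z a) * F (Fin.snoc (α := fun _ => Z) z a) = _
  simp only [feedbackLaw, Fin.prod_univ_castSucc, hlast, hcast, Fin.snoc_castSucc, Fin.snoc_last]
  ring

theorem sum_feedbackLaw {n : ℕ} [Fintype Z] [Nonempty Z] {W : A → Z → ℝ} (hW1 : ∀ x, ∑ z, W x z = 1)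
    {f : (Fin n → Z) → Fin n → A} (hf : IsCausal f) : ∑ z, feedbackLaw W f z = 1 := by
  induction n with
  | zero => simp [feedbackLaw]
  | succ n ih =>
    have h := sum_feedbackLaw_succ W hf fun _ => 1
    simp only [mul_one, hW1] at h
    rw [h, ih hf.initStrategy]

/-- Lindeberg's method for sums along a feedback strategy whose conditional means and variances
do not depend on the input. -/
theorem abs_sum_feedbackLaw_Qfun_sub_le [Fintype Z] [Nonempty Z] {W : A → Z → ℝ}
    {ψ : A → Z → ℝ} {v B : ℝ}
    (hW : ∀ x z, 0 ≤ W x z) (hW1 : ∀ x, ∑ z, W x z = 1) (hmean : ∀ x, ∑ z, W x z * ψ x z = 0)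
    (hvar : ∀ x, ∑ z, W x z * ψ x z ^ 2 = v) (hB : ∀ x z, W x z ≠ 0 → |ψ x z| ≤ B)
    (hB0 : 0 ≤ B) (hv : 0 < v) {n : ℕ} {f : (Fin n → Z) → Fin n → A} (hf : IsCausal f)
    {s : ℝ} (hs : 1 ≤ s) (hvs : v ≤ s) (x : ℝ) :
    |∑ z, feedbackLaw W f z * Qfun ((x + ∑ i, ψ (f z i) (z i)) / Real.sqrt s) -
      Qfun (x / Real.sqrt (s + n * v))| ≤
      (B ^ 3 + 3 * v ^ 2) / v * (4 / Real.sqrt s - 4 / Real.sqrt (s + n * v)) := by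
  induction n generalizing s with
  | zero => simp [feedbackLaw]
  | succ n ih =>
    have hs0 : 0 < s := by linarith
    set c := (B ^ 3 + 3 * v ^ 2) / v with hc
    have hc0 : 0 ≤ c := by positivity
    have ih' := ih hf.initStrategy (s := s + v) (by linarith) (by linarith)
    rw [show s + v + n * v = s + (n + 1 : ℕ) * v by push_cast; ring] at ih'
    have hlast : ∀ (z : Fin n → Z) a, f (Fin.snoc (α := fun _ => Z) z a) (Fin.last n) =
      f (Fin.snoc (α := fun _ => Z) z (Classical.arbitrary Z)) (Fin.last n) := by
      intro z a
      refine hf _ _ _ fun t ht => ?_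
      induction t using Fin.lastCases with
      | last => exact absurd ht (lt_irrefl _)
      | cast t => simp
    have hcast : ∀ (z : Fin n → Z) a (i : Fin n),
        f (Fin.snoc (α := fun _ => Z) z a) i.castSucc = initStrategy f z i := by
      intro z a i
      refine hf _ _ _ fun t ht => ?_
      induction t using Fin.lastCases with
      | last => exact absurd ht (not_lt.2 (Fin.le_last _))
      | cast t => simp
    rw [sum_feedbackLaw_succ W hf]
    simp only [Fin.sum_univ_castSucc, Fin.snoc_castSucc, Fin.snoc_last, hlast, hcast]
    set S : (Fin n → Z) → ℝ := fun z => ∑ i, ψ (initStrategy f z i) (z i)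
    set l : (Fin n → Z) → A := fun z =>
      f (Fin.snoc (α := fun _ => Z) z (Classical.arbitrary Z)) (Fin.last n)
    have hstep : ∀ z, |∑ a, W (l z) a * Qfun ((x + (S z + ψ (l z) a)) / Real.sqrt s) -
        Qfun ((x + S z) / Real.sqrt (s + v))| ≤
        c * (4 / Real.sqrt s - 4 / Real.sqrt (s + v)) := by
      intro z
      have h1 := lindeberg_step (x + S z) (hW (l z)) (hW1 (l z)) (hmean (l z)) (hvar (l z))
        (hB (l z)) hs0
      simp only [add_assoc] at h1 ⊢
      refine h1.trans ?_
      have h2 : 3 * v ^ 2 / s ^ 2 ≤ 3 * v ^ 2 / (s * Real.sqrt s) := by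
        gcongr
        rw [sq]
        gcongr
        exact Real.sqrt_le_iff.2 ⟨hs0.le, by nlinarith⟩
      have h3 := mul_le_mul_of_nonneg_left (div_mul_sqrt_le_telescope hs0 hv.le hvs) hc0
      refine le_trans ?_ h3
      have h4 : c * (v / (s * Real.sqrt s)) =
          B ^ 3 / (s * Real.sqrt s) + 3 * v ^ 2 / (s * Real.sqrt s) := by
        rw [hc]; field_simp
      linarith
    have hdiff : |∑ z, feedbackLaw W (initStrategy f) z *
        ∑ a, W (l z) a * Qfun ((x + (S z + ψ (l z) a)) / Real.sqrt s) -
        ∑ z, feedbackLaw W (initStrategy f) z * Qfun ((x + S z) / Real.sqrt (s + v))| ≤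
        c * (4 / Real.sqrt s - 4 / Real.sqrt (s + v)) := by
      rw [← sum_sub_distrib]
      refine (abs_sum_le_sum_abs _ _).trans ?_
      refine (sum_le_sum fun z _ => ?_).trans_eq
        (b := ∑ z, feedbackLaw W (initStrategy f) z *
          (c * (4 / Real.sqrt s - 4 / Real.sqrt (s + v)))) ?_
      · rw [← mul_sub, abs_mul, abs_of_nonneg (feedbackLaw_nonneg hW _ _)]
        exact mul_le_mul_of_nonneg_left (hstep z) (feedbackLaw_nonneg hW _ _)
      · rw [← sum_mul, sum_feedbackLaw hW1 hf.initStrategy, one_mul]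
    rw [abs_le] at *
    constructor <;> linarith

end Feedback
/-! ### Masses of events under finite weights -/

section Mass

variable {Z : Type*} [Fintype Z]

/-- The total weight of the event `E` under the weights `p`. -/
def mass (p : Z → ℝ) (E : Set Z) : ℝ := ∑ z, E.indicator p z

theorem mass_nonneg {p : Z → ℝ} (hp : ∀ z, 0 ≤ p z) (E : Set Z) : 0 ≤ mass p E :=
  sum_nonneg fun z _ => Set.indicator_nonneg (fun z _ => hp z) z

theorem mass_mono {p : Z → ℝ} (hp : ∀ z, 0 ≤ p z) {E F : Set Z} (h : E ⊆ F) :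
    mass p E ≤ mass p F :=
  sum_le_sum fun z _ => Set.indicator_le_indicator_of_subset h hp z

theorem mass_mono_left {p q : Z → ℝ} {E : Set Z} (h : ∀ z ∈ E, p z ≤ q z) :
    mass p E ≤ mass q E :=
  sum_le_sum fun z _ => Set.indicator_le_indicator' (h z)

theorem mass_union_le {p : Z → ℝ} (hp : ∀ z, 0 ≤ p z) (E F : Set Z) :
    mass p (E ∪ F) ≤ mass p E + mass p F := by
  unfold mass
  rw [← sum_add_distrib]
  refine sum_le_sum fun z _ => ?_
  by_cases h1 : z ∈ E <;> by_cases h2 : z ∈ F <;> simp [h1, h2, hp z]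

theorem mass_biUnion_le {ι : Type*} {p : Z → ℝ} (hp : ∀ z, 0 ≤ p z) (s : Finset ι)
    (E : ι → Set Z) : mass p (⋃ i ∈ s, E i) ≤ ∑ i ∈ s, mass p (E i) := by
  classical
  induction s using Finset.induction_on with
  | empty => simp [mass]
  | insert a s ha ih =>
    rw [sum_insert ha, set_biUnion_insert]
    exact (mass_union_le hp _ _).trans (by gcongr)

theorem mass_sum {ι : Type*} [Fintype ι] (p : ι → Z → ℝ) (E : Set Z) :
    mass (fun z => ∑ i, p i z) E = ∑ i, mass (p i) E := by
  unfold mass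
  rw [sum_comm]
  refine sum_congr rfl fun z _ => ?_
  by_cases h : z ∈ E <;> simp [h]

theorem mass_const_mul (c : ℝ) (p : Z → ℝ) (E : Set Z) :
    mass (fun z => c * p z) E = c * mass p E := by
  unfold mass
  rw [mul_sum]
  refine sum_congr rfl fun z _ => ?_
  by_cases h : z ∈ E <;> simp [h]

theorem mass_compl (p : Z → ℝ) (E : Set Z) : mass p E + mass p Eᶜ = ∑ z, p z := by
  unfold mass
  rw [← sum_add_distrib]
  refine sum_congr rfl fun z _ => ?_
  by_cases h : z ∈ E <;> simp [h]

theorem mass_le_total {p : Z → ℝ} (hp : ∀ z, 0 ≤ p z) (E : Set Z) : mass p E ≤ ∑ z, p z := by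
  linarith [mass_compl p E, mass_nonneg hp Eᶜ]

/-- A Gaussian-tail form of the central limit theorem along a feedback strategy. -/
theorem mass_feedbackLaw_le [Nonempty Z] {A : Type*} {W : A → Z → ℝ} {ψ : A → Z → ℝ} {v B : ℝ}
    (hW : ∀ x z, 0 ≤ W x z) (hW1 : ∀ x, ∑ z, W x z = 1) (hmean : ∀ x, ∑ z, W x z * ψ x z = 0)
    (hvar : ∀ x, ∑ z, W x z * ψ x z ^ 2 = v) (hB : ∀ x z, W x z ≠ 0 → |ψ x z| ≤ B)
    (hB0 : 0 ≤ B) (hv : 0 < v) {n : ℕ} {f : (Fin n → Z) → Fin n → A} (hf : IsCausal f)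
    {s : ℝ} (hs : 1 ≤ s) (hvs : v ≤ s) (t r : ℝ) :
    mass (feedbackLaw W f) {z | ∑ i, ψ (f z i) (z i) ≤ t} ≤
      Qfun ((-t - r) / Real.sqrt (s + n * v)) +
        4 * ((B ^ 3 + 3 * v ^ 2) / v) / Real.sqrt s + Qfun (r / Real.sqrt s) := by
  have hL := abs_le.1 (abs_sum_feedbackLaw_Qfun_sub_le hW hW1 hmean hvar hB hB0 hv hf hs hvs
    (-t - r))
  have hc0 : 0 ≤ (B ^ 3 + 3 * v ^ 2) / v := by positivity
  have hb : 0 ≤ (B ^ 3 + 3 * v ^ 2) / v * (4 / Real.sqrt (s + n * v)) := by positivity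
  have key : mass (feedbackLaw W f) {z | ∑ i, ψ (f z i) (z i) ≤ t} ≤
      ∑ z, (feedbackLaw W f z * Qfun ((-t - r + ∑ i, ψ (f z i) (z i)) / Real.sqrt s) +
        feedbackLaw W f z * Qfun (r / Real.sqrt s)) := by
    refine sum_le_sum fun z _ => ?_
    have hn := feedbackLaw_nonneg hW f z
    by_cases hz : ∑ i, ψ (f z i) (z i) ≤ t
    · rw [Set.indicator_of_mem (by exact hz), ← mul_add]
      refine le_mul_of_one_le_right hn ?_
      have h1 := Qfun_strictAnti.antitone
        (show (-t - r + ∑ i, ψ (f z i) (z i)) / Real.sqrt s ≤ -(r / Real.sqrt s) by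
          rw [← neg_div]; gcongr; linarith)
      linarith [Qfun_add_neg (r / Real.sqrt s)]
    · rw [Set.indicator_of_notMem (by exact hz)]
      have := Qfun_nonneg ((-t - r + ∑ i, ψ (f z i) (z i)) / Real.sqrt s)
      have := Qfun_nonneg (r / Real.sqrt s)
      positivity
  rw [sum_add_distrib, ← sum_mul, sum_feedbackLaw hW1 hf] at key
  have e : 4 * ((B ^ 3 + 3 * v ^ 2) / v) / Real.sqrt s =
    (B ^ 3 + 3 * v ^ 2) / v * (4 / Real.sqrt s) := by ring
  linarith [hL.2]

theorem le_mass_feedbackLaw [Nonempty Z] {A : Type*} {W : A → Z → ℝ} {ψ : A → Z → ℝ} {v B : ℝ}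
    (hW : ∀ x z, 0 ≤ W x z) (hW1 : ∀ x, ∑ z, W x z = 1) (hmean : ∀ x, ∑ z, W x z * ψ x z = 0)
    (hvar : ∀ x, ∑ z, W x z * ψ x z ^ 2 = v) (hB : ∀ x z, W x z ≠ 0 → |ψ x z| ≤ B)
    (hB0 : 0 ≤ B) (hv : 0 < v) {n : ℕ} {f : (Fin n → Z) → Fin n → A} (hf : IsCausal f)
    {s : ℝ} (hs : 1 ≤ s) (hvs : v ≤ s) (t r : ℝ) :
    Qfun ((-t + r) / Real.sqrt (s + n * v)) -
        4 * ((B ^ 3 + 3 * v ^ 2) / v) / Real.sqrt s - Qfun (r / Real.sqrt s) ≤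
      mass (feedbackLaw W f) {z | ∑ i, ψ (f z i) (z i) ≤ t} := by
  have hL := abs_le.1 (abs_sum_feedbackLaw_Qfun_sub_le hW hW1 hmean hvar hB hB0 hv hf hs hvs
    (-t + r))
  have hc0 : 0 ≤ (B ^ 3 + 3 * v ^ 2) / v := by positivity
  have hb : 0 ≤ (B ^ 3 + 3 * v ^ 2) / v * (4 / Real.sqrt (s + n * v)) := by positivity
  have key : ∑ z, (feedbackLaw W f z * Qfun ((-t + r + ∑ i, ψ (f z i) (z i)) / Real.sqrt s) -
        feedbackLaw W f z * Qfun (r / Real.sqrt s)) ≤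
      mass (feedbackLaw W f) {z | ∑ i, ψ (f z i) (z i) ≤ t} := by
    refine sum_le_sum fun z _ => ?_
    have hn := feedbackLaw_nonneg hW f z
    rw [← mul_sub]
    by_cases hz : ∑ i, ψ (f z i) (z i) ≤ t
    · rw [Set.indicator_of_mem (by exact hz)]
      refine mul_le_of_le_one_right hn ?_
      linarith [Qfun_le_one ((-t + r + ∑ i, ψ (f z i) (z i)) / Real.sqrt s),
        Qfun_nonneg (r / Real.sqrt s)]
    · rw [Set.indicator_of_notMem (by exact hz)]
      refine mul_nonpos_of_nonneg_of_nonpos hn ?_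
      have h1 := Qfun_strictAnti.antitone
        (show r / Real.sqrt s ≤ (-t + r + ∑ i, ψ (f z i) (z i)) / Real.sqrt s by
          gcongr; linarith)
      linarith
  rw [sum_sub_distrib, ← sum_mul, sum_feedbackLaw hW1 hf] at key
  have e : 4 * ((B ^ 3 + 3 * v ^ 2) / v) / Real.sqrt s =
    (B ^ 3 + 3 * v ^ 2) / v * (4 / Real.sqrt s) := by ring
  linarith [hL.1]

/-! ### A Chernoff bound for product weights -/

theorem sum_mul_exp_le {p ψ : Z → ℝ} {b t : ℝ} (hp : ∀ z, 0 ≤ p z) (hp1 : ∑ z, p z = 1)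
    (hmean : ∑ z, p z * ψ z = 0) (hb : ∀ z, p z ≠ 0 → |ψ z| ≤ b) (ht : 0 ≤ t) (htb : t * b ≤ 1) :
    ∑ z, p z * Real.exp (t * ψ z) ≤ Real.exp (t ^ 2 * b ^ 2) := by
  have h : ∀ z, p z * Real.exp (t * ψ z) ≤ p z * (1 + t ^ 2 * b ^ 2) + t * (p z * ψ z) := by
    intro z
    by_cases hz : p z = 0
    · simp [hz]
    have hψ := hb z hz
    have h1 : |t * ψ z| ≤ t * b := by
      rw [abs_mul, abs_of_nonneg ht]; gcongr
    have h2 := (abs_le.1 (Real.abs_exp_sub_one_sub_id_le (h1.trans htb))).2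
    have h3 : (t * ψ z) ^ 2 ≤ (t * b) ^ 2 := sq_le_sq' (by linarith [(abs_le.1 h1).1])
      (abs_le.1 h1).2
    nlinarith [mul_le_mul_of_nonneg_left (show Real.exp (t * ψ z) ≤
      1 + t * ψ z + t ^ 2 * b ^ 2 by nlinarith) (hp z)]
  calc _ ≤ ∑ z, (p z * (1 + t ^ 2 * b ^ 2) + t * (p z * ψ z)) := sum_le_sum fun z _ => h z
    _ = t ^ 2 * b ^ 2 + 1 := by
      rw [sum_add_distrib, ← sum_mul, ← mul_sum, hp1, hmean]; ring
    _ ≤ _ := Real.add_one_le_exp _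

theorem mass_prod_le_exp {n : ℕ} {p ψ : Fin n → Z → ℝ} {b : Fin n → ℝ} {t : ℝ} (r : ℝ)
    (hp : ∀ i z, 0 ≤ p i z) (hp1 : ∀ i, ∑ z, p i z = 1) (hmean : ∀ i, ∑ z, p i z * ψ i z = 0)
    (hb : ∀ i z, p i z ≠ 0 → |ψ i z| ≤ b i) (ht : 0 ≤ t) (htb : ∀ i, t * b i ≤ 1) :
    mass (fun z : Fin n → Z => ∏ i, p i (z i)) {z | r ≤ ∑ i, ψ i (z i)} ≤
      Real.exp (-t * r + t ^ 2 * ∑ i, b i ^ 2) := by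
  have key : mass (fun z : Fin n → Z => ∏ i, p i (z i)) {z | r ≤ ∑ i, ψ i (z i)} ≤
      ∑ z : Fin n → Z, Real.exp (-t * r) * ∏ i, (p i (z i) * Real.exp (t * ψ i (z i))) := by
    refine sum_le_sum fun z _ => ?_
    have hn : 0 ≤ ∏ i, p i (z i) := prod_nonneg fun i _ => hp i _
    rw [prod_mul_distrib, ← Real.exp_sum, ← mul_sum, mul_left_comm, ← Real.exp_add]
    by_cases hz : r ≤ ∑ i, ψ i (z i)
    · rw [Set.indicator_of_mem (by exact hz)]
      refine le_mul_of_one_le_right hn (Real.one_le_exp ?_)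
      nlinarith
    · rw [Set.indicator_of_notMem (by exact hz)]
      positivity
  refine key.trans ?_
  rw [← mul_sum, ← Fintype.prod_sum (fun i z => p i z * Real.exp (t * ψ i z)), Real.exp_add,
    mul_sum, Real.exp_sum]
  gcongr with i _
  · exact fun i _ => sum_nonneg fun z _ => mul_nonneg (hp i z) (Real.exp_pos _).le
  · exact sum_mul_exp_le (hp i) (hp1 i) (hmean i) (hb i) ht (htb i)

end Mass
/-! ### Constant-composition words -/

theorem exp_neg_le_ratio {h D : ℝ} (hh : 0 < h) (hD0 : 0 ≤ D) (hD : 4 * D ≤ h) :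
    Real.exp (-(4 * D / h)) * (h + D) ≤ h - D := by
  have h1 : 1 ≤ Real.exp (4 * D / h) * (1 - 2 * D / h) := by
    have h2 := Real.add_one_le_exp (4 * D / h)
    have h3 : 2 * D / h ≤ 1 / 2 := by rw [div_le_iff₀ hh]; linarith
    have h4 : 4 * D / h = 2 * (2 * D / h) := by ring
    have h5 : 0 ≤ 2 * D / h := by positivity
    rw [h4] at h2 ⊢
    nlinarith [mul_le_mul_of_nonneg_right h2 (by linarith : 0 ≤ 1 - 2 * D / h)]
  have h2 : (1 - 2 * D / h) * (h + D) ≤ h - D := by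
    have : (1 - 2 * D / h) * (h + D) = h - D - 2 * D ^ 2 / h := by field_simp; ring
    rw [this]
    have : 0 ≤ 2 * D ^ 2 / h := by positivity
    linarith
  refine le_trans ?_ h2
  gcongr
  rw [Real.exp_neg, inv_le_iff_one_le_mul₀ (Real.exp_pos _), mul_comm]
  exact h1

theorem exp_pow_mul_centralBinom_le {h D : ℕ} (hh : 0 < h) (hD : 4 * D ≤ h) (d : ℕ) (hd : d ≤ D) :
    Real.exp (-(4 * D / h)) ^ d * (2 * h).choose h ≤ (2 * h).choose (h + d) := by
  have hhR : (0 : ℝ) < h := by exact_mod_cast hh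
  have hDR : 4 * (D : ℝ) ≤ h := by exact_mod_cast hD
  have hr := exp_neg_le_ratio hhR (Nat.cast_nonneg D) hDR
  set q := Real.exp (-(4 * D / h))
  have hq : 0 < q := Real.exp_pos _
  induction d with
  | zero => simp
  | succ d ih =>
    have ih := ih (by omega)
    have hrec := Nat.choose_succ_right_eq (2 * h) (h + d)
    rw [show 2 * h - (h + d) = h - d by omega] at hrec
    have hrecR : ((2 * h).choose (h + d + 1) : ℝ) * (h + d + 1) =
        (2 * h).choose (h + d) * (h - d) := by
      have := congrArg (Nat.cast (R := ℝ)) hrec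
      rw [Nat.cast_mul, Nat.cast_mul, Nat.cast_sub (by omega : d ≤ h)] at this
      push_cast at this
      exact this
    have hdD : (d : ℝ) + 1 ≤ D := by exact_mod_cast hd
    have hd0 : (0 : ℝ) ≤ d := Nat.cast_nonneg d
    rw [← add_assoc, pow_succ]
    have hpos : (0 : ℝ) < h + d + 1 := by positivity
    refine le_of_mul_le_mul_right ?_ hpos
    rw [hrecR]
    have hc : (0 : ℝ) ≤ (2 * h).choose (h + d) := Nat.cast_nonneg _
    calc q ^ d * q * (2 * h).choose h * (h + d + 1)
        = (q ^ d * (2 * h).choose h) * (q * (h + d + 1)) := by ring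
      _ ≤ (2 * h).choose (h + d) * (h - d) := by
        refine mul_le_mul ih ?_ (by positivity) hc
        have : q * (h + d + 1) ≤ q * (h + D) := 
          mul_le_mul_of_nonneg_left (by linarith) hq.le
        linarith

/-- A lower bound on the binomial coefficients near the middle of the row. -/
theorem four_pow_mul_exp_le_choose {h D z : ℕ} (hh : 0 < h) (hD : 4 * D ≤ h) (hz1 : h ≤ z + D)
    (hz2 : z ≤ h + D) :
    (4 : ℝ) ^ h * Real.exp (-(4 * D ^ 2 / h)) ≤ 2 * h * (2 * h).choose z := by
  obtain ⟨d, hd, hzd⟩ : ∃ d ≤ D, (2 * h).choose z = (2 * h).choose (h + d) := by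
    rcases le_total h z with hle | hle
    · exact ⟨z - h, by omega, by rw [Nat.add_sub_cancel' hle]⟩
    · refine ⟨h - z, by omega, ?_⟩
      rw [← Nat.choose_symm (by omega : z ≤ 2 * h)]
      congr 1
      omega
  have h1 := exp_pow_mul_centralBinom_le hh hD d hd
  have h2 : (4 : ℝ) ^ h ≤ 2 * h * (2 * h).choose h := by
    exact_mod_cast Nat.four_pow_le_two_mul_self_mul_centralBinom h hh
  have h3 : Real.exp (-(4 * D ^ 2 / h)) ≤ Real.exp (-(4 * D / h)) ^ d := by
    rw [← Real.exp_nat_mul]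
    refine Real.exp_le_exp.2 ?_
    have hd' : (d : ℝ) ≤ D := by exact_mod_cast hd
    have : (d : ℝ) * (4 * D / h) ≤ D * (4 * D / h) := by gcongr
    have e : (D : ℝ) * (4 * D / h) = 4 * D ^ 2 / h := by ring
    linarith
  rw [hzd]
  calc (4 : ℝ) ^ h * Real.exp (-(4 * D ^ 2 / h))
      ≤ (2 * h * (2 * h).choose h) * Real.exp (-(4 * D / h)) ^ d := by gcongr
    _ = 2 * h * (Real.exp (-(4 * D / h)) ^ d * (2 * h).choose h) := by ring
    _ ≤ _ := by gcongr

theorem two_pow_le_succ_mul_choose_half (n : ℕ) : 2 ^ n ≤ (n + 1) * n.choose (n / 2) := by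
  rw [← Nat.sum_range_choose]
  calc ∑ k ∈ range (n + 1), n.choose k ≤ ∑ _k ∈ range (n + 1), n.choose (n / 2) :=
        sum_le_sum fun k _ => Nat.choose_le_middle k n
    _ = _ := by simp

/-- The words of length `l` with exactly `z` letters in the first half of the alphabet. -/
def compositionClass (N l z : ℕ) : Finset (Fin l → Fin 2 × Fin N) :=
  {w | #{i | (w i).1 = 0} = z}

theorem choose_mul_pow_le_card_compositionClass (N l z : ℕ) :
    l.choose z * N ^ l ≤ #(compositionClass N l z) := by
  have hcard : #(powersetCard z (univ : Finset (Fin l)) ×ˢ (univ : Finset (Fin l → Fin N))) =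
      l.choose z * N ^ l := by
    simp [card_product, card_powersetCard]
  rw [← hcard]
  refine card_le_card_of_injOn (fun a i => (if i ∈ a.1 then 0 else 1, a.2 i)) ?_ ?_
  · intro a ha
    simp only [coe_product, Set.mem_prod, mem_coe, mem_powersetCard] at ha
    simp [compositionClass, ha.1.2]
  · rintro ⟨s, U⟩ - ⟨s', U'⟩ - h
    simp only [funext_iff, Prod.mk.injEq] at h
    refine Prod.ext (Finset.ext fun i => ?_) (funext fun i => (h i).2)
    have := (h i).1
    by_cases h1 : i ∈ s <;> by_cases h2 : i ∈ s' <;> simp_all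

/-- The sum of a two-valued function of the letter halves only depends on the composition. -/
theorem sum_compositionClass {N l z : ℕ} {w : Fin l → Fin 2 × Fin N}
    (hw : w ∈ compositionClass N l z) (g : Fin 2 → ℝ) :
    ∑ i, g (w i).1 = z * g 0 + (l - z) * g 1 := by
  simp only [compositionClass, mem_filter, mem_univ, true_and] at hw
  have h2 : ∀ i, g (w i).1 = (if (w i).1 = 0 then (1 : ℝ) else 0) * (g 0 - g 1) + g 1 := by
    intro i
    by_cases h : (w i).1 = 0
    · simp [h]
    · have : (w i).1 = 1 := by omega
      simp [this]
  simp only [h2, sum_add_distrib, ← sum_mul, sum_boole, hw]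
  simp
  ring

/-- Averaging over a product of composition classes: some prefix and some continuations achieve
at most a multiple of the total cost. -/
theorem exists_prefix_continuations {α β κ : Type*} [Fintype α] [Fintype β] (U : Finset α)
    (C : κ → Finset β) (c : α → β → ℝ) (hc : ∀ a b, 0 ≤ c a b) {a T : ℝ} (ha : 0 < a)
    (haC : ∀ k, a ≤ #U * #(C k)) (hT : ∑ x, ∑ y, c x y ≤ T) [Nonempty κ] :
    ∃ u ∈ U, ∃ v : κ → β, ∀ k, v k ∈ C k ∧ c u (v k) ≤ T / a := by
  have hU : U.Nonempty := by
    by_contra h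
    obtain ⟨k⟩ := ‹Nonempty κ›
    have := haC k
    simp [not_nonempty_iff_eq_empty.1 h] at this
    linarith
  have hUpos : (0 : ℝ) < #U := by exact_mod_cast hU.card_pos
  obtain ⟨u, hu, hule⟩ : ∃ u ∈ U, ∑ y, c u y ≤ T / #U := by
    refine exists_le_of_sum_le hU ?_
    rw [sum_const, nsmul_eq_mul, mul_div_cancel₀ _ hUpos.ne']
    exact (sum_le_sum_of_subset_of_nonneg (subset_univ U)
      fun x _ _ => sum_nonneg fun y _ => hc x y).trans hT
  have hv : ∀ k, ∃ v ∈ C k, c u v ≤ T / a := by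
    intro k
    have hCpos : (0 : ℝ) < #(C k) := by
      by_contra h
      have h0 : (#(C k) : ℝ) = 0 := le_antisymm (not_lt.1 h) (Nat.cast_nonneg _)
      have := haC k
      rw [h0, mul_zero] at this
      linarith
    have hT0 : 0 ≤ T := (sum_nonneg fun x _ => sum_nonneg fun y _ => hc x y).trans hT
    refine exists_le_of_sum_le (card_pos.1 (by exact_mod_cast hCpos)) ?_
    rw [sum_const, nsmul_eq_mul]
    have h1 : ∑ y ∈ C k, c u y ≤ T / #U :=
      (sum_le_sum_of_subset_of_nonneg (subset_univ _) fun y _ _ => hc u y).trans hule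
    refine h1.trans ?_
    rw [← mul_div_assoc, div_le_div_iff₀ hUpos ha]
    nlinarith [mul_le_mul_of_nonneg_left (haC k) hT0]
  choose v hv1 hv2 using hv
  exact ⟨u, hu, v, fun k => ⟨hv1 k, hv2 k⟩⟩
/-! ### Two channels driven by a common input -/

section PairChannel

variable {A Y : Type*}

/-- The channel with two independent output components. -/
def pairChannel (W1 W2 : A → Y → ℝ) (x : A) (a : Y × Y) : ℝ := W1 x a.1 * W2 x a.2

/-- The output law of the channel `W` when the fixed word `w` is sent. -/
def wordLaw {n : ℕ} (W : A → Y → ℝ) (w : Fin n → A) (y : Fin n → Y) : ℝ := ∏ i, W (w i) (y i)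

/-- The accumulated log-likelihood ratio of the word `w` against the product of `q`. -/
def wordLLR {n : ℕ} (W : A → Y → ℝ) (q : Y → ℝ) (w : Fin n → A) (y : Fin n → Y) : ℝ :=
  ∑ i, Real.log (W (w i) (y i) / q (y i))

theorem pairChannel_nonneg {W1 W2 : A → Y → ℝ} (h1 : ∀ x y, 0 ≤ W1 x y) (h2 : ∀ x y, 0 ≤ W2 x y)
    (x : A) (a : Y × Y) : 0 ≤ pairChannel W1 W2 x a := mul_nonneg (h1 _ _) (h2 _ _)

theorem wordLaw_nonneg {n : ℕ} {W : A → Y → ℝ} (hW : ∀ x y, 0 ≤ W x y) (w : Fin n → A)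
    (y : Fin n → Y) : 0 ≤ wordLaw W w y := prod_nonneg fun _ _ => hW _ _

theorem feedbackLaw_pairChannel {n : ℕ} (W1 W2 : A → Y → ℝ)
    (f : (Fin n → Y × Y) → Fin n → A) (z : Fin n → Y × Y) :
    feedbackLaw (pairChannel W1 W2) f z =
      wordLaw W1 (f z) (Prod.fst ∘ z) * wordLaw W2 (f z) (Prod.snd ∘ z) :=
  prod_mul_distrib

/-- A word likelihood is the product measure tilted by the log-likelihood ratio. -/
theorem wordLaw_eq_exp_mul {n : ℕ} {W : A → Y → ℝ} {q : Y → ℝ} (hW : ∀ x y, 0 ≤ W x y)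
    (hq : ∀ x y, 0 < W x y → 0 < q y) {w : Fin n → A} {y : Fin n → Y} (h : 0 < wordLaw W w y) :
    wordLaw W w y = Real.exp (wordLLR W q w y) * ∏ i, q (y i) := by
  have hpos : ∀ i, 0 < W (w i) (y i) := fun i =>
    (hW _ _).lt_of_ne' (prod_ne_zero_iff.1 h.ne' i (mem_univ i))
  rw [wordLLR, Real.exp_sum, ← prod_mul_distrib]
  refine prod_congr rfl fun i _ => ?_
  have hqi := hq _ _ (hpos i)
  rw [Real.exp_log (div_pos (hpos i) hqi), div_mul_cancel₀ _ hqi.ne']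

theorem isCausal_comp_swap {n : ℕ} {f : (Fin n → Y × Y) → Fin n → A} (hf : IsCausal f) :
    IsCausal fun z => f (Prod.swap ∘ z) :=
  fun z z' i h => hf _ _ i fun t ht => by simp [h t ht]

/-- Summing the word laws over all words gives a multiple of the product output law. -/
theorem sum_words_wordLaw {n : ℕ} [Fintype A] {W : A → Y → ℝ} {q : Y → ℝ} {c : ℝ}
    (h : ∀ y, ∑ x, W x y = c * q y) (y : Fin n → Y) :
    ∑ w : Fin n → A, wordLaw W w y = c ^ n * ∏ i, q (y i) := by
  classical
  have := (Finset.prod_univ_sum (fun _ : Fin n => (univ : Finset A)) fun i x => W x (y i))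
  rw [Fintype.piFinset_univ] at this
  simp only [wordLaw, ← this, h, prod_mul_distrib, prod_const, card_univ, Fintype.card_fin]

variable [Fintype Y]

theorem sum_pairChannel {W1 W2 : A → Y → ℝ} (h1 : ∀ x, ∑ y, W1 x y = 1)
    (h2 : ∀ x, ∑ y, W2 x y = 1) (x : A) : ∑ a, pairChannel W1 W2 x a = 1 := by
  simp only [pairChannel]
  rw [Fintype.sum_prod_type]
  simp [← mul_sum, h1, h2]

theorem sum_wordLaw {n : ℕ} {W : A → Y → ℝ} (h : ∀ x, ∑ y, W x y = 1) (w : Fin n → A) :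
    ∑ y, wordLaw W w y = 1 := by
  classical
  have := (Finset.prod_univ_sum (fun _ : Fin n => (univ : Finset Y)) fun i y => W (w i) y)
  rw [Fintype.piFinset_univ] at this
  simp only [wordLaw, ← this, h, prod_const_one]

theorem sum_pair_words {n : ℕ} (F : (Fin n → Y × Y) → ℝ) :
    ∑ z, F z = ∑ y1 : Fin n → Y, ∑ y2 : Fin n → Y, F fun i => (y1 i, y2 i) := by
  rw [← (Equiv.arrowProdEquivProdArrow (Fin n) (fun _ => Y) (fun _ => Y)).symm.sum_comp,
    Fintype.sum_prod_type]
  rfl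

/-- Exchanging the two components. -/
theorem mass_feedbackLaw_swap {n : ℕ} (W1 W2 : A → Y → ℝ) (f : (Fin n → Y × Y) → Fin n → A)
    (E : Set (Fin n → Y × Y)) :
    mass (feedbackLaw (pairChannel W1 W2) f) E =
      mass (feedbackLaw (pairChannel W2 W1) fun z => f (Prod.swap ∘ z)) {z | Prod.swap ∘ z ∈ E} := by
  classical
  unfold mass
  refine Fintype.sum_equiv ((Equiv.refl (Fin n)).arrowCongr (Equiv.prodComm Y Y)) _ _ fun z => ?_
  have hz : Prod.swap ∘ (Equiv.refl (Fin n)).arrowCongr (Equiv.prodComm Y Y) z = z := by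
    ext i <;> rfl
  simp only [Set.indicator, Set.mem_ofPred_eq, hz, feedbackLaw_pairChannel]
  rw [mul_comm]
  rfl

/-- If the strategy always follows one of finitely many words, the marginal law of the first
component is dominated by the sum of the word laws. -/
theorem mass_feedbackLaw_fst_le {n : ℕ} {κ : Type*} [Fintype κ] {W1 W2 : A → Y → ℝ}
    (h1 : ∀ x y, 0 ≤ W1 x y) (h2 : ∀ x y, 0 ≤ W2 x y) (hs2 : ∀ x, ∑ y, W2 x y = 1)
    {f : (Fin n → Y × Y) → Fin n → A} (k : (Fin n → Y × Y) → κ) (w : κ → Fin n → A)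
    (hf : ∀ z, f z = w (k z)) (F : κ → Set (Fin n → Y)) :
    mass (feedbackLaw (pairChannel W1 W2) f) {z | Prod.fst ∘ z ∈ F (k z)} ≤
      ∑ k, mass (wordLaw W1 (w k)) (F k) := by
  classical
  calc mass (feedbackLaw (pairChannel W1 W2) f) {z | Prod.fst ∘ z ∈ F (k z)}
      ≤ ∑ z : Fin n → Y × Y, ∑ k, (F k).indicator (wordLaw W1 (w k)) (Prod.fst ∘ z) *
          wordLaw W2 (w k) (Prod.snd ∘ z) := by
        refine sum_le_sum fun z _ => ?_
        have hnn : ∀ k, 0 ≤ (F k).indicator (wordLaw W1 (w k)) (Prod.fst ∘ z) *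
            wordLaw W2 (w k) (Prod.snd ∘ z) := fun k =>
          mul_nonneg (Set.indicator_nonneg (fun _ _ => wordLaw_nonneg h1 _ _) _)
            (wordLaw_nonneg h2 _ _)
        by_cases hz : Prod.fst ∘ z ∈ F (k z)
        · refine le_trans ?_ (single_le_sum (fun k _ => hnn k) (mem_univ (k z)))
          rw [Set.indicator_of_mem (by exact hz), Set.indicator_of_mem hz,
            feedbackLaw_pairChannel, hf]
        · rw [Set.indicator_of_notMem (by exact hz)]
          exact sum_nonneg fun k _ => hnn k
    _ = _ := by
        rw [sum_comm]
        refine sum_congr rfl fun k _ => ?_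
        rw [sum_pair_words]
        simp only [Function.comp_def, ← mul_sum]
        refine sum_congr rfl fun y _ => ?_
        rw [sum_wordLaw hs2, mul_one]

theorem mass_feedbackLaw_snd_le {n : ℕ} {κ : Type*} [Fintype κ] {W1 W2 : A → Y → ℝ}
    (h1 : ∀ x y, 0 ≤ W1 x y) (h2 : ∀ x y, 0 ≤ W2 x y) (hs1 : ∀ x, ∑ y, W1 x y = 1)
    {f : (Fin n → Y × Y) → Fin n → A} (k : (Fin n → Y × Y) → κ) (w : κ → Fin n → A)
    (hf : ∀ z, f z = w (k z)) (F : κ → Set (Fin n → Y)) :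
    mass (feedbackLaw (pairChannel W1 W2) f) {z | Prod.snd ∘ z ∈ F (k z)} ≤
      ∑ k, mass (wordLaw W2 (w k)) (F k) := by
  rw [mass_feedbackLaw_swap]
  exact mass_feedbackLaw_fst_le h2 h1 hs1 (fun z => k (Prod.swap ∘ z)) w (fun z => hf _) F

end PairChannel
/-! ### Balanced pairs of channels and steering strategies -/

section Deviation

variable {A Y : Type*}

theorem mass_le_of_support {Z : Type*} [Fintype Z] {p : Z → ℝ} (hp : ∀ z, 0 ≤ p z) {E F : Set Z}
    (h : ∀ z ∈ E, p z ≠ 0 → z ∈ F) : mass p E ≤ mass p F := by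
  refine sum_le_sum fun z _ => ?_
  by_cases h0 : p z = 0
  · rw [Set.indicator_apply_eq_zero.2 fun _ => h0, Set.indicator_apply_eq_zero.2 fun _ => h0]
  by_cases hE : z ∈ E
  · rw [Set.indicator_of_mem hE, Set.indicator_of_mem (h z hE h0)]
  · rw [Set.indicator_of_notMem hE]
    exact Set.indicator_nonneg (fun z _ => hp z) z

theorem isCausal_append {n m : ℕ} {κ Z : Type*} (u : Fin n → A) (v : κ → Fin m → A)
    (k : (Fin n → Z) → κ) :
    IsCausal fun z : Fin (n + m) → Z => Fin.append u (v (k fun i => z (Fin.castAdd m i))) := by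
  intro z z' i h
  induction i using Fin.addCases with
  | left i => simp
  | right i =>
    have : (fun i => z (Fin.castAdd m i)) = fun i => z' (Fin.castAdd m i) :=
      funext fun t => h _ (by simp [Fin.lt_def]; omega)
    simp [this]

theorem wordLLR_append {n m : ℕ} (W : A → Y → ℝ) (q : Y → ℝ) (u : Fin n → A) (v : Fin m → A)
    (y : Fin (n + m) → Y) :
    wordLLR W q (Fin.append u v) y =
      wordLLR W q u (fun i => y (Fin.castAdd m i)) + wordLLR W q v fun i => y (Fin.natAdd n i) := by
  simp [wordLLR, Fin.sum_univ_add]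

variable [Fintype Y]

/-- Subgaussian deviations of a partial sum of the log-likelihood ratio. -/
theorem mass_wordLaw_deviation_le {n : ℕ} {W : A → Y → ℝ} {q : Y → ℝ} {ν : A → ℝ} {B : ℝ}
    (hW : ∀ x y, 0 ≤ W x y) (hW1 : ∀ x, ∑ y, W x y = 1)
    (hmean : ∀ x, ∑ y, W x y * Real.log (W x y / q y) = ν x)
    (hB : ∀ x y, |Real.log (W x y / q y) - ν x| ≤ B) (hB0 : 0 < B) (w : Fin n → A)
    {σ : Fin n → ℝ} (hσ : ∀ i, σ i = 0 ∨ σ i = 1) {L r : ℝ} (hL : 0 < L) (hσL : ∑ i, σ i ≤ L)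
    (hr : 0 ≤ r) (hrL : r ≤ 2 * L * B) :
    mass (wordLaw W w)
      {y | r < |∑ i, σ i * (Real.log (W (w i) (y i) / q (y i)) - ν (w i))|} ≤
      2 * Real.exp (-(r ^ 2 / (4 * L * B ^ 2))) := by
  have key : ∀ c : ℝ, |c| = 1 → mass (wordLaw W w)
      {y | r ≤ ∑ i, c * (σ i * (Real.log (W (w i) (y i) / q (y i)) - ν (w i)))} ≤
      Real.exp (-(r ^ 2 / (4 * L * B ^ 2))) := by
    intro c hc
    have hσ1 : ∀ i, |σ i| ≤ 1 := fun i => by rcases hσ i with h | h <;> simp [h]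
    have htB : r / (2 * L * B ^ 2) * B ≤ 1 := by
      rw [div_mul_eq_mul_div, div_le_one (by positivity)]
      nlinarith
    refine (mass_prod_le_exp (p := fun i => W (w i))
      (ψ := fun i y => c * (σ i * (Real.log (W (w i) y / q y) - ν (w i))))
      (b := fun i => |σ i| * B) (t := r / (2 * L * B ^ 2)) r (fun i => hW _) (fun i => hW1 _)
      (fun i => ?_) (fun i y _ => ?_) (by positivity) fun i => ?_).trans (Real.exp_le_exp.2 ?_)
    · have : ∀ y, W (w i) y * (c * (σ i * (Real.log (W (w i) y / q y) - ν (w i)))) =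
          c * σ i * (W (w i) y * Real.log (W (w i) y / q y)) - c * σ i * ν (w i) * W (w i) y :=
        fun y => by ring
      simp only [this, sum_sub_distrib, ← mul_sum, hmean, hW1]
      ring
    · rw [abs_mul, abs_mul, hc, one_mul]
      exact mul_le_mul_of_nonneg_left (hB _ _) (abs_nonneg _)
    · refine le_trans ?_ htB
      have : |σ i| * B ≤ B := mul_le_of_le_one_left hB0.le (hσ1 i)
      gcongr
    · have h1 : ∑ i, (|σ i| * B) ^ 2 ≤ L * B ^ 2 := by
        have : ∀ i, (|σ i| * B) ^ 2 = σ i * B ^ 2 := fun i => by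
          rcases hσ i with h | h <;> simp [h]
        simp only [this, ← sum_mul]
        gcongr
      calc -(r / (2 * L * B ^ 2)) * r + (r / (2 * L * B ^ 2)) ^ 2 * ∑ i, (|σ i| * B) ^ 2
          ≤ -(r / (2 * L * B ^ 2)) * r + (r / (2 * L * B ^ 2)) ^ 2 * (L * B ^ 2) := by gcongr
        _ = -(r ^ 2 / (4 * L * B ^ 2)) := by field_simp; ring
  have hsub : {y : Fin n → Y |
      r < |∑ i, σ i * (Real.log (W (w i) (y i) / q (y i)) - ν (w i))|} ⊆
      {y | r ≤ ∑ i, (1 : ℝ) * (σ i * (Real.log (W (w i) (y i) / q (y i)) - ν (w i)))} ∪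
      {y | r ≤ ∑ i, (-1 : ℝ) * (σ i * (Real.log (W (w i) (y i) / q (y i)) - ν (w i)))} := by
    intro y hy
    simp only [Set.mem_union, Set.mem_ofPred_eq, ← mul_sum] at hy ⊢
    rcases lt_abs.1 hy with h | h
    · left; linarith
    · right; linarith
  refine (mass_mono (wordLaw_nonneg hW w) hsub).trans
    ((mass_union_le (wordLaw_nonneg hW w) _ _).trans ?_)
  linarith [key 1 (by simp), key (-1) (by simp)]

/-- The outputs for which some word of the family passes the threshold test. -/
def decodeSet {n : ℕ} {κ : Type*} (W : A → Y → ℝ) (q : Y → ℝ) (τ : ℝ) (w : κ → Fin n → A) :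
    Set (Fin n → Y) :=
  {y | ∃ k, 0 < wordLaw W (w k) y ∧ τ ≤ wordLLR W q (w k) y}

theorem mass_decodeSet_le {n : ℕ} {κ : Type*} [Fintype κ] {W : A → Y → ℝ} {q : Y → ℝ} (τ : ℝ)
    (hW : ∀ x y, 0 ≤ W x y) (hW1 : ∀ x, ∑ y, W x y = 1) (hq0 : ∀ y, 0 ≤ q y)
    (hq : ∀ x y, 0 < W x y → 0 < q y) (w : κ → Fin n → A) :
    mass (fun y => ∏ i, q (y i)) (decodeSet W q τ w) ≤ Fintype.card κ * Real.exp (-τ) := by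
  have hnn : ∀ y : Fin n → Y, 0 ≤ ∏ i, q (y i) := fun y => prod_nonneg fun i _ => hq0 _
  have hU : decodeSet W q τ w =
      ⋃ k ∈ (univ : Finset κ), {y | 0 < wordLaw W (w k) y ∧ τ ≤ wordLLR W q (w k) y} := by
    ext y
    simp [decodeSet]
  rw [hU]
  refine (mass_biUnion_le hnn _ _).trans ?_
  rw [← nsmul_eq_mul, ← card_univ]
  refine sum_le_card_nsmul _ _ _ fun k _ => ?_
  calc _ ≤ mass (fun y => Real.exp (-τ) * wordLaw W (w k) y)
        {y | 0 < wordLaw W (w k) y ∧ τ ≤ wordLLR W q (w k) y} := by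
        refine mass_mono_left fun y hy => ?_
        rw [wordLaw_eq_exp_mul hW hq hy.1, ← mul_assoc, ← Real.exp_add]
        refine le_mul_of_one_le_left (hnn y) (Real.one_le_exp ?_)
        linarith [hy.2]
    _ ≤ Real.exp (-τ) := by
        rw [mass_const_mul]
        have := mass_le_total (wordLaw_nonneg hW (w k))
          {y | 0 < wordLaw W (w k) y ∧ τ ≤ wordLLR W q (w k) y}
        rw [sum_wordLaw hW1] at this
        nlinarith [Real.exp_pos (-τ)]

end Deviation

/-- Two channels with a common uniform output law, whose information densities have means
exchanged between the two halves of the alphabet and a common total variance. -/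
structure BalancedPair {Y : Type*} [Fintype Y] {N : ℕ} (W1 W2 : Fin 2 × Fin N → Y → ℝ)
    (q : Y → ℝ) (μ : Fin 2 → ℝ) (v B : ℝ) : Prop where
  nonneg1 : ∀ x y, 0 ≤ W1 x y
  nonneg2 : ∀ x y, 0 ≤ W2 x y
  sum1 : ∀ x, ∑ y, W1 x y = 1
  sum2 : ∀ x, ∑ y, W2 x y = 1
  avg1 : ∀ y, ∑ x, W1 x y = (2 * N : ℝ) * q y
  avg2 : ∀ y, ∑ x, W2 x y = (2 * N : ℝ) * q y
  mean1 : ∀ x, ∑ y, W1 x y * Real.log (W1 x y / q y) = μ x.1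
  mean2 : ∀ x, ∑ y, W2 x y * Real.log (W2 x y / q y) = μ (1 - x.1)
  var : ∀ x, ∑ a, pairChannel W1 W2 x a *
    (Real.log (W1 x a.1 / q a.1) + Real.log (W2 x a.2 / q a.2) - (μ 0 + μ 1)) ^ 2 = v
  bound1 : ∀ x y, |Real.log (W1 x y / q y) - μ x.1| ≤ B
  bound2 : ∀ x y, |Real.log (W2 x y / q y) - μ (1 - x.1)| ≤ B

namespace BalancedPair

variable {Y : Type*} [Fintype Y] {N : ℕ} {W1 W2 : Fin 2 × Fin N → Y → ℝ} {q : Y → ℝ}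
  {μ : Fin 2 → ℝ} {v B : ℝ}

theorem symm (h : BalancedPair W1 W2 q μ v B) :
    BalancedPair W2 W1 q (fun t => μ (1 - t)) v B where
  nonneg1 := h.nonneg2
  nonneg2 := h.nonneg1
  sum1 := h.sum2
  sum2 := h.sum1
  avg1 := h.avg2
  avg2 := h.avg1
  mean1 := h.mean2
  mean2 := by simpa using h.mean1
  var x := by
    rw [← h.var x, ← (Equiv.prodComm Y Y).sum_comp]
    refine sum_congr rfl fun a _ => ?_
    simp only [pairChannel, Equiv.prodComm_apply, Prod.fst_swap, Prod.snd_swap, sub_zero, sub_self]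
    ring
  bound1 := h.bound2
  bound2 := by simpa using h.bound1

theorem q_pos (h : BalancedPair W1 W2 q μ v B) (x : Fin 2 × Fin N) (y : Y) (hx : 0 < W1 x y) :
    0 < q y := by
  have h1 : W1 x y ≤ (2 * N : ℝ) * q y := by
    rw [← h.avg1]
    exact single_le_sum (fun x _ => h.nonneg1 x y) (mem_univ x)
  exact pos_of_mul_pos_right (hx.trans_le h1) (by positivity)

theorem q_nonneg (h : BalancedPair W1 W2 q μ v B) (hN : 0 < N) (y : Y) : 0 ≤ q y := by
  have hN' : (0 : ℝ) < 2 * N := by positivity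
  have h1 : (0 : ℝ) ≤ (2 * N : ℝ) * q y := by
    rw [← h.avg1]
    exact sum_nonneg fun x _ => h.nonneg1 x y
  exact nonneg_of_mul_nonneg_right h1 hN'

theorem sum_q (h : BalancedPair W1 W2 q μ v B) (hN : 0 < N) : ∑ y, q y = 1 := by
  have hN' : (0 : ℝ) < 2 * N := by positivity
  have h1 : ∑ y, ∑ x, W1 x y = 2 * N := by
    rw [sum_comm]
    simp [h.sum1]
  simp only [h.avg1, ← mul_sum] at h1
  exact mul_left_cancel₀ hN'.ne' (by linarith)

end BalancedPair
/-! ### Steering one decoder with a variable composition -/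

theorem exists_steering_index {D : ℕ} {Δ x : ℝ} (hΔ : Δ ≠ 0) (hx : |x| ≤ (D - 1) * |Δ|) :
    ∃ k : Fin (2 * D + 1), x ≤ (D - (k : ℕ)) * Δ ∧ (D - (k : ℕ)) * Δ ≤ x + |Δ| := by
  have hpos : 0 < |Δ| := abs_pos.2 hΔ
  obtain ⟨h1, h2⟩ := abs_le.1 hx
  set e := ⌈x / |Δ|⌉ with he
  have hle : x ≤ e * |Δ| := (div_le_iff₀ hpos).1 (Int.le_ceil _)
  have hlt : e * |Δ| ≤ x + |Δ| := by
    have := (Int.ceil_lt_add_one (x / |Δ|)).le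
    rw [← he] at this
    calc e * |Δ| ≤ (x / |Δ| + 1) * |Δ| := by gcongr
      _ = x + |Δ| := by field_simp
  have heD : e ≤ D := by
    rw [he, Int.ceil_le, div_le_iff₀ hpos]
    push_cast
    nlinarith
  have hDe : -(D : ℤ) ≤ e := by
    have : (-(D : ℝ)) ≤ e := by
      refine le_of_mul_le_mul_right ?_ hpos
      nlinarith
    exact_mod_cast this
  rcases hΔ.lt_or_gt with hneg | hpos'
  · refine ⟨⟨(D + e).toNat, by omega⟩, ?_⟩
    have hc : (((D + e).toNat : ℕ) : ℝ) = D + e := by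
      have : (((D + e).toNat : ℕ) : ℤ) = D + e := Int.toNat_of_nonneg (by omega)
      exact_mod_cast this
    rw [hc]
    rw [abs_of_neg hneg] at *
    constructor <;> linarith
  · refine ⟨⟨(D - e).toNat, by omega⟩, ?_⟩
    have hc : (((D - e).toNat : ℕ) : ℝ) = D - e := by
      have : (((D - e).toNat : ℕ) : ℤ) = D - e := Int.toNat_of_nonneg (by omega)
      exact_mod_cast this
    rw [hc]
    rw [abs_of_pos hpos'] at *
    constructor <;> linarith

/-- The centred total information density of a pair of channels. -/
def totalDens {A Y : Type*} (W1 W2 : A → Y → ℝ) (q : Y → ℝ) (c : ℝ) (x : A) (a : Y × Y) : ℝ :=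
  Real.log (W1 x a.1 / q a.1) + Real.log (W2 x a.2 / q a.2) - c

theorem sum_totalDens {A Y : Type*} {n : ℕ} (W1 W2 : A → Y → ℝ) (q : Y → ℝ) (c : ℝ) (w : Fin n → A)
    (z : Fin n → Y × Y) :
    ∑ i, totalDens W1 W2 q c (w i) (z i) =
      wordLLR W1 q w (Prod.fst ∘ z) + wordLLR W2 q w (Prod.snd ∘ z) - n * c := by
  simp [totalDens, wordLLR, sum_add_distrib, sum_sub_distrib]

/-- The bound on the probability of an atypical log-likelihood ratio in the steering scheme. -/
def steeringTail (n m D : ℕ) (B R r : ℝ) : ℝ :=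
  (2 * D + 1) * (2 * Real.exp (-(R ^ 2 / (4 * n * B ^ 2))) +
    2 * Real.exp (-(r ^ 2 / (4 * m * B ^ 2))))

theorem abs_sum_half_composition_sub_le {N n : ℕ} {u : Fin n → Fin 2 × Fin N}
    (hu : u ∈ compositionClass N n (n / 2)) (g : Fin 2 → ℝ) :
    |∑ i, g (u i).1 - n * ((g 0 + g 1) / 2)| ≤ |g 0 - g 1| := by
  rw [sum_compositionClass hu]
  have h1 : ((n / 2 : ℕ) : ℝ) * 2 ≤ n := by exact_mod_cast Nat.div_mul_le_self n 2
  have h2 : (n : ℝ) ≤ ((n / 2 : ℕ) : ℝ) * 2 + 1 := by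
    have : n ≤ n / 2 * 2 + 1 := by omega
    exact_mod_cast this
  have h3 : ((n / 2 : ℕ) : ℝ) * g 0 + (n - (n / 2 : ℕ)) * g 1 - n * ((g 0 + g 1) / 2) =
      (((n / 2 : ℕ) : ℝ) - n / 2) * (g 0 - g 1) := by ring
  rw [h3, abs_mul]
  refine mul_le_of_le_one_left (abs_nonneg _) (abs_le.2 ⟨?_, ?_⟩) <;> linarith

namespace BalancedPair

variable {Y : Type*} [Fintype Y] {N : ℕ} {W1 W2 : Fin 2 × Fin N → Y → ℝ} {q : Y → ℝ}
  {μ : Fin 2 → ℝ} {v B : ℝ}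

/-- After a fixed prefix, the composition of the suffix is chosen from the prefix outputs so that
the second decoder meets its threshold with little to spare. -/
theorem exists_steering (h : BalancedPair W1 W2 q μ v B) (hμ : μ 0 ≠ μ 1) (hB : 0 < B)
    {n m D : ℕ} (hn : 0 < n) (hm : 0 < m) (hD : D ≤ m) {u : Fin n → Fin 2 × Fin N}
    (hu : u ∈ compositionClass N n (n / 2)) {w : Fin (2 * D + 1) → Fin (2 * m) → Fin 2 × Fin N}
    (hw : ∀ k : Fin (2 * D + 1), w k ∈ compositionClass N (2 * m) (m - D + (k : ℕ)))
    {τ r R : ℝ} (hr : 0 ≤ r)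
    (hrm : r ≤ 2 * (2 * m) * B) (hR : 0 ≤ R) (hRn : R ≤ 2 * n * B)
    (hτ : |τ + r - (n + 2 * m) * ((μ 0 + μ 1) / 2)| + R + |μ 0 - μ 1| ≤ (D - 1) * |μ 0 - μ 1|) :
    ∃ f : (Fin (n + 2 * m) → Y × Y) → Fin (n + 2 * m) → Fin 2 × Fin N,
      IsCausal f ∧ (∃ k : (Fin (n + 2 * m) → Y × Y) → Fin (2 * D + 1),
        ∀ z, f z = Fin.append u (w (k z))) ∧
      mass (feedbackLaw (pairChannel W1 W2) f)
        {z | Prod.snd ∘ z ∉ decodeSet W2 q τ fun k => Fin.append u (w k)} ≤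
        steeringTail n (2 * m) D B R r ∧
      mass (feedbackLaw (pairChannel W1 W2) f)
        {z | Prod.fst ∘ z ∉ decodeSet W1 q τ fun k => Fin.append u (w k)} ≤
        mass (feedbackLaw (pairChannel W1 W2) f)
          {z | ∑ i, totalDens W1 W2 q (μ 0 + μ 1) (f z i) (z i) ≤
            2 * τ + 2 * r + |μ 0 - μ 1| - (n + 2 * m : ℕ) * (μ 0 + μ 1)} +
          steeringTail n (2 * m) D B R r := by
  classical
  set Δ := μ 0 - μ 1 with hΔdef
  have hΔ : Δ ≠ 0 := sub_ne_zero.2 hμ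
  set x : (Fin n → Y × Y) → ℝ := fun z => τ + r - wordLLR W2 q u (Prod.snd ∘ z) - m * (μ 0 + μ 1)
  have hk : ∀ z : Fin n → Y × Y, ∃ k : Fin (2 * D + 1), |x z| ≤ (D - 1) * |Δ| →
      x z ≤ (D - (k : ℕ)) * Δ ∧ (D - (k : ℕ)) * Δ ≤ x z + |Δ| := by
    intro z
    by_cases hz : |x z| ≤ (D - 1) * |Δ|
    · obtain ⟨k, hk⟩ := exists_steering_index hΔ hz
      exact ⟨k, fun _ => hk⟩
    · exact ⟨0, fun h => absurd h hz⟩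
  choose k hk using hk
  set words : Fin (2 * D + 1) → Fin (n + 2 * m) → Fin 2 × Fin N := fun k => Fin.append u (w k)
  set k' : (Fin (n + 2 * m) → Y × Y) → Fin (2 * D + 1) :=
    fun z => k fun i => z (Fin.castAdd (2 * m) i)
  set f : (Fin (n + 2 * m) → Y × Y) → Fin (n + 2 * m) → Fin 2 × Fin N := fun z => words (k' z)
  set law := feedbackLaw (pairChannel W1 W2) f with hlaw
  have hlaw0 : ∀ z, 0 ≤ law z :=
    feedbackLaw_nonneg (pairChannel_nonneg h.nonneg1 h.nonneg2) f
  set ν : Fin 2 × Fin N → ℝ := fun x => μ (1 - x.1)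
  set dev : (Fin (n + 2 * m) → ℝ) → Fin (2 * D + 1) → (Fin (n + 2 * m) → Y) → ℝ :=
    fun σ k y => ∑ i, σ i * (Real.log (W2 (words k i) (y i) / q (y i)) - ν (words k i)) with hdev
  set σ1 : Fin (n + 2 * m) → ℝ := Fin.append (fun _ => 1) fun _ => 0 with hσ1
  set σ2 : Fin (n + 2 * m) → ℝ := Fin.append (fun _ => 0) fun _ => 1 with hσ2
  set tail : Fin (2 * D + 1) → Set (Fin (n + 2 * m) → Y) :=
    fun k => {y | R < |dev σ1 k y|} ∪ {y | r < |dev σ2 k y|} with htail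
  have htailmass : mass law {z | Prod.snd ∘ z ∈ tail (k' z)} ≤ steeringTail n (2 * m) D B R r := by
    refine (mass_feedbackLaw_snd_le h.nonneg1 h.nonneg2 h.sum1 k' words (fun z => rfl) tail).trans ?_
    have hone : ∀ k, mass (wordLaw W2 (words k)) (tail k) ≤
        2 * Real.exp (-(R ^ 2 / (4 * n * B ^ 2))) +
          2 * Real.exp (-(r ^ 2 / (4 * (2 * m : ℕ) * B ^ 2))) := by
      intro k
      refine (mass_union_le (wordLaw_nonneg h.nonneg2 _) _ _).trans (add_le_add ?_ ?_)
      · refine mass_wordLaw_deviation_le h.nonneg2 h.sum2 h.mean2 h.bound2 hB (words k) (σ := σ1)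
          (fun i => ?_) (by exact_mod_cast hn) (by simp [hσ1, Fin.sum_univ_add]) hR hRn
        induction i using Fin.addCases <;> simp [hσ1]
      · refine mass_wordLaw_deviation_le h.nonneg2 h.sum2 h.mean2 h.bound2 hB (words k) (σ := σ2)
          (fun i => ?_) (by exact_mod_cast (by omega : 0 < 2 * m))
          (by simp [hσ2, Fin.sum_univ_add]) hr (by push_cast; exact hrm)
        induction i using Fin.addCases <;> simp [hσ2]
    refine (sum_le_card_nsmul _ _ _ fun k _ => hone k).trans_eq ?_
    rw [card_univ, Fintype.card_fin, nsmul_eq_mul, steeringTail]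
    push_cast
    ring
  have hgood : ∀ z, law z ≠ 0 → Prod.snd ∘ z ∉ tail (k' z) →
      τ ≤ wordLLR W2 q (f z) (Prod.snd ∘ z) ∧
        wordLLR W2 q (f z) (Prod.snd ∘ z) ≤ τ + 2 * r + |Δ| := by
    intro z _ hz
    simp only [htail, Set.mem_union, Set.mem_ofPred_eq, not_or, not_lt] at hz
    set z1 : Fin n → Y × Y := fun i => z (Fin.castAdd (2 * m) i)
    have e1 : dev σ1 (k' z) (Prod.snd ∘ z) = wordLLR W2 q u (Prod.snd ∘ z1) - ∑ i, ν (u i) := by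
      simp [hdev, hσ1, words, Fin.sum_univ_add, wordLLR, z1]
    have e2 : dev σ2 (k' z) (Prod.snd ∘ z) =
        wordLLR W2 q (w (k' z)) (fun i => (z (Fin.natAdd n i)).2) - ∑ i, ν (w (k' z) i) := by
      simp [hdev, hσ2, words, Fin.sum_univ_add, wordLLR]
    have e3 : wordLLR W2 q (f z) (Prod.snd ∘ z) = wordLLR W2 q u (Prod.snd ∘ z1) +
        wordLLR W2 q (w (k' z)) (fun i => (z (Fin.natAdd n i)).2) := wordLLR_append _ _ _ _ _
    have m1 := abs_sum_half_composition_sub_le hu fun t => μ (1 - t)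
    have m2 : ∑ i, ν (w (k' z) i) = m * (μ 0 + μ 1) + (D - (k' z : ℕ)) * Δ := by
      have := sum_compositionClass (hw (k' z)) fun t => μ (1 - t)
      rw [show ∑ i, ν (w (k' z) i) = ∑ i, μ (1 - (w (k' z) i).1) from rfl, this]
      rw [Nat.cast_add, Nat.cast_sub hD]
      simp only [sub_zero, sub_self, hΔdef]
      push_cast
      ring
    simp only [sub_zero, sub_self] at m1
    rw [abs_sub_comm (μ 1), add_comm (μ 1), ← hΔdef] at m1
    rw [e1, e2, m2] at hz
    have hx : |x z1| ≤ (D - 1) * |Δ| := by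
      have hm1 := abs_le.1 m1
      have hz1 := abs_le.1 hz.1
      have hν : ∑ i, ν (u i) = ∑ i, μ (1 - (u i).1) := rfl
      rw [hν] at hz1
      obtain ⟨t1, t2⟩ := abs_le.1 (le_refl |τ + r - (n + 2 * m) * ((μ 0 + μ 1) / 2)|)
      refine abs_le.2 ⟨?_, ?_⟩ <;> simp only [x] <;> linarith
    obtain ⟨k1, k2⟩ := hk z1 hx
    have hz2 := abs_le.1 hz.2
    have hkk : k' z = k z1 := rfl
    rw [hkk] at hz2 e3
    simp only [x] at k1 k2
    rw [e3]
    constructor <;> linarith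
  have hlawpos : ∀ z, law z ≠ 0 → 0 < wordLaw W1 (f z) (Prod.fst ∘ z) ∧
      0 < wordLaw W2 (f z) (Prod.snd ∘ z) := by
    intro z hz
    rw [hlaw, feedbackLaw_pairChannel] at hz
    exact ⟨(wordLaw_nonneg h.nonneg1 _ _).lt_of_ne' (left_ne_zero_of_mul hz),
      (wordLaw_nonneg h.nonneg2 _ _).lt_of_ne' (right_ne_zero_of_mul hz)⟩
  refine ⟨f, isCausal_append u w k, ⟨k', fun z => rfl⟩, ?_, ?_⟩
  · refine (mass_le_of_support hlaw0 fun z hz hz0 => ?_).trans htailmass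
    by_contra hzt
    exact hz ⟨k' z, (hlawpos z hz0).2, (hgood z hz0 hzt).1⟩
  · refine le_trans ?_ (add_le_add_right htailmass _)
    refine le_trans ?_ (mass_union_le hlaw0 _ _)
    refine mass_le_of_support hlaw0 fun z hz hz0 => ?_
    by_cases hzt : Prod.snd ∘ z ∈ tail (k' z)
    · exact Or.inr hzt
    left
    have h1 : wordLLR W1 q (f z) (Prod.fst ∘ z) < τ := by
      by_contra hc
      exact hz ⟨k' z, (hlawpos z hz0).1, not_lt.1 hc⟩
    rw [Set.mem_ofPred_eq, sum_totalDens]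
    linarith [(hgood z hz0 hzt).2]

end BalancedPair
/-! ### Selection of codewords -/

section Codes

variable {A Y : Type*} [Fintype Y]

theorem errProb1_eq (W1 W2 : A → Y → ℝ) (n M : ℕ)
    (f : Fin M → (Fin n → Y) → (Fin n → Y) → Fin n → A) (g : (Fin n → Y) → Fin M) :
    errProb1 W1 W2 n M f g = (1 / M : ℝ) * ∑ j, mass (feedbackLaw (pairChannel W1 W2)
      fun z => f j (Prod.fst ∘ z) (Prod.snd ∘ z)) {z | g (Prod.fst ∘ z) ≠ j} := by
  rw [errProb1, mul_sum]
  refine sum_congr rfl fun j _ => ?_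
  rw [mass, sum_pair_words, mul_sum]
  refine sum_congr rfl fun y1 _ => ?_
  rw [mul_sum]
  refine sum_congr rfl fun y2 _ => ?_
  by_cases h : g y1 = j <;>
    simp [Set.indicator, Function.comp_def, h, codeLaw, feedbackLaw, pairChannel]

theorem errProb2_eq (W1 W2 : A → Y → ℝ) (n M : ℕ)
    (f : Fin M → (Fin n → Y) → (Fin n → Y) → Fin n → A) (g : (Fin n → Y) → Fin M) :
    errProb2 W1 W2 n M f g = (1 / M : ℝ) * ∑ j, mass (feedbackLaw (pairChannel W1 W2)
      fun z => f j (Prod.fst ∘ z) (Prod.snd ∘ z)) {z | g (Prod.snd ∘ z) ≠ j} := by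
  rw [errProb2, mul_sum]
  refine sum_congr rfl fun j _ => ?_
  rw [mass, sum_pair_words, mul_sum]
  refine sum_congr rfl fun y1 _ => ?_
  rw [mul_sum]
  refine sum_congr rfl fun y2 _ => ?_
  by_cases h : g y2 = j <;>
    simp [Set.indicator, Function.comp_def, h, codeLaw, feedbackLaw, pairChannel]

theorem flfExists_iff (W1 W2 : A → Y → ℝ) (n M : ℕ) (ε : ℝ) :
    FLFExists W1 W2 n M ε ↔ ∃ f : Fin M → (Fin n → Y × Y) → Fin n → A, (∀ j, IsCausal (f j)) ∧
      ∃ g1 g2 : (Fin n → Y) → Fin M,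
        (1 / M : ℝ) * ∑ j, mass (feedbackLaw (pairChannel W1 W2) (f j))
          {z | g1 (Prod.fst ∘ z) ≠ j} ≤ ε ∧
        (1 / M : ℝ) * ∑ j, mass (feedbackLaw (pairChannel W1 W2) (f j))
          {z | g2 (Prod.snd ∘ z) ≠ j} ≤ ε := by
  constructor
  · rintro ⟨f, hf, g1, g2, h1, h2⟩
    rw [errProb1_eq] at h1
    rw [errProb2_eq] at h2
    refine ⟨fun j z => f j (Prod.fst ∘ z) (Prod.snd ∘ z), fun j z z' i h => ?_, g1, g2, h1, h2⟩
    exact hf j _ _ _ _ i (fun t ht => by simp [h t ht]) fun t ht => by simp [h t ht]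
  · rintro ⟨f, hf, g1, g2, h1, h2⟩
    refine ⟨fun j y1 y2 => f j fun i => (y1 i, y2 i), fun j y1 y1' y2 y2' i e1 e2 => ?_, g1, g2, ?_, ?_⟩
    · exact hf j _ _ i fun t ht => by simp [e1 t ht, e2 t ht]
    · rwa [errProb1_eq]
    · rwa [errProb2_eq]

end Codes

/-- The ratio between the numbers of all words and of words of the compositions in use. -/
def compositionLoss (n m D : ℕ) : ℝ := (n + 1) * (2 * m) * Real.exp (4 * D ^ 2 / m)

theorem pow_le_compositionLoss_mul_card {N n m D : ℕ} (hm : 0 < m) (hD : 4 * D ≤ m)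
    (k : Fin (2 * D + 1)) :
    (2 * N : ℝ) ^ (n + 2 * m) ≤ compositionLoss n m D *
      (#(compositionClass N n (n / 2)) * #(compositionClass N (2 * m) (m - D + (k : ℕ)))) := by
  have h1 : (2 : ℝ) ^ n ≤ (n + 1) * n.choose (n / 2) := by
    exact_mod_cast two_pow_le_succ_mul_choose_half n
  have h2 := four_pow_mul_exp_le_choose (D := D) (z := m - D + k) hm hD (by omega)
    (by have := k.2; omega)
  have h3 : ((n.choose (n / 2) * N ^ n : ℕ) : ℝ) ≤ #(compositionClass N n (n / 2)) := by
    exact_mod_cast choose_mul_pow_le_card_compositionClass N n (n / 2)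
  have h4 : (((2 * m).choose (m - D + k) * N ^ (2 * m) : ℕ) : ℝ) ≤
      #(compositionClass N (2 * m) (m - D + (k : ℕ))) := by
    exact_mod_cast choose_mul_pow_le_card_compositionClass N (2 * m) (m - D + k)
  push_cast at h3 h4
  have h5 : (4 : ℝ) ^ m ≤ 2 * m * (2 * m).choose (m - D + k) * Real.exp (4 * D ^ 2 / m) := by
    calc (4 : ℝ) ^ m = 4 ^ m * Real.exp (-(4 * D ^ 2 / m)) * Real.exp (4 * D ^ 2 / m) := by
          rw [mul_assoc, ← Real.exp_add]; simp
      _ ≤ _ := by gcongr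
  have h6 : (2 * N : ℝ) ^ (n + 2 * m) = 2 ^ n * 4 ^ m * (N ^ n * N ^ (2 * m)) := by
    rw [mul_pow, pow_add, pow_add, pow_mul]; norm_num
  rw [h6, compositionLoss]
  calc (2 : ℝ) ^ n * 4 ^ m * (N ^ n * N ^ (2 * m))
      ≤ ((n + 1) * n.choose (n / 2)) *
          (2 * m * (2 * m).choose (m - D + k) * Real.exp (4 * D ^ 2 / m)) *
          (N ^ n * N ^ (2 * m)) := by gcongr
    _ = (n + 1) * (2 * m) * Real.exp (4 * D ^ 2 / m) *
        ((n.choose (n / 2) * N ^ n) * ((2 * m).choose (m - D + k) * N ^ (2 * m))) := by ring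
    _ ≤ _ := by gcongr

theorem sum_mass_wordLaw {A Y : Type*} [Fintype A] [Fintype Y] {n m : ℕ} {W : A → Y → ℝ} {q : Y → ℝ}
    {c : ℝ} (h : ∀ y, ∑ x, W x y = c * q y) (E : Set (Fin (n + m) → Y)) :
    ∑ u : Fin n → A, ∑ w : Fin m → A, mass (wordLaw W (Fin.append u w)) E =
      c ^ (n + m) * mass (fun y => ∏ i, q (y i)) E := by
  rw [← Fintype.sum_prod_type' fun u w => mass (wordLaw W (Fin.append u w)) E,
    ← mass_const_mul]
  simp only [← sum_words_wordLaw h]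
  rw [mass_sum]
  exact (Fin.appendEquiv n m).sum_comp fun w => mass (wordLaw W w) E

/-- The family of words attached to a prefix and its continuations. -/
def treeWords {A : Type*} {n m : ℕ} {κ : Type*} (t : (Fin n → A) × (κ → Fin m → A)) (k : κ) :
    Fin (n + m) → A := Fin.append t.1 (t.2 k)

namespace BalancedPair

variable {Y : Type*} [Fintype Y] {N : ℕ} {W1 W2 : Fin 2 × Fin N → Y → ℝ} {q : Y → ℝ}
  {μ : Fin 2 → ℝ} {v B : ℝ}

theorem exists_words (h : BalancedPair W1 W2 q μ v B) (hN : 0 < N) {n m D : ℕ} (hm : 0 < m)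
    (hD : 4 * D ≤ m) {E1 E2 : Set (Fin (n + 2 * m) → Y)} {T : ℝ}
    (hE1 : mass (fun y => ∏ i, q (y i)) E1 ≤ T) (hE2 : mass (fun y => ∏ i, q (y i)) E2 ≤ T) :
    ∃ u ∈ compositionClass N n (n / 2), ∃ w : Fin (2 * D + 1) → Fin (2 * m) → Fin 2 × Fin N,
      ∀ k : Fin (2 * D + 1), w k ∈ compositionClass N (2 * m) (m - D + (k : ℕ)) ∧
        mass (wordLaw W1 (Fin.append u (w k))) E1 ≤ 2 * T * compositionLoss n m D ∧
        mass (wordLaw W2 (Fin.append u (w k))) E2 ≤ 2 * T * compositionLoss n m D := by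
  have hβ : 0 < compositionLoss n m D := by
    have : (0 : ℝ) < m := by exact_mod_cast hm
    unfold compositionLoss
    positivity
  have hX : (0 : ℝ) < (2 * N : ℝ) ^ (n + 2 * m) := by positivity
  obtain ⟨u, hu, w, hw⟩ := exists_prefix_continuations (compositionClass N n (n / 2))
    (fun k : Fin (2 * D + 1) => compositionClass N (2 * m) (m - D + (k : ℕ)))
    (fun u w => mass (wordLaw W1 (Fin.append u w)) E1 + mass (wordLaw W2 (Fin.append u w)) E2)
    (fun u w => add_nonneg (mass_nonneg (wordLaw_nonneg h.nonneg1 _) _)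
      (mass_nonneg (wordLaw_nonneg h.nonneg2 _) _))
    (a := (2 * N : ℝ) ^ (n + 2 * m) / compositionLoss n m D)
    (T := (2 * N : ℝ) ^ (n + 2 * m) * (2 * T)) (div_pos hX hβ)
    (fun k => by
      rw [div_le_iff₀' hβ]
      exact pow_le_compositionLoss_mul_card hm hD k)
    (by
      simp only [sum_add_distrib]
      rw [sum_mass_wordLaw h.avg1, sum_mass_wordLaw h.avg2, ← mul_add]
      gcongr
      linarith)
  have he : (2 * N : ℝ) ^ (n + 2 * m) * (2 * T) / ((2 * N : ℝ) ^ (n + 2 * m) / compositionLoss n m D)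
      = 2 * T * compositionLoss n m D := by
    field_simp
  refine ⟨u, hu, w, fun k => ⟨(hw k).1, ?_, ?_⟩⟩
  · linarith [(hw k).2, mass_nonneg (wordLaw_nonneg h.nonneg2 (Fin.append u (w k))) E2]
  · linarith [(hw k).2, mass_nonneg (wordLaw_nonneg h.nonneg1 (Fin.append u (w k))) E1]

/-- Greedy selection of families of words whose decoding sets hardly overlap. -/
theorem exists_trees (h : BalancedPair W1 W2 q μ v B) (hN : 0 < N) {n m D : ℕ} (hm : 0 < m)
    (hD : 4 * D ≤ m) (τ : ℝ) {M l : ℕ}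
    (hl : l ≤ M) :
    ∃ t : ℕ → (Fin n → Fin 2 × Fin N) × (Fin (2 * D + 1) → Fin (2 * m) → Fin 2 × Fin N),
      ∀ j < l, (t j).1 ∈ compositionClass N n (n / 2) ∧
        ∀ k : Fin (2 * D + 1), (t j).2 k ∈ compositionClass N (2 * m) (m - D + (k : ℕ)) ∧
          mass (wordLaw W1 (treeWords (t j) k))
            {y | ∃ i < j, y ∈ decodeSet W1 q τ (treeWords (t i))} ≤
            2 * (M * ((2 * D + 1) * Real.exp (-τ))) * compositionLoss n m D ∧
          mass (wordLaw W2 (treeWords (t j) k))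
            {y | ∃ i < j, y ∈ decodeSet W2 q τ (treeWords (t i))} ≤
            2 * (M * ((2 * D + 1) * Real.exp (-τ))) * compositionLoss n m D := by
  classical
  induction l with
  | zero => exact ⟨fun _ => (fun _ => (0, ⟨0, hN⟩), fun _ _ => (0, ⟨0, hN⟩)), by simp⟩
  | succ l ih =>
    obtain ⟨t, ht⟩ := ih (by omega)
    have hmass : ∀ (W : Fin 2 × Fin N → Y → ℝ), (∀ x y, 0 ≤ W x y) → (∀ x, ∑ y, W x y = 1) →
        (∀ x y, 0 < W x y → 0 < q y) →
        mass (fun y => ∏ i, q (y i)) {y | ∃ i < l, y ∈ decodeSet W q τ (treeWords (t i))} ≤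
          M * ((2 * D + 1) * Real.exp (-τ)) := by
      intro W hW hW1 hWq
      have hU : {y | ∃ i < l, y ∈ decodeSet W q τ (treeWords (t i))} =
          ⋃ i ∈ range l, decodeSet W q τ (treeWords (t i)) := by
        ext y; simp
      rw [hU]
      refine (mass_biUnion_le (fun y => prod_nonneg fun i _ => h.q_nonneg hN _) _ _).trans ?_
      refine (sum_le_card_nsmul _ _ ((2 * D + 1) * Real.exp (-τ)) fun i _ => ?_).trans ?_
      · refine (mass_decodeSet_le τ hW hW1 (h.q_nonneg hN) hWq _).trans_eq ?_
        simp
      · rw [card_range, nsmul_eq_mul]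
        have : (l : ℝ) ≤ M := by exact_mod_cast (by omega : l ≤ M)
        gcongr
    obtain ⟨u, hu, w, hw⟩ := h.exists_words hN hm hD (hmass W1 h.nonneg1 h.sum1 h.q_pos)
      (hmass W2 h.nonneg2 h.sum2 h.symm.q_pos)
    refine ⟨Function.update t l (u, w), fun j hj => ?_⟩
    have hlt : ∀ i < l, Function.update t l (u, w) i = t i := fun i hi =>
      Function.update_of_ne hi.ne _ _
    have hset : ∀ W : Fin 2 × Fin N → Y → ℝ,
        {y | ∃ i < j, y ∈ decodeSet W q τ (treeWords (Function.update t l (u, w) i))} =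
          {y | ∃ i < j, y ∈ decodeSet W q τ (treeWords (t i))} := by
      intro W
      ext y
      simp only [Set.mem_ofPred_eq]
      refine exists_congr fun i => and_congr_right fun hi => ?_
      rw [hlt i (by omega)]
    rw [hset, hset]
    rcases (Nat.lt_succ_iff_lt_or_eq.1 hj) with hj' | rfl
    · rw [hlt j hj']
      exact ht j hj'
    · rw [Function.update_self]
      exact ⟨hu, hw⟩

end BalancedPair
/-! ### Construction of the code -/

/-- A decoder which outputs the first message passing its test. -/
theorem exists_firstDecoder {Z : Type*} (S : ℕ → Set Z) {M : ℕ} (hM : 0 < M) :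
    ∃ g : Z → Fin M, ∀ (j : Fin M) (y : Z), y ∈ S j → y ∉ {y | ∃ i < (j : ℕ), y ∈ S i} → g y = j := by
  classical
  refine ⟨fun y => if hy : ∃ i, i < M ∧ y ∈ S i then ⟨Nat.find hy, (Nat.find_spec hy).1⟩
    else ⟨0, hM⟩, fun j y hj hlt => ?_⟩
  have hy : ∃ i, i < M ∧ y ∈ S i := ⟨j, j.2, hj⟩
  dsimp only
  rw [dif_pos hy]
  refine Fin.ext (le_antisymm (Nat.find_min' hy ⟨j.2, hj⟩) ?_)
  by_contra hc
  exact hlt ⟨_, not_le.1 hc, (Nat.find_spec hy).2⟩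

/-- The Berry-Esseen type bound on the lower tail of the total information density. -/
def lowerTailBound (n : ℕ) (v B s ρ t : ℝ) : ℝ :=
  Qfun ((-t - ρ) / Real.sqrt (s + n * v)) + 4 * (((2 * B) ^ 3 + 3 * v ^ 2) / v) / Real.sqrt s +
    Qfun (ρ / Real.sqrt s)

namespace BalancedPair

variable {Y : Type*} [Fintype Y] {N : ℕ} {W1 W2 : Fin 2 × Fin N → Y → ℝ} {q : Y → ℝ}
  {μ : Fin 2 → ℝ} {v B : ℝ}

theorem nonempty (h : BalancedPair W1 W2 q μ v B) (hN : 0 < N) : Nonempty Y := by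
  by_contra hY
  have := h.sum1 (0, ⟨0, hN⟩)
  rw [not_nonempty_iff] at hY
  simp at this

theorem sum_pairChannel_totalDens (h : BalancedPair W1 W2 q μ v B) (x : Fin 2 × Fin N) :
    ∑ a, pairChannel W1 W2 x a * totalDens W1 W2 q (μ 0 + μ 1) x a = 0 := by
  have h1 : ∀ a, pairChannel W1 W2 x a * totalDens W1 W2 q (μ 0 + μ 1) x a =
      W1 x a.1 * Real.log (W1 x a.1 / q a.1) * W2 x a.2 +
      W1 x a.1 * (W2 x a.2 * Real.log (W2 x a.2 / q a.2)) - (μ 0 + μ 1) * pairChannel W1 W2 x a :=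
    fun a => by simp only [pairChannel, totalDens]; ring
  simp only [h1, sum_sub_distrib, sum_add_distrib, ← mul_sum, sum_pairChannel h.sum1 h.sum2]
  rw [Fintype.sum_prod_type, Fintype.sum_prod_type]
  simp only [← mul_sum, ← sum_mul, h.sum1, h.sum2, h.mean1, h.mean2]
  have : x.1 = 0 ∨ x.1 = 1 := by omega
  rcases this with h0 | h0 <;> simp [h0]; ring

theorem abs_totalDens_le (h : BalancedPair W1 W2 q μ v B) (x : Fin 2 × Fin N) (a : Y × Y) :
    |totalDens W1 W2 q (μ 0 + μ 1) x a| ≤ 2 * B := by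
  have hμ : μ 0 + μ 1 = μ x.1 + μ (1 - x.1) := by
    have : x.1 = 0 ∨ x.1 = 1 := by omega
    rcases this with h0 | h0 <;> simp [h0]; ring
  have e : totalDens W1 W2 q (μ 0 + μ 1) x a = (Real.log (W1 x a.1 / q a.1) - μ x.1) +
      (Real.log (W2 x a.2 / q a.2) - μ (1 - x.1)) := by
    rw [totalDens, hμ]; ring
  rw [e]
  refine (abs_add_le _ _).trans ?_
  linarith [h.bound1 x a.1, h.bound2 x a.2]

theorem mass_totalDens_le (h : BalancedPair W1 W2 q μ v B) (hN : 0 < N) (hB : 0 ≤ B) (hv : 0 < v)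
    {n : ℕ} {f : (Fin n → Y × Y) → Fin n → Fin 2 × Fin N} (hf : IsCausal f) {s : ℝ} (hs : 1 ≤ s)
    (hvs : v ≤ s) (t ρ : ℝ) :
    mass (feedbackLaw (pairChannel W1 W2) f)
      {z | ∑ i, totalDens W1 W2 q (μ 0 + μ 1) (f z i) (z i) ≤ t} ≤ lowerTailBound n v B s ρ t :=
  have := h.nonempty hN
  mass_feedbackLaw_le (pairChannel_nonneg h.nonneg1 h.nonneg2) (sum_pairChannel h.sum1 h.sum2)
    h.sum_pairChannel_totalDens h.var (fun x z _ => h.abs_totalDens_le x z) (by linarith) hv hf hs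
    hvs t ρ

theorem le_mass_totalDens (h : BalancedPair W1 W2 q μ v B) (hN : 0 < N) (hB : 0 ≤ B) (hv : 0 < v)
    {n : ℕ} {f : (Fin n → Y × Y) → Fin n → Fin 2 × Fin N} (hf : IsCausal f) {s : ℝ} (hs : 1 ≤ s)
    (hvs : v ≤ s) (t ρ : ℝ) :
    Qfun ((-t + ρ) / Real.sqrt (s + n * v)) - 4 * (((2 * B) ^ 3 + 3 * v ^ 2) / v) / Real.sqrt s -
      Qfun (ρ / Real.sqrt s) ≤ mass (feedbackLaw (pairChannel W1 W2) f)
      {z | ∑ i, totalDens W1 W2 q (μ 0 + μ 1) (f z i) (z i) ≤ t} :=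
  have := h.nonempty hN
  le_mass_feedbackLaw (pairChannel_nonneg h.nonneg1 h.nonneg2) (sum_pairChannel h.sum1 h.sum2)
    h.sum_pairChannel_totalDens h.var (fun x z _ => h.abs_totalDens_le x z) (by linarith) hv hf hs
    hvs t ρ

/-- The parameters of the steering scheme are admissible. -/
def _root_.SteeringAdmissible (μ : Fin 2 → ℝ) (v B : ℝ) (n m D : ℕ) (τ r R s : ℝ) : Prop :=
  0 < n ∧ 0 < m ∧ 4 * D ≤ m ∧ 0 ≤ r ∧ r ≤ 2 * (2 * m) * B ∧ 0 ≤ R ∧ R ≤ 2 * n * B ∧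
    |τ + r - (n + 2 * m) * ((μ 0 + μ 1) / 2)| + R + |μ 0 - μ 1| ≤ (D - 1) * |μ 0 - μ 1| ∧
    1 ≤ s ∧ v ≤ s

theorem _root_.SteeringAdmissible.symm {n m D : ℕ} {τ r R s : ℝ}
    (ha : SteeringAdmissible μ v B n m D τ r R s) :
    SteeringAdmissible (fun t => μ (1 - t)) v B n m D τ r R s := by
  simpa only [SteeringAdmissible, sub_zero, sub_self, add_comm (μ 1), abs_sub_comm (μ 1)] using ha

/-- The strategy of one message, steering the second decoder. -/
theorem exists_strategy (h : BalancedPair W1 W2 q μ v B) (hN : 0 < N) (hμ : μ 0 ≠ μ 1)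
    (hB : 0 < B) (hv : 0 < v) {n m D : ℕ} {τ r R s : ℝ}
    (ha : SteeringAdmissible μ v B n m D τ r R s) (ρ : ℝ)
    {t : (Fin n → Fin 2 × Fin N) × (Fin (2 * D + 1) → Fin (2 * m) → Fin 2 × Fin N)}
    (ht1 : t.1 ∈ compositionClass N n (n / 2))
    (ht2 : ∀ k : Fin (2 * D + 1), t.2 k ∈ compositionClass N (2 * m) (m - D + (k : ℕ))) :
    ∃ f : (Fin (n + 2 * m) → Y × Y) → Fin (n + 2 * m) → Fin 2 × Fin N,
      IsCausal f ∧ (∃ k : (Fin (n + 2 * m) → Y × Y) → Fin (2 * D + 1), ∀ z, f z = treeWords t (k z)) ∧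
      mass (feedbackLaw (pairChannel W1 W2) f)
        {z | Prod.snd ∘ z ∉ decodeSet W2 q τ (treeWords t)} ≤ steeringTail n (2 * m) D B R r ∧
      mass (feedbackLaw (pairChannel W1 W2) f)
        {z | Prod.fst ∘ z ∉ decodeSet W1 q τ (treeWords t)} ≤
        lowerTailBound (n + 2 * m) v B s ρ
          (2 * τ + 2 * r + |μ 0 - μ 1| - (n + 2 * m : ℕ) * (μ 0 + μ 1)) +
          steeringTail n (2 * m) D B R r := by
  obtain ⟨hn, hm, hD, hr, hrm, hR, hRn, hτ, hs, hvs⟩ := ha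
  obtain ⟨f, hf, hk, h2, h1⟩ :=
    h.exists_steering hμ hB hn hm (by omega) ht1 ht2 hr hrm hR hRn hτ
  exact ⟨f, hf, hk, h2, h1.trans
    (add_le_add_left (h.mass_totalDens_le hN hB.le hv hf hs hvs _ ρ) _)⟩

/-- The strategy of one message, steering the first decoder. -/
theorem exists_strategy_symm (h : BalancedPair W1 W2 q μ v B) (hN : 0 < N) (hμ : μ 0 ≠ μ 1)
    (hB : 0 < B) (hv : 0 < v) {n m D : ℕ} {τ r R s : ℝ}
    (ha : SteeringAdmissible μ v B n m D τ r R s) (ρ : ℝ)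
    {t : (Fin n → Fin 2 × Fin N) × (Fin (2 * D + 1) → Fin (2 * m) → Fin 2 × Fin N)}
    (ht1 : t.1 ∈ compositionClass N n (n / 2))
    (ht2 : ∀ k : Fin (2 * D + 1), t.2 k ∈ compositionClass N (2 * m) (m - D + (k : ℕ))) :
    ∃ f : (Fin (n + 2 * m) → Y × Y) → Fin (n + 2 * m) → Fin 2 × Fin N,
      IsCausal f ∧ (∃ k : (Fin (n + 2 * m) → Y × Y) → Fin (2 * D + 1), ∀ z, f z = treeWords t (k z)) ∧
      mass (feedbackLaw (pairChannel W1 W2) f)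
        {z | Prod.fst ∘ z ∉ decodeSet W1 q τ (treeWords t)} ≤ steeringTail n (2 * m) D B R r ∧
      mass (feedbackLaw (pairChannel W1 W2) f)
        {z | Prod.snd ∘ z ∉ decodeSet W2 q τ (treeWords t)} ≤
        lowerTailBound (n + 2 * m) v B s ρ
          (2 * τ + 2 * r + |μ 0 - μ 1| - (n + 2 * m : ℕ) * (μ 0 + μ 1)) +
          steeringTail n (2 * m) D B R r := by
  obtain ⟨f, hf, ⟨k, hk⟩, h1, h2⟩ :=
    h.symm.exists_strategy hN (by simpa using hμ.symm) hB hv ha.symm ρ ht1 ht2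
  have hsw : (fun z => f (Prod.swap ∘ (Prod.swap ∘ z))) = f := by
    funext z
    congr 1
  refine ⟨fun z => f (Prod.swap ∘ z), isCausal_comp_swap hf,
    ⟨fun z => k (Prod.swap ∘ z), fun z => hk _⟩, ?_, ?_⟩
  · rw [mass_feedbackLaw_swap, hsw]
    exact h1
  · rw [mass_feedbackLaw_swap, hsw]
    simp only [sub_zero, sub_self, add_comm (μ 1), abs_sub_comm (μ 1)] at h2
    exact h2

/-- Random coding with a fair coin deciding which decoder is steered. -/
theorem flfExists (h : BalancedPair W1 W2 q μ v B) (hN : 0 < N) (hμ : μ 0 ≠ μ 1)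
    (hB : 0 < B) (hv : 0 < v) {n m D : ℕ} {τ r R s : ℝ}
    (ha : SteeringAdmissible μ v B n m D τ r R s) (ρ : ℝ) {M : ℕ} (hM : 0 < M) {ε : ℝ}
    (hε : lowerTailBound (n + 2 * m) v B s ρ
        (2 * τ + 2 * r + |μ 0 - μ 1| - (n + 2 * m : ℕ) * (μ 0 + μ 1)) / 2 +
        steeringTail n (2 * m) D B R r +
        (2 * D + 1) * (2 * ((M + M : ℕ) * ((2 * D + 1) * Real.exp (-τ))) * compositionLoss n m D) ≤
          ε) :
    FLFExists W1 W2 (n + 2 * m) (M + M) ε := by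
  classical
  set b := lowerTailBound (n + 2 * m) v B s ρ
    (2 * τ + 2 * r + |μ 0 - μ 1| - (n + 2 * m : ℕ) * (μ 0 + μ 1))
  set δ := steeringTail n (2 * m) D B R r
  set η := 2 * ((M + M : ℕ) * ((2 * D + 1) * Real.exp (-τ))) * compositionLoss n m D
  obtain ⟨t, ht⟩ := h.exists_trees hN ha.2.1 ha.2.2.1 τ (le_refl (M + M))
  have hA := fun j : Fin M => h.exists_strategy hN hμ hB hv ha ρ (t := t (Fin.castAdd M j))
    (ht _ (Fin.is_lt _)).1 fun k => ((ht _ (Fin.is_lt (Fin.castAdd M j))).2 k).1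
  have hB' := fun j : Fin M => h.exists_strategy_symm hN hμ hB hv ha ρ (t := t (Fin.natAdd M j))
    (ht _ (Fin.is_lt _)).1 fun k => ((ht _ (Fin.is_lt (Fin.natAdd M j))).2 k).1
  choose fA hfA hkA hA1 hA2 using fun j => (hA j)
  choose fB hfB hkB hB1 hB2 using fun j => (hB' j)
  obtain ⟨g1, hg1⟩ := exists_firstDecoder (fun j => decodeSet W1 q τ (treeWords (t j)))
    (by omega : 0 < M + M)
  obtain ⟨g2, hg2⟩ := exists_firstDecoder (fun j => decodeSet W2 q τ (treeWords (t j)))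
    (by omega : 0 < M + M)
  have hp0 : ∀ f : (Fin (n + 2 * m) → Y × Y) → Fin (n + 2 * m) → Fin 2 × Fin N,
      ∀ z, 0 ≤ feedbackLaw (pairChannel W1 W2) f z :=
    feedbackLaw_nonneg (pairChannel_nonneg h.nonneg1 h.nonneg2)
  have herr1 : ∀ (j : Fin (M + M)) (f : (Fin (n + 2 * m) → Y × Y) → Fin (n + 2 * m) → Fin 2 × Fin N),
      (∃ k : (Fin (n + 2 * m) → Y × Y) → Fin (2 * D + 1), ∀ z, f z = treeWords (t j) (k z)) →
      ∀ c, mass (feedbackLaw (pairChannel W1 W2) f)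
        {z | Prod.fst ∘ z ∉ decodeSet W1 q τ (treeWords (t j))} ≤ c →
      mass (feedbackLaw (pairChannel W1 W2) f) {z | g1 (Prod.fst ∘ z) ≠ j} ≤
        c + (2 * D + 1) * η := by
    rintro j f ⟨k, hk⟩ c hc
    have hconf := mass_feedbackLaw_fst_le h.nonneg1 h.nonneg2 h.sum2 k (treeWords (t j)) hk
      fun _ => {y | ∃ i < (j : ℕ), y ∈ decodeSet W1 q τ (treeWords (t i))}
    have hsum := sum_le_card_nsmul univ (fun k => mass (wordLaw W1 (treeWords (t j) k))
      {y | ∃ i < (j : ℕ), y ∈ decodeSet W1 q τ (treeWords (t i))}) η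
      fun k _ => ((ht j j.2).2 k).2.1
    rw [card_univ, Fintype.card_fin, nsmul_eq_mul] at hsum
    push_cast at hsum
    refine (mass_mono (hp0 f) ?_).trans ((mass_union_le (hp0 f) _ _).trans
      (add_le_add hc (hconf.trans hsum)))
    intro z hz
    by_contra hcon
    simp only [Set.mem_union, not_or, Set.mem_ofPred_eq, not_not] at hcon
    exact hz (hg1 j _ hcon.1 hcon.2)
  have herr2 : ∀ (j : Fin (M + M)) (f : (Fin (n + 2 * m) → Y × Y) → Fin (n + 2 * m) → Fin 2 × Fin N),
      (∃ k : (Fin (n + 2 * m) → Y × Y) → Fin (2 * D + 1), ∀ z, f z = treeWords (t j) (k z)) →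
      ∀ c, mass (feedbackLaw (pairChannel W1 W2) f)
        {z | Prod.snd ∘ z ∉ decodeSet W2 q τ (treeWords (t j))} ≤ c →
      mass (feedbackLaw (pairChannel W1 W2) f) {z | g2 (Prod.snd ∘ z) ≠ j} ≤
        c + (2 * D + 1) * η := by
    rintro j f ⟨k, hk⟩ c hc
    have hconf := mass_feedbackLaw_snd_le h.nonneg1 h.nonneg2 h.sum1 k (treeWords (t j)) hk
      fun _ => {y | ∃ i < (j : ℕ), y ∈ decodeSet W2 q τ (treeWords (t i))}
    have hsum := sum_le_card_nsmul univ (fun k => mass (wordLaw W2 (treeWords (t j) k))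
      {y | ∃ i < (j : ℕ), y ∈ decodeSet W2 q τ (treeWords (t i))}) η
      fun k _ => ((ht j j.2).2 k).2.2
    rw [card_univ, Fintype.card_fin, nsmul_eq_mul] at hsum
    push_cast at hsum
    refine (mass_mono (hp0 f) ?_).trans ((mass_union_le (hp0 f) _ _).trans
      (add_le_add hc (hconf.trans hsum)))
    intro z hz
    by_contra hcon
    simp only [Set.mem_union, not_or, Set.mem_ofPred_eq, not_not] at hcon
    exact hz (hg2 j _ hcon.1 hcon.2)
  have hMR : (0 : ℝ) < M := by exact_mod_cast hM
  have havg : ∀ (F : Fin (M + M) → ℝ) (cA cB : ℝ), cA + cB = b + 2 * δ →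
      (∀ j, F (Fin.castAdd M j) ≤ cA + (2 * D + 1) * η) →
      (∀ j, F (Fin.natAdd M j) ≤ cB + (2 * D + 1) * η) →
      (1 / (M + M : ℕ) : ℝ) * ∑ j, F j ≤ ε := by
    intro F cA cB hc hFA hFB
    refine le_trans ?_ hε
    rw [Fin.sum_univ_add, one_div_mul_eq_div, div_le_iff₀ (by push_cast; linarith)]
    have h1 := sum_le_card_nsmul univ _ _ fun j _ => hFA j
    have h2 := sum_le_card_nsmul univ _ _ fun j _ => hFB j
    rw [card_univ, Fintype.card_fin, nsmul_eq_mul] at h1 h2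
    have hcB : cB = b + 2 * δ - cA := by linarith
    rw [hcB] at h2
    push_cast
    linarith
  rw [flfExists_iff]
  refine ⟨fun j => Fin.addCases fA fB j, fun j => ?_, g1, g2, ?_, ?_⟩
  · induction j using Fin.addCases with
    | left j => simpa only [Fin.addCases_left] using hfA j
    | right j => simpa only [Fin.addCases_right] using hfB j
  · refine havg _ (b + δ) δ (by ring) (fun j => ?_) fun j => ?_
    · simp only [Fin.addCases_left]
      exact herr1 _ _ (hkA j) _ (hA2 j)
    · simp only [Fin.addCases_right]
      exact herr1 _ _ (hkB j) _ (hB1 j)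
  · refine havg _ δ (b + δ) (by ring) (fun j => ?_) fun j => ?_
    · simp only [Fin.addCases_left]
      exact herr2 _ _ (hkA j) _ (hA1 j)
    · simp only [Fin.addCases_right]
      exact herr2 _ _ (hkB j) _ (hB2 j)

end BalancedPair

/-! ### Converse -/

namespace BalancedPair

variable {Y : Type*} [Fintype Y] {N : ℕ} {W1 W2 : Fin 2 × Fin N → Y → ℝ} {q : Y → ℝ}
  {μ : Fin 2 → ℝ} {v B : ℝ}

/-- Change of measure: feedback does not help to hit a set of outputs of the first decoder while
its log-likelihood ratio is small. -/
theorem mass_wordLLR_le_inter (h : BalancedPair W1 W2 q μ v B) (hN : 0 < N) {n : ℕ}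
    {f : (Fin n → Y × Y) → Fin n → Fin 2 × Fin N} (hf : IsCausal f) (T : ℝ)
    (E : Set (Fin n → Y)) :
    mass (feedbackLaw (pairChannel W1 W2) f)
      {z | wordLLR W1 q (f z) (Prod.fst ∘ z) ≤ T ∧ Prod.fst ∘ z ∈ E} ≤
      Real.exp T * mass (fun y => ∏ i, q (y i)) E := by
  classical
  have := h.nonempty hN
  have hQ : ∀ y : Fin n → Y, 0 ≤ ∏ i, q (y i) := fun y => prod_nonneg fun i _ => h.q_nonneg hN _
  unfold mass
  rw [sum_pair_words, mul_sum]
  refine sum_le_sum fun y1 _ => ?_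
  have hcausal : IsCausal fun y2 : Fin n → Y => f fun i => (y1 i, y2 i) :=
    fun y y' i ht => hf _ _ _ fun t h' => by rw [ht t h']
  have hone := sum_feedbackLaw h.sum2 hcausal
  by_cases hE : y1 ∈ E
  · rw [Set.indicator_of_mem hE, ← mul_one (Real.exp T * _), ← hone, mul_sum]
    refine sum_le_sum fun y2 _ => ?_
    have hrhs : 0 ≤ Real.exp T * (∏ i, q (y1 i)) *
        feedbackLaw W2 (fun y2 : Fin n → Y => f fun i => (y1 i, y2 i)) y2 :=
      mul_nonneg (mul_nonneg (Real.exp_pos _).le (hQ _)) (feedbackLaw_nonneg h.nonneg2 _ _)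
    rw [Set.indicator_apply]
    split_ifs with hz
    · rw [feedbackLaw_pairChannel]
      refine mul_le_mul_of_nonneg_right ?_ (wordLaw_nonneg h.nonneg2 _ _)
      rcases (wordLaw_nonneg h.nonneg1 (f fun i => (y1 i, y2 i)) y1).eq_or_lt with h0 | h0
      · exact h0.symm.trans_le (mul_nonneg (Real.exp_pos _).le (hQ _))
      · refine (wordLaw_eq_exp_mul h.nonneg1 h.q_pos h0).trans_le ?_
        exact mul_le_mul_of_nonneg_right (Real.exp_le_exp.2 hz.1) (hQ _)
    · exact hrhs
  · rw [Set.indicator_of_notMem hE, mul_zero]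
    refine (sum_eq_zero fun y2 _ => Set.indicator_of_notMem ?_ _).le
    exact fun hz => hE hz.2

theorem sum_mass_wordLLR_le (h : BalancedPair W1 W2 q μ v B) (hN : 0 < N) {n M : ℕ}
    {f : Fin M → (Fin n → Y × Y) → Fin n → Fin 2 × Fin N} (hf : ∀ j, IsCausal (f j)) (T : ℝ)
    (g : (Fin n → Y) → Fin M) :
    ∑ j, mass (feedbackLaw (pairChannel W1 W2) (f j))
      {z | wordLLR W1 q (f j z) (Prod.fst ∘ z) ≤ T} ≤
      ∑ j, mass (feedbackLaw (pairChannel W1 W2) (f j)) {z | g (Prod.fst ∘ z) ≠ j} +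
        Real.exp T := by
  have hQ : ∀ y : Fin n → Y, 0 ≤ ∏ i, q (y i) := fun y => prod_nonneg fun i _ => h.q_nonneg hN _
  have hp := fun j => feedbackLaw_nonneg (pairChannel_nonneg h.nonneg1 h.nonneg2) (f j)
  have hQ1 : ∑ j, mass (fun y : Fin n → Y => ∏ i, q (y i)) {y | g y = j} = 1 := by
    classical
    have hsum := Finset.prod_univ_sum (fun _ : Fin n => (univ : Finset Y)) fun _ y => q y
    rw [Fintype.piFinset_univ] at hsum
    unfold mass
    rw [sum_comm]
    simp only [Set.indicator_apply, Set.mem_ofPred_eq, sum_ite_eq, mem_univ, if_true, ← hsum,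
      h.sum_q hN, prod_const_one]
  calc _ ≤ ∑ j, (mass (feedbackLaw (pairChannel W1 W2) (f j)) {z | g (Prod.fst ∘ z) ≠ j} +
        Real.exp T * mass (fun y : Fin n → Y => ∏ i, q (y i)) {y | g y = j}) := by
        refine sum_le_sum fun j _ => ?_
        refine le_trans (mass_mono (hp j) fun z hz => ?_) ((mass_union_le (hp j) _ _).trans
          (add_le_add le_rfl (h.mass_wordLLR_le_inter hN (hf j) T {y | g y = j})))
        by_cases hg : g (Prod.fst ∘ z) = j
        · exact Or.inr ⟨hz, hg⟩
        · exact Or.inl hg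
    _ = _ := by rw [sum_add_distrib, ← mul_sum, hQ1, mul_one]

theorem sum_mass_wordLLR_le_symm (h : BalancedPair W1 W2 q μ v B) (hN : 0 < N) {n M : ℕ}
    {f : Fin M → (Fin n → Y × Y) → Fin n → Fin 2 × Fin N} (hf : ∀ j, IsCausal (f j)) (T : ℝ)
    (g : (Fin n → Y) → Fin M) :
    ∑ j, mass (feedbackLaw (pairChannel W1 W2) (f j))
      {z | wordLLR W2 q (f j z) (Prod.snd ∘ z) ≤ T} ≤
      ∑ j, mass (feedbackLaw (pairChannel W1 W2) (f j)) {z | g (Prod.snd ∘ z) ≠ j} +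
        Real.exp T := by
  simp only [mass_feedbackLaw_swap W1 W2]
  exact h.symm.sum_mass_wordLLR_le hN (fun j => isCausal_comp_swap (hf j)) T g

/-- The converse bound: if both decoders succeed, the sum of the information densities cannot be
small. -/
theorem converse (h : BalancedPair W1 W2 q μ v B) (hN : 0 < N) (hB : 0 ≤ B) (hv : 0 < v)
    {n M : ℕ} (hM : 0 < M) {ε : ℝ} (hcode : FLFExists W1 W2 n M ε) {s : ℝ} (hs : 1 ≤ s)
    (hvs : v ≤ s) (γ ρ : ℝ) :
    Qfun ((n * (μ 0 + μ 1) - 2 * Real.log M + 2 * γ + ρ) / Real.sqrt (s + n * v)) -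
        4 * (((2 * B) ^ 3 + 3 * v ^ 2) / v) / Real.sqrt s - Qfun (ρ / Real.sqrt s) ≤
      2 * ε + 2 * Real.exp (-γ) := by
  obtain ⟨f, hf, g1, g2, he1, he2⟩ := (flfExists_iff W1 W2 n M ε).1 hcode
  have hM' : (0 : ℝ) < M := by exact_mod_cast hM
  set T := Real.log M - γ with hT
  have hp := fun j => feedbackLaw_nonneg (pairChannel_nonneg h.nonneg1 h.nonneg2) (f j)
  have hj := fun j => (h.le_mass_totalDens hN hB hv (hf j) hs hvs (2 * T - n * (μ 0 + μ 1)) ρ).trans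
    ((mass_mono (hp j) fun z hz => ?_).trans (mass_union_le (hp j)
      {z | wordLLR W1 q (f j z) (Prod.fst ∘ z) ≤ T} {z | wordLLR W2 q (f j z) (Prod.snd ∘ z) ≤ T}))
  · have hsum := Finset.sum_le_sum fun j (_ : j ∈ (univ : Finset (Fin M))) => hj j
    rw [sum_add_distrib, sum_const, card_univ, Fintype.card_fin, nsmul_eq_mul] at hsum
    have h1 := h.sum_mass_wordLLR_le hN hf T g1
    have h2 := h.sum_mass_wordLLR_le_symm hN hf T g2
    have hexp : Real.exp T = M * Real.exp (-γ) := by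
      rw [hT, sub_eq_add_neg, Real.exp_add, Real.exp_log hM']
    rw [one_div, inv_mul_le_iff₀ hM'] at he1 he2
    refine le_of_mul_le_mul_left ?_ hM'
    have e : n * (μ 0 + μ 1) - 2 * Real.log M + 2 * γ + ρ =
      -(2 * T - n * (μ 0 + μ 1)) + ρ := by rw [hT]; ring
    rw [e]
    linarith
  · simp only [Set.mem_ofPred_eq, sum_totalDens] at hz
    by_contra hc
    rw [Set.mem_union, not_or] at hc
    simp only [Set.mem_ofPred_eq, not_le] at hc
    linarith [hc.1, hc.2]

end BalancedPair

/-! ### Antisymmetric channels -/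

section Information

variable {A Y : Type*} [Fintype A] [Fintype Y]

/-- Gibbs' inequality. -/
theorem relEnt_nonneg {p q : Y → ℝ} (hp : ∀ y, 0 ≤ p y) (hq : ∀ y, 0 ≤ q y)
    (hpq : ∀ y, 0 < p y → 0 < q y) (h : ∑ y, q y ≤ ∑ y, p y) : 0 ≤ relEnt p q := by
  have hterm : ∀ y, p y - q y ≤ p y * Real.log (p y / q y) := by
    intro y
    rcases (hp y).eq_or_lt with h0 | h0
    · simpa [← h0] using hq y
    · have hq0 := hpq y h0
      have hl := Real.one_sub_inv_le_log_of_pos (div_pos h0 hq0)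
      have := mul_le_mul_of_nonneg_left hl h0.le
      rwa [inv_div, mul_sub, mul_one, mul_div_cancel₀ _ h0.ne'] at this
  have := sum_le_sum fun y (_ : y ∈ univ) => hterm y
  rw [sum_sub_distrib] at this
  exact le_trans (by linarith) this

/-- Mutual information is at most the average relative entropy to any output law. -/
theorem mutInfo_le_sum_relEnt {P : A → ℝ} {W : A → Y → ℝ} {q : Y → ℝ} (hP : IsDist P)
    (hW : ∀ x y, 0 ≤ W x y) (hW1 : ∀ x, ∑ y, W x y = 1) (hq : ∀ y, 0 ≤ q y)
    (hWq : ∀ x y, 0 < W x y → 0 < q y) (hq1 : ∑ y, q y = 1) :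
    mutInfo P W ≤ ∑ x, P x * relEnt (W x) q := by
  have hnn : ∀ x y, 0 ≤ P x * W x y := fun x y => mul_nonneg (hP.1 x) (hW x y)
  have hO : ∀ x y, 0 < P x * W x y → 0 < outDist P W y := fun x y h =>
    h.trans_le (single_le_sum (f := fun x => P x * W x y) (fun x _ => hnn x y) (mem_univ x))
  have hO1 : ∑ y, outDist P W y = 1 := by
    unfold outDist
    rw [sum_comm]
    simp only [← mul_sum, hW1, mul_one, hP.2]
  have hOq : ∀ y, 0 < outDist P W y → 0 < q y := fun y hy => by
    obtain ⟨x, -, hx⟩ := exists_lt_of_sum_lt (s := univ) (f := fun _ : A => (0 : ℝ))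
      (g := fun x => P x * W x y) (by simpa [outDist] using hy)
    exact hWq x y (pos_of_mul_pos_right hx (hP.1 x))
  have hkey : ∑ x, P x * relEnt (W x) q - mutInfo P W = relEnt (outDist P W) q := by
    unfold relEnt mutInfo
    simp only [mul_sum]
    rw [← sum_sub_distrib, sum_congr rfl fun x _ => (sum_sub_distrib _ _).symm, sum_comm]
    refine sum_congr rfl fun y _ => ?_
    conv_rhs => rw [outDist, sum_mul]
    refine sum_congr rfl fun x _ => ?_
    rcases (hnn x y).eq_or_lt with h0 | h0
    · rw [← mul_assoc, ← h0]; simp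
    · have hw := pos_of_mul_pos_right h0 (hP.1 x)
      have ho := hO x y h0
      change _ = P x * W x y * Real.log (outDist P W y / q y)
      rw [Real.log_div hw.ne' (hWq x y hw).ne', Real.log_div hw.ne' ho.ne',
        Real.log_div ho.ne' (hWq x y hw).ne']
      ring
  have := relEnt_nonneg (p := outDist P W) (fun y => sum_nonneg fun x _ => hnn x y) hq hOq
    (hq1.trans hO1.symm).le
  linarith

end Information

section Antisymmetric

variable {Y : Type*} {N : ℕ}

/-- Sums over a block do not depend on the row of a weakly symmetric matrix. -/
theorem WeaklySymmetricOn.sum_comp_eq {S : Finset Y} {M : Fin N → Y → ℝ}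
    (h : WeaklySymmetricOn S N M) (F : ℝ → ℝ) (u u' : Fin N) :
    ∑ y ∈ S, F (M u y) = ∑ y ∈ S, F (M u' y) := by
  obtain ⟨σ, hσ, hM⟩ := h.2.2.2.1 u u'
  have hS : S.map σ.toEmbedding = S := by
    refine eq_of_subset_of_card_le (fun y hy => ?_) (card_map _).ge
    obtain ⟨z, hz, rfl⟩ := mem_map.1 hy
    exact hσ z hz
  conv_rhs => rw [← hS, sum_map]
  exact sum_congr rfl fun y hy => by rw [Equiv.coe_toEmbedding, hM y hy]

variable [Fintype Y]

theorem sum_unifDist (hN : 0 < N) : ∑ x, unifDist N x = 1 := by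
  have : (N : ℝ) ≠ 0 := by exact_mod_cast hN.ne'
  simp only [unifDist, sum_const, card_univ, Fintype.card_prod, Fintype.card_fin, nsmul_eq_mul]
  push_cast
  field_simp

theorem isDist_unifDist (hN : 0 < N) : IsDist (unifDist N) :=
  ⟨fun _ => by unfold unifDist; positivity, sum_unifDist hN⟩

theorem sum_unifDist_mul (hN : 0 < N) (g : Fin 2 → ℝ) :
    ∑ x, unifDist N x * g x.1 = (g 0 + g 1) / 2 := by
  have : (N : ℝ) ≠ 0 := by exact_mod_cast hN.ne'
  rw [Fintype.sum_prod_type]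
  simp only [unifDist, sum_const, card_univ, Fintype.card_fin, nsmul_eq_mul, Fin.sum_univ_two]
  field_simp

/-- Two channels exchanged by swapping the two halves of the input alphabet, all rows of one half
being equivalent relative to the common output law. -/
theorem exists_balancedPair {W1 W2 : Fin 2 × Fin N → Y → ℝ} {q : Y → ℝ} (hN : 0 < N)
    (h2 : ∀ x, W2 x = W1 (1 - x.1, x.2)) (hnn : ∀ x y, 0 ≤ W1 x y) (hsum : ∀ x, ∑ y, W1 x y = 1)
    (hq : ∀ y, ∑ x, W1 x y = (2 * N : ℝ) * q y)
    (hinv : ∀ (F : ℝ → ℝ → ℝ) (k : Fin 2) (u u' : Fin N),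
      ∑ y, F (W1 (k, u) y) (q y) = ∑ y, F (W1 (k, u') y) (q y)) :
    ∃ μ : Fin 2 → ℝ, ∃ v B : ℝ, BalancedPair W1 W2 q μ v B ∧ 0 < B ∧
      condInfoVar (unifDist N) W1 = v / 2 := by
  set u0 : Fin N := ⟨0, hN⟩
  have hN' : (N : ℝ) ≠ 0 := by exact_mod_cast hN.ne'
  set μ : Fin 2 → ℝ := fun k => ∑ y, W1 (k, u0) y * Real.log (W1 (k, u0) y / q y)
  set V : Fin 2 → ℝ := fun k => ∑ y, W1 (k, u0) y * (Real.log (W1 (k, u0) y / q y) - μ k) ^ 2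
  have hμ : ∀ x, ∑ y, W1 x y * Real.log (W1 x y / q y) = μ x.1 := fun x =>
    hinv (fun a b => a * Real.log (a / b)) x.1 x.2 u0
  have hV : ∀ x, ∑ y, W1 x y * (Real.log (W1 x y / q y) - μ x.1) ^ 2 = V x.1 := fun x =>
    hinv (fun a b => a * (Real.log (a / b) - μ x.1) ^ 2) x.1 x.2 u0
  set B := 1 + ∑ x, ∑ y, |Real.log (W1 x y / q y) - μ x.1|
  have hB : ∀ x y, |Real.log (W1 x y / q y) - μ x.1| ≤ B := fun x y => by
    have i1 := single_le_sum (f := fun y => |Real.log (W1 x y / q y) - μ x.1|)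
      (fun y _ => abs_nonneg _) (mem_univ y)
    have i2 := single_le_sum (f := fun x => ∑ y, |Real.log (W1 x y / q y) - μ x.1|)
      (fun x _ => sum_nonneg fun y _ => abs_nonneg _) (mem_univ x)
    linarith
  have hq2 : ∀ y, ∑ x, W2 x y = (2 * N : ℝ) * q y := fun y => by
    rw [← hq, Fintype.sum_prod_type, Fintype.sum_prod_type]
    simp [h2, add_comm]
  refine ⟨μ, V 0 + V 1, B, ⟨hnn, fun x y => by rw [h2]; exact hnn _ _, hsum,
    fun x => by rw [h2]; exact hsum _, hq, hq2, hμ, fun x => by rw [h2]; exact hμ _,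
    fun x => ?_, hB, fun x y => by rw [h2]; exact hB _ _⟩, ?_, ?_⟩
  · have e1 : μ 0 + μ 1 = μ x.1 + μ (1 - x.1) := by
      have : x.1 = 0 ∨ x.1 = 1 := by omega
      rcases this with h0 | h0 <;> simp [h0]; ring
    have e2 : V 0 + V 1 = V x.1 + V (1 - x.1) := by
      have : x.1 = 0 ∨ x.1 = 1 := by omega
      rcases this with h0 | h0 <;> simp [h0]; ring
    set x' : Fin 2 × Fin N := (1 - x.1, x.2)
    have hc : ∑ y, W1 x y * (Real.log (W1 x y / q y) - μ x.1) = 0 := by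
      simp only [mul_sub, sum_sub_distrib, hμ, ← sum_mul, hsum, one_mul, sub_self]
    rw [e1, e2, ← hV x, show V (1 - x.1) = V x'.1 from rfl, ← hV x']
    set α := fun y => Real.log (W1 x y / q y) - μ x.1
    set β := fun y => Real.log (W1 x' y / q y) - μ x'.1
    have e3 : ∀ a : Y × Y, pairChannel W1 W2 x a * (Real.log (W1 x a.1 / q a.1) +
        Real.log (W2 x a.2 / q a.2) - (μ x.1 + μ (1 - x.1))) ^ 2 =
        W1 x a.1 * α a.1 ^ 2 * W1 x' a.2 + W1 x a.1 * (W1 x' a.2 * β a.2 ^ 2) +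
          2 * (W1 x a.1 * α a.1) * (W1 x' a.2 * β a.2) := fun a => by
      simp only [pairChannel, h2, α, β, x']
      ring
    simp only [e3, Fintype.sum_prod_type, sum_add_distrib, ← mul_sum, ← sum_mul, hsum, mul_one,
      one_mul]
    rw [hc, mul_zero, zero_mul, add_zero]
  · have : 0 ≤ ∑ x, ∑ y, |Real.log (W1 x y / q y) - μ x.1| :=
      sum_nonneg fun x _ => sum_nonneg fun y _ => abs_nonneg _
    linarith
  · have hout : outDist (unifDist N) W1 = q := funext fun y => by
      simp only [outDist, unifDist, ← mul_sum, hq]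
      field_simp
    rw [← sum_unifDist_mul hN]
    refine sum_congr rfl fun x _ => ?_
    simp only [symbVar, infoDens, hout, hμ, hV]

namespace BalancedPair

variable {W1 W2 : Fin 2 × Fin N → Y → ℝ} {q : Y → ℝ} {μ : Fin 2 → ℝ} {v B : ℝ}

theorem mutInfo_le (h : BalancedPair W1 W2 q μ v B) (hN : 0 < N) {P : Fin 2 × Fin N → ℝ}
    (hP : IsDist P) : mutInfo P W1 ≤ ∑ x, P x * μ x.1 :=
  (mutInfo_le_sum_relEnt hP h.nonneg1 h.sum1 (h.q_nonneg hN) h.q_pos (h.sum_q hN)).trans_eq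
    (sum_congr rfl fun x _ => by rw [relEnt, h.mean1])

theorem mutInfo_unifDist (h : BalancedPair W1 W2 q μ v B) (hN : 0 < N) :
    mutInfo (unifDist N) W1 = (μ 0 + μ 1) / 2 := by
  have hN' : (N : ℝ) ≠ 0 := by exact_mod_cast hN.ne'
  have hout : outDist (unifDist N) W1 = q := funext fun y => by
    simp only [outDist, unifDist, ← mul_sum, h.avg1]
    field_simp
  rw [← sum_unifDist_mul hN]
  refine sum_congr rfl fun x _ => ?_
  simp only [hout, mul_assoc, ← mul_sum, h.mean1]

theorem mean_nonneg (h : BalancedPair W1 W2 q μ v B) (hN : 0 < N) (k : Fin 2) : 0 ≤ μ k := by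
  rw [← h.mean1 (k, ⟨0, hN⟩)]
  exact relEnt_nonneg (h.nonneg1 _) (h.q_nonneg hN) (h.q_pos _) (by rw [h.sum1, h.sum_q hN])

/-- The uniform distribution is the unique capacity-achieving one, and the two means differ. -/
theorem eq_unifDist (h : BalancedPair W1 W2 q μ v B) (hN : 0 < N) {Pstar : Fin 2 × Fin N → ℝ}
    {C C1 : ℝ} (hPstar : IsDist Pstar)
    (hCach : min (mutInfo Pstar W1) (mutInfo Pstar W2) = C)
    (hCmax : ∀ P, IsDist P → min (mutInfo P W1) (mutInfo P W2) ≤ C)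
    (hUniq : ∀ P, IsDist P → min (mutInfo P W1) (mutInfo P W2) = C → P = Pstar)
    (hC1 : IsLUB {s | ∃ P, IsDist P ∧ s = mutInfo P W1} C1) (hC1gt : C < C1) :
    Pstar = unifDist N ∧ C = (μ 0 + μ 1) / 2 ∧ μ 0 ≠ μ 1 := by
  have hu1 := h.mutInfo_unifDist hN
  have hu2 := h.symm.mutInfo_unifDist hN
  have hmin : min (mutInfo (unifDist N) W1) (mutInfo (unifDist N) W2) = (μ 0 + μ 1) / 2 := by
    rw [hu1, hu2]
    simp [add_comm]
  have hle := hCmax _ (isDist_unifDist hN)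
  rw [hmin] at hle
  have hI1 := h.mutInfo_le hN hPstar
  have hI2 := h.symm.mutInfo_le hN hPstar
  have hs : ∑ x, Pstar x * μ x.1 + ∑ x, Pstar x * μ (1 - x.1) = μ 0 + μ 1 := by
    rw [← sum_add_distrib, ← one_mul (μ 0 + μ 1), ← hPstar.2, sum_mul]
    refine sum_congr rfl fun x _ => ?_
    have : x.1 = 0 ∨ x.1 = 1 := by omega
    rcases this with h0 | h0 <;> simp [h0] <;> ring
  have hge : C ≤ (μ 0 + μ 1) / 2 := by
    have m1 := min_le_left (mutInfo Pstar W1) (mutInfo Pstar W2)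
    have m2 := min_le_right (mutInfo Pstar W1) (mutInfo Pstar W2)
    rw [hCach] at m1 m2
    linarith
  have hC := le_antisymm hge hle
  refine ⟨(hUniq _ (isDist_unifDist hN) (hmin.trans hC.symm)).symm, hC, fun heq => ?_⟩
  refine hC1gt.not_ge (hC1.2 ?_)
  rintro _ ⟨P, hP, rfl⟩
  refine (h.mutInfo_le hN hP).trans_eq ?_
  have : ∀ x : Fin 2 × Fin N, μ x.1 = C := fun x => by
    have : x.1 = 0 ∨ x.1 = 1 := by omega
    rcases this with h0 | h0 <;> rw [h0] <;> linarith
  simp only [this, ← sum_mul, hP.2, one_mul]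

end BalancedPair

/-- An antisymmetric pair of channels is balanced. -/
theorem exists_balancedPair_of_weaklySymmetric {r : ℕ} (hN : 0 < N)
    {W1 W2 : Fin 2 × Fin N → Y → ℝ} {part : Y → Fin r} {p : Fin 2 → Fin r → ℝ}
    {Wb : Fin 2 → Fin r → Fin N → Y → ℝ} (hp : ∀ k j, 0 ≤ p k j) (hpsum : ∀ k, ∑ j, p k j = 1)
    (hWb : ∀ k j, WeaklySymmetricOn (univ.filter fun y => part y = j) N (Wb k j))
    (hW1a : ∀ u y, W1 (0, u) y = p 0 (part y) * Wb 0 (part y) u y)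
    (hW1b : ∀ u y, W1 (1, u) y = p 1 (part y) * Wb 1 (part y) u y)
    (hW2a : ∀ u y, W2 (0, u) y = p 1 (part y) * Wb 1 (part y) u y)
    (hW2b : ∀ u y, W2 (1, u) y = p 0 (part y) * Wb 0 (part y) u y) :
    ∃ (q : Y → ℝ) (μ : Fin 2 → ℝ) (v B : ℝ), BalancedPair W1 W2 q μ v B ∧ 0 < B ∧
      condInfoVar (unifDist N) W1 = v / 2 := by
  have hN' : (N : ℝ) ≠ 0 := by exact_mod_cast hN.ne'
  have h1 : ∀ k u y, W1 (k, u) y = p k (part y) * Wb k (part y) u y := fun k u y => by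
    have : k = 0 ∨ k = 1 := by omega
    rcases this with rfl | rfl
    exacts [hW1a u y, hW1b u y]
  have h2 : ∀ x, W2 x = W1 (1 - x.1, x.2) := fun x => funext fun y => by
    obtain ⟨k, u⟩ := x
    have : k = 0 ∨ k = 1 := by omega
    rcases this with rfl | rfl
    exacts [(hW2a u y).trans (hW1b u y).symm, (hW2b u y).trans (hW1a u y).symm]
  set q : Y → ℝ := fun y => (∑ x, W1 x y) / (2 * N) with hq
  have hqc : ∀ y y', part y = part y' → q y = q y' := fun y y' he => by
    have hcol : ∀ k, ∑ u, W1 (k, u) y = ∑ u, W1 (k, u) y' := fun k => by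
      simp only [h1, ← mul_sum, he]
      rw [(hWb k (part y')).2.2.2.2 y (by simp [he]) y' (by simp)]
    simp only [hq, Fintype.sum_prod_type, hcol]
  have hsum : ∀ x, ∑ y, W1 x y = 1 := fun x => by
    rw [← Prod.mk.eta (p := x), ← hpsum x.1, ← sum_fiberwise univ part]
    refine sum_congr rfl fun j _ => ?_
    rw [← mul_one (p x.1 j), ← (hWb x.1 j).2.2.1 x.2, mul_sum]
    refine sum_congr rfl fun y hy => ?_
    rw [h1, (mem_filter.1 hy).2]
  have hinv : ∀ (F : ℝ → ℝ → ℝ) (k : Fin 2) (u u' : Fin N),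
      ∑ y, F (W1 (k, u) y) (q y) = ∑ y, F (W1 (k, u') y) (q y) := fun F k u u' => by
    rw [← sum_fiberwise univ part, ← sum_fiberwise univ part fun y => F (W1 (k, u') y) (q y)]
    refine sum_congr rfl fun j _ => ?_
    rcases (univ.filter fun y => part y = j).eq_empty_or_nonempty with he | ⟨y0, hy0⟩
    · simp [he]
    · have key : ∀ w : Fin N, ∑ y with part y = j, F (W1 (k, w) y) (q y) =
          ∑ y with part y = j, F (p k j * Wb k j w y) (q y0) := fun w =>
        sum_congr rfl fun y hy => by
          rw [h1, hqc y y0 ((mem_filter.1 hy).2.trans (mem_filter.1 hy0).2.symm),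
            (mem_filter.1 hy).2]
      rw [key u, key u']
      exact (hWb k j).sum_comp_eq (fun a => F (p k j * a) (q y0)) u u'
  exact ⟨q, exists_balancedPair hN h2
    (fun x y => by rw [← Prod.mk.eta (p := x), h1]; exact mul_nonneg (hp _ _) ((hWb _ _).1 _ _))
    hsum (fun y => by rw [hq]; field_simp) hinv⟩

end Antisymmetric

/-! ### Asymptotics -/

/-- Eventually the logarithm is large and negligible against the cube root. -/
theorem eventually_one_le_log_and_mul_log_le (A : ℝ) :
    ∀ᶠ n : ℕ in Filter.atTop, 1 ≤ Real.log n ∧ A * Real.log n ≤ (n : ℝ) ^ ((1 : ℝ) / 3) := by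
  have h1 : ∀ᶠ n : ℕ in Filter.atTop, 1 ≤ Real.log n :=
    (Real.tendsto_log_atTop.comp tendsto_natCast_atTop_atTop).eventually_ge_atTop 1
  have hpos : (0 : ℝ) < 1 / 3 := by norm_num
  have h2 := ((isLittleO_log_rpow_atTop hpos).comp_tendsto
    (tendsto_natCast_atTop_atTop (R := ℝ))).bound (inv_pos.2 (by positivity : 0 < |A| + 1))
  filter_upwards [h1, h2] with n hn hb
  refine ⟨hn, ?_⟩
  simp only [Function.comp_apply, Real.norm_eq_abs] at hb
  rw [abs_of_nonneg (zero_le_one.trans hn), abs_of_nonneg (Real.rpow_nonneg (Nat.cast_nonneg n) _),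
    ← div_eq_inv_mul,
    le_div_iff₀ (by positivity)] at hb
  nlinarith [le_abs_self A]

theorem rpow_third_pow_three (n : ℕ) : ((n : ℝ) ^ ((1 : ℝ) / 3)) ^ 3 = n := by
  rw [← Real.rpow_natCast, ← Real.rpow_mul (Nat.cast_nonneg _)]
  norm_num

theorem sqrt_add_sq_le {a ℓ : ℝ} (ha : 0 ≤ a) (hℓ : 0 ≤ ℓ) :
    Real.sqrt (ℓ ^ 2 + a) ≤ ℓ + Real.sqrt a := by
  refine Real.sqrt_le_iff.2 ⟨by positivity, ?_⟩
  nlinarith [mul_nonneg hℓ (Real.sqrt_nonneg a), Real.sq_sqrt ha]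

theorem sqrt_le_sq_of_pow_three {n ℓ : ℝ} (h : ℓ ^ 3 = n) (hℓ : 1 ≤ ℓ) : Real.sqrt n ≤ ℓ ^ 2 := by
  refine Real.sqrt_le_iff.2 ⟨by positivity, ?_⟩
  rw [← h]
  nlinarith [pow_pos (by linarith : 0 < ℓ) 3]

theorem sqrt_perturbation {n v b a ℓ : ℝ} (h : ℓ ^ 3 = n) (hℓ : 1 ≤ ℓ) (hv : 0 ≤ v) (ha : 0 ≤ a) :
    |b * Real.sqrt (ℓ ^ 2 + n * v) - b * Real.sqrt (n * v)| ≤ |b| * ℓ ∧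
      a / ℓ * Real.sqrt (ℓ ^ 2 + n * v) ≤ (a + a * Real.sqrt v) * ℓ := by
  have hn : 0 ≤ n := by rw [← h]; positivity
  have s1 : Real.sqrt (ℓ ^ 2 + n * v) ≤ ℓ + Real.sqrt (n * v) :=
    sqrt_add_sq_le (by positivity) (by linarith)
  have s2 : Real.sqrt (n * v) ≤ Real.sqrt (ℓ ^ 2 + n * v) :=
    Real.sqrt_le_sqrt (le_add_of_nonneg_left (sq_nonneg ℓ))
  have s3 : Real.sqrt (n * v) ≤ ℓ ^ 2 * Real.sqrt v := by
    rw [Real.sqrt_mul hn]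
    exact mul_le_mul_of_nonneg_right (sqrt_le_sq_of_pow_three h hℓ) (Real.sqrt_nonneg _)
  constructor
  · rw [← mul_sub, abs_mul, abs_of_nonneg (sub_nonneg.2 s2)]
    exact mul_le_mul_of_nonneg_left (by linarith) (abs_nonneg _)
  · calc _ ≤ a / ℓ * (ℓ + ℓ ^ 2 * Real.sqrt v) :=
          mul_le_mul_of_nonneg_left (by linarith) (by positivity)
      _ = a + a * Real.sqrt v * ℓ := by field_simp
      _ ≤ _ := by nlinarith

namespace BalancedPair

variable {Y : Type*} [Fintype Y] {N : ℕ} {W1 W2 : Fin 2 × Fin N → Y → ℝ} {q : Y → ℝ}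
  {μ : Fin 2 → ℝ} {v B : ℝ}

theorem eventually_log_le (h : BalancedPair W1 W2 q μ v B) (hN : 0 < N) (hB : 0 < B) (hv : 0 < v)
    {ε : ℝ} (hε : ε ∈ Set.Ioo (0 : ℝ) (1 / 2)) :
    ∃ K > 0, ∀ᶠ n : ℕ in Filter.atTop, ∀ M : ℕ, 0 < M → FLFExists W1 W2 n M ε →
      Real.log M ≤ n * ((μ 0 + μ 1) / 2) - Real.sqrt (n * v) / 2 * Qinv (2 * ε) +
        K * ((n : ℝ) ^ ((1 : ℝ) / 3) * Real.log n) := by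
  set b := Qinv (2 * ε)
  have hb : Qfun b = 2 * ε := Qfun_Qinv ⟨by linarith [hε.1], by linarith [hε.2]⟩
  obtain ⟨κ, hκ, hslope⟩ := Qfun_local_slope b
  set c := 4 * (((2 * B) ^ 3 + 3 * v ^ 2) / v)
  have hc : 0 < c := by positivity
  set a := (c + 4) / κ with ha
  have ha0 : 0 < a := by positivity
  refine ⟨2 + |b| + a + a * Real.sqrt v, by positivity, ?_⟩
  filter_upwards [eventually_one_le_log_and_mul_log_le (1 + a + v), Filter.eventually_gt_atTop 0]
    with n hn hn0 M hM hcode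
  set L := Real.log n with hL
  set ℓ := (n : ℝ) ^ ((1 : ℝ) / 3)
  have hℓ3 : ℓ ^ 3 = n := rpow_third_pow_three n
  obtain ⟨hL1, hLℓ⟩ := hn
  have hn' : (0 : ℝ) < n := by exact_mod_cast hn0
  have hbig : 1 + a + v ≤ ℓ := le_trans (by nlinarith) hLℓ
  have hℓ1 : 1 ≤ ℓ := by linarith
  have hℓ0 : 0 < ℓ := by linarith
  have hsq : ℓ ≤ ℓ ^ 2 := by nlinarith
  have hℓn : ℓ ≤ n := by rw [← hℓ3]; nlinarith
  have hexp : Real.exp (-L) ≤ 1 / ℓ := by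
    rw [Real.exp_neg, hL, Real.exp_log hn', ← one_div]
    exact one_div_le_one_div_of_le hℓ0 hℓn
  have hconv := h.converse hN hB.le hv hM hcode (s := ℓ ^ 2) (by linarith) (by linarith) L (ℓ * L)
  rw [Real.sqrt_sq hℓ0.le, mul_div_cancel_left₀ _ hℓ0.ne', ← hb] at hconv
  have hQL := Qfun_le_exp_neg L
  have hsl := (hslope (a / ℓ) (by positivity) ((div_le_one hℓ0).2 (by linarith))).2
  have hκa : κ * (a / ℓ) = (c + 4) / ℓ := by rw [ha]; field_simp
  have hlt : Qfun ((n * (μ 0 + μ 1) - 2 * Real.log M + 2 * L + ℓ * L) /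
      Real.sqrt (ℓ ^ 2 + n * v)) < Qfun (b - a / ℓ) := by
    have e : (c + 4) / ℓ = c / ℓ + 4 * (1 / ℓ) := by ring
    have : 0 < 1 / ℓ := by positivity
    change _ - c / ℓ - _ ≤ _ at hconv
    linarith
  have harg := Qfun_strictAnti.lt_iff_gt.1 hlt
  have hpos : 0 < Real.sqrt (ℓ ^ 2 + n * v) := Real.sqrt_pos.2 (by positivity)
  rw [lt_div_iff₀ hpos] at harg
  obtain ⟨t1, t2⟩ := sqrt_perturbation (b := b) hℓ3 hℓ1 hv.le ha0.le
  set S := Real.sqrt (ℓ ^ 2 + n * v)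
  set σ := Real.sqrt (n * v)
  have hℓL : ℓ ≤ ℓ * L := le_mul_of_one_le_right hℓ0.le hL1
  have t3 : |b| * ℓ ≤ |b| * (ℓ * L) := mul_le_mul_of_nonneg_left hℓL (abs_nonneg _)
  have t4 : (a + a * Real.sqrt v) * ℓ ≤ (a + a * Real.sqrt v) * (ℓ * L) :=
    mul_le_mul_of_nonneg_left hℓL (by positivity)
  have t6 : L ≤ ℓ * L := le_mul_of_one_le_left (by linarith) hℓ1
  have hX : 0 < ℓ * L := by positivity
  have t7 := abs_le.1 t1
  have t9 : 0 ≤ |b| * (ℓ * L) := by positivity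
  have t10 : 0 ≤ (a + a * Real.sqrt v) * (ℓ * L) := by positivity
  have e2 : (2 + |b| + a + a * Real.sqrt v) * (ℓ * L) =
      2 * (ℓ * L) + |b| * (ℓ * L) + (a + a * Real.sqrt v) * (ℓ * L) := by ring
  rw [sub_mul] at harg
  rw [e2]
  linarith [t7.1]

end BalancedPair

section Parameters

theorem steeringTail_le {n n1 m D : ℕ} {B : ℝ} (hB : 0 < B) (hn1 : 0 < n1) (hn : n1 ≤ n)
    (hm : 0 < m) (hD : 2 * D + 1 ≤ n) :
    steeringTail n1 (2 * m) D B (2 * B * Real.sqrt (2 * n * Real.log n))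
      (4 * B * Real.sqrt (m * Real.log n)) ≤ 4 / n := by
  have hn0 : (0 : ℝ) < n := by exact_mod_cast hn1.trans_le hn
  have hn1' : (0 : ℝ) < n1 := by exact_mod_cast hn1
  have hle : (n1 : ℝ) ≤ n := by exact_mod_cast hn
  have hm' : (0 : ℝ) < m := by exact_mod_cast hm
  have hD' : (2 * D + 1 : ℝ) ≤ n := by exact_mod_cast hD
  have hL : 0 ≤ Real.log n := Real.log_natCast_nonneg n
  have hexp : Real.exp (-(2 * Real.log n)) = 1 / (n : ℝ) ^ 2 := by
    rw [Real.exp_neg, two_mul, Real.exp_add, Real.exp_log hn0, one_div, sq]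
  have e1 : 2 * Real.log n ≤
      (2 * B * Real.sqrt (2 * n * Real.log n)) ^ 2 / (4 * n1 * B ^ 2) := by
    rw [mul_pow, Real.sq_sqrt (by positivity), le_div_iff₀ (by positivity)]
    have : 0 ≤ B ^ 2 * Real.log n * (n - n1) :=
      mul_nonneg (by positivity) (sub_nonneg.2 hle)
    nlinarith
  have e2 : 2 * Real.log n ≤
      (4 * B * Real.sqrt (m * Real.log n)) ^ 2 / (4 * (2 * m : ℕ) * B ^ 2) := by
    rw [mul_pow, Real.sq_sqrt (by positivity), le_div_iff₀ (by positivity)]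
    push_cast
    linarith
  have f1 := (Real.exp_le_exp.2 (neg_le_neg e1)).trans_eq hexp
  have f2 := (Real.exp_le_exp.2 (neg_le_neg e2)).trans_eq hexp
  calc _ ≤ (n : ℝ) * (2 * (1 / (n : ℝ) ^ 2) + 2 * (1 / (n : ℝ) ^ 2)) :=
        mul_le_mul hD' (by linarith) (by positivity) hn0.le
    _ = _ := by field_simp; norm_num

theorem collision_term_le {n n1 m D M : ℕ} {τ c ℓ : ℝ} (hn4 : 4 ≤ n) (hn1 : n1 + 1 ≤ n)
    (hm : 2 * m ≤ n) (hD : 2 * D + 1 ≤ n) (hDm : 4 * (D : ℝ) ^ 2 / m ≤ c * (ℓ * Real.log n))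
    (hℓ : 1 ≤ ℓ) (hM : (M : ℝ) ≤ Real.exp (τ - (c + 6) * (ℓ * Real.log n))) :
    (2 * D + 1) * (2 * ((M + M : ℕ) * ((2 * D + 1) * Real.exp (-τ))) * compositionLoss n1 m D) ≤
      1 / n := by
  have hn0 : (0 : ℝ) < n := by exact_mod_cast (by omega : 0 < n)
  have hn4' : (4 : ℝ) ≤ n := by exact_mod_cast hn4
  have hn1' : (n1 + 1 : ℝ) ≤ n := by exact_mod_cast hn1
  have hm' : (2 * m : ℝ) ≤ n := by exact_mod_cast hm
  have hD' : (2 * D + 1 : ℝ) ≤ n := by exact_mod_cast hD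
  have hL : 0 ≤ Real.log n := Real.log_natCast_nonneg n
  have hloss : compositionLoss n1 m D ≤ n * n * Real.exp (c * (ℓ * Real.log n)) := by
    unfold compositionLoss
    gcongr
  have hloss0 : 0 ≤ compositionLoss n1 m D := by unfold compositionLoss; positivity
  have hexp : Real.exp (-(6 * Real.log n)) = 1 / (n : ℝ) ^ 6 := by
    rw [Real.exp_neg, show 6 * Real.log n = (6 : ℕ) * Real.log n by norm_num, Real.exp_nat_mul,
      Real.exp_log hn0, one_div]
  calc _ = 4 * (2 * D + 1) ^ 2 * (M * Real.exp (-τ)) * compositionLoss n1 m D := by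
        push_cast; ring
    _ ≤ n * n ^ 2 * (Real.exp (τ - (c + 6) * (ℓ * Real.log n)) * Real.exp (-τ)) *
        (n * n * Real.exp (c * (ℓ * Real.log n))) := by gcongr
    _ = (n : ℝ) ^ 5 * Real.exp (-(6 * (ℓ * Real.log n))) := by
        rw [show -(6 * (ℓ * Real.log n)) =
          τ - (c + 6) * (ℓ * Real.log n) + -τ + c * (ℓ * Real.log n) by ring, Real.exp_add,
          Real.exp_add]
        ring
    _ ≤ (n : ℝ) ^ 5 * Real.exp (-(6 * Real.log n)) := by
        gcongr
        exact le_mul_of_one_le_left hL hℓ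
    _ = 1 / n := by rw [hexp]; field_simp

/-- The sizes of the two phases and of the steering range. -/
theorem steering_sizes {n : ℕ} {ℓ L d : ℝ} (hℓ3 : ℓ ^ 3 = n) (hL : 1 ≤ L) (hd : 0 ≤ d)
    (hbig : 32 * (d + 1) ^ 2 * L ≤ ℓ) :
    ℓ ^ 2 ≤ (⌈ℓ ^ 2⌉₊ : ℕ) ∧ ((⌈ℓ ^ 2⌉₊ : ℕ) : ℝ) ≤ 2 * ℓ ^ 2 ∧ 8 * ⌈ℓ ^ 2⌉₊ ≤ n ∧
      4 * ⌈d * Real.sqrt (n * L)⌉₊ ≤ ⌈ℓ ^ 2⌉₊ ∧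
      4 * ((⌈d * Real.sqrt (n * L)⌉₊ : ℕ) : ℝ) ^ 2 / (⌈ℓ ^ 2⌉₊ : ℕ) ≤ 4 * (d + 1) ^ 2 * (ℓ * L) ∧
      ℓ * L ≤ Real.sqrt (n * L) := by
  have hd1 : 1 ≤ (d + 1) ^ 2 := by nlinarith
  have hℓL : 32 * L ≤ ℓ := by nlinarith
  have hℓ : 32 ≤ ℓ := by linarith
  have hn : (0 : ℝ) < n := by rw [← hℓ3]; positivity
  have hc := Nat.ceil_lt_add_one (sq_nonneg ℓ)
  have hm1 : ((⌈ℓ ^ 2⌉₊ : ℕ) : ℝ) ≤ 2 * ℓ ^ 2 := by nlinarith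
  have hm0 := Nat.le_ceil (ℓ ^ 2)
  have hsn : 0 ≤ (n : ℝ) * L := by positivity
  have hs1 : ℓ * L ≤ Real.sqrt (n * L) := by
    refine Real.le_sqrt_of_sq_le ?_
    rw [← hℓ3]
    have : 0 ≤ ℓ ^ 2 * L * (ℓ - L) := mul_nonneg (by positivity) (by linarith)
    nlinarith
  have hs2 : 1 ≤ Real.sqrt (n * L) := le_trans (by nlinarith) hs1
  have hD : ((⌈d * Real.sqrt (n * L)⌉₊ : ℕ) : ℝ) ≤ (d + 1) * Real.sqrt (n * L) := by
    have := (Nat.ceil_lt_add_one (by positivity : 0 ≤ d * Real.sqrt (n * L))).le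
    linarith
  have hs3 : 4 * ((d + 1) * Real.sqrt (n * L)) ≤ ℓ ^ 2 := by
    rw [← mul_assoc]
    refine abs_le_of_sq_le_sq' ?_ (by positivity) |>.2
    rw [mul_pow, Real.sq_sqrt hsn, ← hℓ3]
    have : 0 ≤ ℓ ^ 3 * (ℓ - 32 * (d + 1) ^ 2 * L) := mul_nonneg (by positivity) (by linarith)
    have h' : 0 ≤ ℓ ^ 3 * ((d + 1) ^ 2 * L) := by positivity
    nlinarith
  refine ⟨hm0, hm1, ?_, ?_, ?_, hs1⟩
  · have : 8 * ((⌈ℓ ^ 2⌉₊ : ℕ) : ℝ) ≤ n := by rw [← hℓ3]; nlinarith [sq_nonneg ℓ]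
    exact_mod_cast this
  · have : 4 * ((⌈d * Real.sqrt (n * L)⌉₊ : ℕ) : ℝ) ≤ (⌈ℓ ^ 2⌉₊ : ℕ) := by linarith
    exact_mod_cast this
  · rw [div_le_iff₀ (lt_of_lt_of_le (by positivity) hm0)]
    have h1 : ((⌈d * Real.sqrt (n * L)⌉₊ : ℕ) : ℝ) ^ 2 ≤ (d + 1) ^ 2 * (ℓ ^ 3 * L) := by
      refine (pow_le_pow_left₀ (Nat.cast_nonneg _) hD 2).trans_eq ?_
      rw [mul_pow, Real.sq_sqrt hsn, hℓ3]
    have h2 : 0 ≤ 4 * (d + 1) ^ 2 * (ℓ * L) * ((⌈ℓ ^ 2⌉₊ : ℕ) - ℓ ^ 2) :=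
      mul_nonneg (by positivity) (by linarith)
    nlinarith

/-- The sizes of the deviations allowed in the two phases. -/
theorem steering_radii {n n1 m : ℕ} {ℓ L B : ℝ} (hB : 0 < B) (hℓ3 : ℓ ^ 3 = n) (hL : 1 ≤ L)
    (hℓ : 32 * L ≤ ℓ) (hm1 : ℓ ^ 2 ≤ m) (hm2 : (m : ℝ) ≤ 2 * ℓ ^ 2) (hmn : 8 * m ≤ n)
    (hn1 : n1 + 2 * m = n) :
    4 * B * Real.sqrt (m * L) ≤ 6 * B * (ℓ * L) ∧
      2 * B * Real.sqrt (2 * n * L) ≤ 3 * B * Real.sqrt (n * L) ∧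
      4 * B * Real.sqrt (m * L) ≤ 2 * (2 * m) * B ∧
      2 * B * Real.sqrt (2 * n * L) ≤ 2 * n1 * B := by
  have hL0 : 0 < L := by linarith
  have hℓ0 : 0 < ℓ := by linarith
  have hn : (0 : ℝ) < n := by rw [← hℓ3]; positivity
  have h8 : (8 * m : ℝ) ≤ n := by exact_mod_cast hmn
  have hn1' : (n1 + 2 * m : ℝ) = n := by exact_mod_cast hn1
  have hLm : L ≤ m := by nlinarith
  have e1 : Real.sqrt (m * L) ≤ 3 / 2 * (ℓ * L) := by
    refine Real.sqrt_le_iff.2 ⟨by positivity, ?_⟩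
    calc m * L ≤ 2 * ℓ ^ 2 * L := mul_le_mul_of_nonneg_right hm2 hL0.le
      _ ≤ 2 * ℓ ^ 2 * (L * L) :=
        mul_le_mul_of_nonneg_left (le_mul_of_one_le_right hL0.le hL) (by positivity)
      _ ≤ _ := by nlinarith [mul_pos hℓ0 hL0]
  have e2 : Real.sqrt (2 * n * L) ≤ 3 / 2 * Real.sqrt (n * L) := by
    refine Real.sqrt_le_iff.2 ⟨by positivity, ?_⟩
    rw [mul_pow, Real.sq_sqrt (by positivity)]
    nlinarith [mul_pos hn hL0]
  have e3 : Real.sqrt (m * L) ≤ m :=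
    Real.sqrt_le_iff.2 ⟨Nat.cast_nonneg _, by nlinarith [(Nat.cast_nonneg m : (0 : ℝ) ≤ m)]⟩
  have e4 : Real.sqrt (2 * n * L) ≤ n1 := by
    refine Real.sqrt_le_iff.2 ⟨Nat.cast_nonneg _, ?_⟩
    have e1 : 3 / 4 * (n : ℝ) ≤ n1 := by linarith
    have e2 : 8 * L ≤ n := by linarith
    nlinarith
  refine ⟨?_, ?_, ?_, ?_⟩
  · linarith [mul_le_mul_of_nonneg_left e1 (by positivity : 0 ≤ 4 * B)]
  · linarith [mul_le_mul_of_nonneg_left e2 (by positivity : 0 ≤ 2 * B)]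
  · linarith [mul_le_mul_of_nonneg_left e3 (by positivity : 0 ≤ 4 * B)]
  · linarith [mul_le_mul_of_nonneg_left e4 (by positivity : 0 ≤ 2 * B)]

/-- The steering range covers all relevant deviations of the information densities. -/
theorem steering_range {B b c d w r R S Δ σ x τ : ℝ} {D : ℕ} (hB : 0 < B) (hc : 0 < c)
    (hΔ : 0 < Δ) (hd : d = 2 + (w / 2 + c + 9 * B) / Δ) (hdD : d * S ≤ D) (hx : 1 ≤ x)
    (hxS : x ≤ S) (hσ : |σ * b| ≤ w * S) (hr0 : 0 ≤ r) (hr : r ≤ 6 * B * x) (hR : R ≤ 3 * B * S)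
    {t : ℝ} (hτ : τ = t - σ / 2 * b - c * x) :
    |τ + r - t| + R + Δ ≤ (D - 1) * Δ := by
  have hx0 : 0 < x := by linarith
  have e2 : |τ + r - t| ≤ w * S / 2 + (6 * B + c) * S := by
    have f1 : (6 * B + c) * x ≤ (6 * B + c) * S := mul_le_mul_of_nonneg_left hxS (by positivity)
    have f2 := abs_le.1 hσ
    have f3 : 0 ≤ c * x := by positivity
    have f4 : 0 ≤ 6 * B * x := by positivity
    rw [hτ]
    exact abs_le.2 ⟨by linarith [f2.2], by linarith [f2.1]⟩
  have e3 : d * S * Δ ≤ D * Δ := mul_le_mul_of_nonneg_right hdD hΔ.le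
  have e4 : d * S * Δ = 2 * (S * Δ) + (w * S / 2 + (6 * B + c) * S + 3 * B * S) := by
    rw [hd]; field_simp; ring
  have e5 : Δ ≤ S * Δ := le_mul_of_one_le_left hΔ.le (hx.trans hxS)
  rw [sub_mul, one_mul]
  linarith

theorem lowerTailBound_le {n : ℕ} {v B b κ a ℓ t : ℝ} (hv : 0 ≤ v)
    (hslope : ∀ h, 0 ≤ h → h ≤ 1 → Qfun (b + h) ≤ Qfun b - κ * h)
    (hκ : κ * a = 4 * (((2 * B) ^ 3 + 3 * v ^ 2) / v) + 11) (ha : 0 ≤ a) (haℓ : a ≤ ℓ)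
    (hℓ3 : ℓ ^ 3 = n) (hℓ : 1 ≤ ℓ)
    (ht : b * Real.sqrt (n * v) + (|b| + a + a * Real.sqrt v) * ℓ ≤ -t - ℓ * Real.log n) :
    lowerTailBound n v B (ℓ ^ 2) (ℓ * Real.log n) t ≤ Qfun b - 10 / ℓ := by
  have hℓ0 : 0 < ℓ := by linarith
  have hn : (0 : ℝ) < n := by rw [← hℓ3]; positivity
  have hℓn : ℓ ≤ n := by rw [← hℓ3]; nlinarith [sq_nonneg (ℓ - 1)]
  have hexp : Real.exp (-Real.log n) ≤ 1 / ℓ := by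
    rw [Real.exp_neg, Real.exp_log hn, ← one_div]
    exact one_div_le_one_div_of_le hℓ0 hℓn
  have hQL := (Qfun_le_exp_neg (Real.log n)).trans hexp
  obtain ⟨t1, t2⟩ := sqrt_perturbation (b := b) hℓ3 hℓ hv ha
  have harg : b + a / ℓ ≤ (-t - ℓ * Real.log n) / Real.sqrt (ℓ ^ 2 + n * v) := by
    rw [le_div_iff₀ (Real.sqrt_pos.2 (by positivity)), add_mul]
    refine le_trans ?_ ht
    have := (abs_le.1 t1).2
    linarith
  have h1 := (Qfun_strictAnti.antitone harg).trans
    (hslope _ (by positivity) ((div_le_one hℓ0).2 haℓ))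
  rw [← mul_div_assoc, hκ] at h1
  unfold lowerTailBound
  rw [Real.sqrt_sq hℓ0.le, mul_div_cancel_left₀ _ hℓ0.ne']
  have e : (4 * (((2 * B) ^ 3 + 3 * v ^ 2) / v) + 11) / ℓ =
    4 * (((2 * B) ^ 3 + 3 * v ^ 2) / v) / ℓ + 10 / ℓ + 1 / ℓ := by ring
  rw [e] at h1
  linarith

theorem le_of_linear_dominates {n ℓ L C w b σ c κ : ℝ} (hℓ3 : ℓ ^ 3 = n) (hC : 0 < C) (hℓ : 0 ≤ ℓ)
    (hL : L ≤ ℓ) (hc : 0 ≤ c + κ) (hσ : |σ * b| ≤ w * ℓ ^ 2) (hG : (w / 2 + c + κ) / C ≤ ℓ) :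
    0 ≤ n * C - σ / 2 * b - c * (ℓ * L) - κ * (ℓ * L) := by
  rw [div_le_iff₀ hC] at hG
  have e1 : n * C = ℓ * C * ℓ ^ 2 := by rw [← hℓ3]; ring
  have e3 : (w / 2 + c + κ) * ℓ ^ 2 ≤ ℓ * C * ℓ ^ 2 := by gcongr
  have e4 : (c + κ) * (ℓ * L) ≤ (c + κ) * ℓ ^ 2 := by
    rw [sq]
    gcongr
  have f2 := abs_le.1 hσ
  rw [e1]
  linarith [f2.2]

theorem backoff_le {B Δ b e c x ℓ r τ t σ : ℝ} (hΔ : 0 < Δ) (he : 0 ≤ e)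
    (hc : c = 6 * B + (Δ + 1 + e) / 2) (hx : 1 ≤ x) (hℓ : ℓ ≤ x) (hr : r ≤ 6 * B * x)
    (hτ : τ = t / 2 - σ / 2 * b - c * x) :
    b * σ + e * ℓ ≤ -(2 * τ + 2 * r + Δ - t) - x := by
  have e1 : e * ℓ ≤ e * x := mul_le_mul_of_nonneg_left hℓ he
  have e2 : 2 * c * x = 12 * B * x + Δ * x + x + e * x := by rw [hc]; ring
  have e3 : Δ ≤ Δ * x := le_mul_of_one_le_right hΔ.le hx
  rw [hτ]
  linarith

end Parameters

namespace BalancedPair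

variable {Y : Type*} [Fintype Y] {N : ℕ} {W1 W2 : Fin 2 × Fin N → Y → ℝ} {q : Y → ℝ}
  {μ : Fin 2 → ℝ} {v B : ℝ}

set_option maxHeartbeats 1000000 in
theorem eventually_exists_code (h : BalancedPair W1 W2 q μ v B) (hN : 0 < N) (hμ : μ 0 ≠ μ 1)
    (hpos : 0 < (μ 0 + μ 1) / 2) (hB : 0 < B) (hv : 0 < v) {ε : ℝ}
    (hε : ε ∈ Set.Ioo (0 : ℝ) (1 / 2)) :
    ∃ K > 0, ∀ᶠ n : ℕ in Filter.atTop, ∃ M : ℕ, 0 < M ∧ FLFExists W1 W2 n M ε ∧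
      n * ((μ 0 + μ 1) / 2) - Real.sqrt (n * v) / 2 * Qinv (2 * ε) -
        K * ((n : ℝ) ^ ((1 : ℝ) / 3) * Real.log n) ≤ Real.log M := by
  set b := Qinv (2 * ε)
  have hb : Qfun b = 2 * ε := Qfun_Qinv ⟨by linarith [hε.1], by linarith [hε.2]⟩
  obtain ⟨κ, hκ, hslope⟩ := Qfun_local_slope b
  set a := (4 * (((2 * B) ^ 3 + 3 * v ^ 2) / v) + 11) / κ with ha
  have ha0 : 0 < a := by positivity
  have hκa : κ * a = 4 * (((2 * B) ^ 3 + 3 * v ^ 2) / v) + 11 := by rw [ha]; field_simp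
  set Δ := |μ 0 - μ 1|
  have hΔ : 0 < Δ := abs_pos.2 (sub_ne_zero.2 hμ)
  set C := (μ 0 + μ 1) / 2 with hC
  set w := |b| * Real.sqrt v
  have hw : 0 ≤ w := by positivity
  set c := 6 * B + (Δ + 1 + (|b| + a + a * Real.sqrt v)) / 2 with hc
  have hc0 : 0 < c := by positivity
  set d := 2 + (w / 2 + c + 9 * B) / Δ with hd
  have hd0 : 0 ≤ d := by positivity
  set κ' := 4 * (d + 1) ^ 2 + 6
  set G := (w / 2 + c + κ') / C with hG
  have hG0 : 0 ≤ G := by positivity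
  refine ⟨c + κ', by positivity, ?_⟩
  filter_upwards [eventually_one_le_log_and_mul_log_le (32 * (d + 1) ^ 2 + a + v + G),
    Filter.eventually_gt_atTop 0] with n hn hn0
  have hn' : (0 : ℝ) < n := by exact_mod_cast hn0
  set ℓ := (n : ℝ) ^ ((1 : ℝ) / 3)
  have hℓ3 : ℓ ^ 3 = n := rpow_third_pow_three n
  obtain ⟨hL1, hLℓ⟩ := hn
  have hL0 : 0 < Real.log n := by linarith
  have hd32 : 32 ≤ 32 * (d + 1) ^ 2 := by nlinarith
  have hbig : 32 * (d + 1) ^ 2 * Real.log n ≤ ℓ := le_trans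
    (mul_le_mul_of_nonneg_right (by linarith) hL0.le) hLℓ
  have hLℓ' : 32 * Real.log n ≤ ℓ := le_trans (mul_le_mul_of_nonneg_right hd32 hL0.le) hbig
  have hsum : 32 * (d + 1) ^ 2 + a + v + G ≤ ℓ := le_trans
    (le_mul_of_one_le_right (by positivity) hL1) hLℓ
  have hℓ1 : 1 ≤ ℓ := by linarith
  have hℓ0 : 0 < ℓ := by linarith
  have hsq : ℓ ≤ ℓ ^ 2 := le_self_pow₀ hℓ1 two_ne_zero
  obtain ⟨hm1, hm2, hmn, hDm, hD2, hs1⟩ := steering_sizes hℓ3 hL1 hd0 hbig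
  set m := ⌈ℓ ^ 2⌉₊
  set D := ⌈d * Real.sqrt (n * Real.log n)⌉₊ with hD
  have hdD : d * Real.sqrt (n * Real.log n) ≤ D := Nat.le_ceil _
  have hm0 : 0 < m := Nat.ceil_pos.2 (by positivity)
  obtain ⟨n1, hn1⟩ : ∃ n1, n1 + 2 * m = n := ⟨n - 2 * m, by omega⟩
  have hn1' : (n1 + 2 * m : ℝ) = n := by exact_mod_cast hn1
  set L := Real.log n
  set σ := Real.sqrt (n * v)
  set S := Real.sqrt (n * L)
  have hℓL : ℓ ≤ ℓ * L := le_mul_of_one_le_right hℓ0.le hL1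
  have hone : 1 ≤ ℓ * L := one_le_mul_of_one_le_of_one_le hℓ1 hL1
  have hσ : |σ * b| ≤ w * Real.sqrt n := by
    rw [abs_mul, abs_of_nonneg (Real.sqrt_nonneg _), Real.sqrt_mul hn'.le]
    exact le_of_eq (by ring)
  have hσS : w * Real.sqrt n ≤ w * S :=
    mul_le_mul_of_nonneg_left (Real.sqrt_le_sqrt (le_mul_of_one_le_right hn'.le hL1)) hw
  have hσℓ : w * Real.sqrt n ≤ w * ℓ ^ 2 :=
    mul_le_mul_of_nonneg_left (sqrt_le_sq_of_pow_three hℓ3 hℓ1) hw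
  set τ := n * C - σ / 2 * b - c * (ℓ * L) with hτ
  set r := 4 * B * Real.sqrt (m * L)
  set R := 2 * B * Real.sqrt (2 * n * L)
  have hr0 : 0 ≤ r := by positivity
  have hR0 : 0 ≤ R := by positivity
  obtain ⟨hr, hR, hrm, hRn⟩ := steering_radii hB hℓ3 hL1 hLℓ' hm1 hm2 hmn hn1
  have hadm : SteeringAdmissible μ v B n1 m D τ r R (ℓ ^ 2) := by
    refine ⟨by omega, hm0, hDm, hr0, hrm, hR0, hRn, ?_, by linarith, by linarith⟩
    rw [hn1']
    exact steering_range hB hc0 hΔ hd hdD hone hs1 (hσ.trans hσS) hr0 hr hR hτ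
  have hX0 : 0 ≤ τ - κ' * (ℓ * L) :=
    le_of_linear_dominates hℓ3 hpos hℓ0.le (by linarith) (by positivity) (hσ.trans hσℓ)
      (by linarith)
  set M := ⌊Real.exp (τ - κ' * (ℓ * L))⌋₊ with hM
  have hM1 : (M : ℝ) ≤ Real.exp (τ - κ' * (ℓ * L)) := Nat.floor_le (Real.exp_pos _).le
  have hM0 : 0 < M := Nat.floor_pos.2 (Real.one_le_exp hX0)
  have hM2 : Real.exp (τ - κ' * (ℓ * L)) ≤ (M + M : ℕ) := by
    have h1 := (Nat.lt_floor_add_one (Real.exp (τ - κ' * (ℓ * L)))).le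
    have h2 : (1 : ℝ) ≤ M := by exact_mod_cast hM0
    push_cast
    linarith
  have hcode := h.flfExists hN hμ hB hv hadm (ℓ * L) hM0 (ε := ε) ?_
  · rw [hn1] at hcode
    refine ⟨M + M, by omega, hcode, ?_⟩
    refine le_trans (le_of_eq ?_) ((Real.le_log_iff_exp_le (by positivity)).2 hM2)
    rw [hτ]
    ring
  · rw [hn1]
    have hnℓ : 1 / (n : ℝ) ≤ 1 / ℓ := one_div_le_one_div_of_le hℓ0
      (by rw [← hℓ3]; exact le_self_pow₀ hℓ1 three_ne_zero)
    have h1 := lowerTailBound_le (n := n) (v := v) (B := B)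
      (t := 2 * τ + 2 * r + Δ - n * (μ 0 + μ 1)) hv.le (fun h h0 h1 => (hslope h h0 h1).1) hκa
      ha0.le (by linarith) hℓ3 hℓ1
      (backoff_le hΔ (by positivity) hc hone hℓL hr (by rw [hτ, hC]; ring))
    have h2 := steeringTail_le (n := n) hB (by omega : 0 < n1) (by omega) hm0
      (by omega : 2 * D + 1 ≤ n)
    have h3 := collision_term_le (n := n) (n1 := n1) (m := m) (D := D) (M := M) (τ := τ)
      (by omega) (by omega) (by omega) (by omega) hD2 hℓ1 hM1
    have e : 10 / ℓ = 10 * (1 / ℓ) := by ring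
    have e' : 4 / (n : ℝ) = 4 * (1 / n) := by ring
    rw [hb, e] at h1
    rw [e'] at h2
    change _ / 2 + _ + _ ≤ _
    linarith

end BalancedPair

section MstarF

variable {X Y : Type*} [Fintype Y] {W1 W2 : X → Y → ℝ} {n : ℕ} {ε U : ℝ}

theorem bddAbove_of_log_le
    (hU : ∀ M : ℕ, 0 < M → FLFExists W1 W2 n M ε → Real.log M ≤ U) :
    BddAbove {M | FLFExists W1 W2 n M ε} := by
  refine ⟨⌈Real.exp U⌉₊, fun M hM => ?_⟩
  rcases M.eq_zero_or_pos with rfl | hM0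
  · exact Nat.zero_le _
  · have h := (Real.log_le_iff_le_exp (Nat.cast_pos.2 hM0)).1 (hU M hM0 hM)
    exact_mod_cast h.trans (Nat.le_ceil _)

theorem log_MstarF_mem_Icc {L : ℝ}
    (hU : ∀ M : ℕ, 0 < M → FLFExists W1 W2 n M ε → Real.log M ≤ U)
    (hL : ∃ M : ℕ, 0 < M ∧ FLFExists W1 W2 n M ε ∧ L ≤ Real.log M) :
    Real.log (MstarF W1 W2 n ε) ∈ Set.Icc L U := by
  obtain ⟨M, hM0, hM, hLM⟩ := hL
  have hbdd := bddAbove_of_log_le hU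
  have hle : M ≤ MstarF W1 W2 n ε := le_csSup hbdd hM
  exact ⟨hLM.trans (Real.log_le_log (Nat.cast_pos.2 hM0) (Nat.cast_le.2 hle)),
    hU _ (hM0.trans_le hle) (Nat.sSup_mem ⟨M, hM⟩ hbdd)⟩

end MstarF

/-- **Corollary 1** (half-dispersion for antisymmetric CM-DMBCs): for an
antisymmetric CM-DMBC with `min_k C_k > C` and `ε ∈ (0, 1/2)`, the CAID `P*` is
uniform and `log M*_f(n,ε) = nC − √(n V₁/2) Q⁻¹(2ε) + O(n^{1/3} log n)`. -/
theorem antisymmetric_half_dispersion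
    (N r : ℕ) (hN : 0 < N)
    (W1 W2 : Fin 2 × Fin N → 𝒴 → ℝ)
    (part : 𝒴 → Fin r) (p : Fin 2 → Fin r → ℝ)
    (Wb : Fin 2 → Fin r → Fin N → 𝒴 → ℝ)
    (hp : ∀ k j, 0 ≤ p k j) (hpsum : ∀ k, ∑ j, p k j = 1)
    (hWb : ∀ k j, WeaklySymmetricOn (Finset.univ.filter fun y => part y = j) N (Wb k j))
    (hW1a : ∀ u y, W1 (0, u) y = p 0 (part y) * Wb 0 (part y) u y)
    (hW1b : ∀ u y, W1 (1, u) y = p 1 (part y) * Wb 1 (part y) u y)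
    (hW2a : ∀ u y, W2 (0, u) y = p 1 (part y) * Wb 1 (part y) u y)
    (hW2b : ∀ u y, W2 (1, u) y = p 0 (part y) * Wb 0 (part y) u y)
    (Pstar : Fin 2 × Fin N → ℝ) (C C1 C2 : ℝ)
    (hPstar : IsDist Pstar) (hPpos : ∀ x, 0 < Pstar x)
    (hCach : min (mutInfo Pstar W1) (mutInfo Pstar W2) = C)
    (hCmax : ∀ P, IsDist P → min (mutInfo P W1) (mutInfo P W2) ≤ C)
    (hUniq : ∀ P, IsDist P → min (mutInfo P W1) (mutInfo P W2) = C → P = Pstar)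
    (hC1 : IsLUB {s | ∃ P, IsDist P ∧ s = mutInfo P W1} C1)
    (hC2 : IsLUB {s | ∃ P, IsDist P ∧ s = mutInfo P W2} C2)
    (hC1gt : C < C1) (hC2gt : C < C2)
    (hV1pos : 0 < condInfoVar Pstar W1) (hV2pos : 0 < condInfoVar Pstar W2)
    (ε : ℝ) (hε : ε ∈ Set.Ioo (0 : ℝ) (1 / 2)) :
    (∀ x, Pstar x = 1 / (2 * N)) ∧
    ∃ K > (0 : ℝ), ∃ n₀ : ℕ, ∀ n ≥ n₀,
      |Real.log (MstarF W1 W2 n ε) -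
          ((n : ℝ) * C -
            Real.sqrt ((n : ℝ) * condInfoVar Pstar W1 / 2) * Qinv (2 * ε))|
        ≤ K * (n : ℝ) ^ ((1 : ℝ) / 3) * Real.log n := by
  obtain ⟨q, μ, v, B, h, hB, hV⟩ :=
    exists_balancedPair_of_weaklySymmetric hN hp hpsum hWb hW1a hW1b hW2a hW2b
  obtain ⟨hP, hC, hμ⟩ := h.eq_unifDist hN hPstar hCach hCmax hUniq hC1 hC1gt
  rw [hP] at hV1pos ⊢
  rw [hV] at hV1pos ⊢
  have hv : 0 < v := by linarith
  have hpos : 0 < (μ 0 + μ 1) / 2 := by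
    rcases hμ.lt_or_gt with hlt | hlt
    · linarith [h.mean_nonneg hN 0]
    · linarith [h.mean_nonneg hN 1]
  refine ⟨fun _ => rfl, ?_⟩
  obtain ⟨K1, hK1, hup⟩ := h.eventually_log_le hN hB hv hε
  obtain ⟨K2, hK2, hlow⟩ := h.eventually_exists_code hN hμ hpos hB hv hε
  obtain ⟨n₀, hn₀⟩ := Filter.eventually_atTop.1 (hup.and hlow)
  refine ⟨K1 + K2, by positivity, n₀, fun n hn => ?_⟩
  obtain ⟨hl, hu⟩ := log_MstarF_mem_Icc (hn₀ n hn).1 (hn₀ n hn).2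
  have hsqrt : Real.sqrt (n * (v / 2) / 2) = Real.sqrt (n * v) / 2 := by
    rw [show n * (v / 2) / 2 = n * v / 2 ^ 2 by ring, Real.sqrt_div' _ (by positivity),
      Real.sqrt_sq (by norm_num)]
  have hx : 0 ≤ (n : ℝ) ^ ((1 : ℝ) / 3) * Real.log n :=
    mul_nonneg (Real.rpow_nonneg n.cast_nonneg _) (Real.log_natCast_nonneg n)
  have hx1 := mul_nonneg hK1.le hx
  have hx2 := mul_nonneg hK2.le hx
  rw [hsqrt, hC, mul_assoc, add_mul, abs_le]
  constructor <;> linarith
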